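/- Let Ω be a bounded pseudoconvex domain in ℂ^n and z₀ ∈ ∂Ω. Suppose W ⊂⊂ U are small open neighborhoods of z₀. Then there exists a positive constant C₀ such that I⁰_{U∩Ω}(p) ≤ I⁰_Ω(p) ≤ C₀ · I⁰_{U∩Ω}(p) for all p ∈ W ∩ Ω. -/

import Mathlib

open MeasureTheory Complex Topology Filter Set

noncomputable section

/-! ### Wirtinger derivatives and complex Hessians on ℂⁿ -/

/-- The Wirtinger derivative `∂u/∂z_j` of a function `u : ℂⁿ → ℂ` at `z`. -/
def wder (n : ℕ) (j : Fin n) (u : (Fin n → ℂ) → ℂ) (z : Fin n → ℂ) : ℂ :=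
  (1 / 2) * (fderiv ℝ u z (Pi.single j 1) - Complex.I * fderiv ℝ u z (Pi.single j Complex.I))

/-- The conjugate Wirtinger derivative `∂u/∂z̄_j` of a function `u : ℂⁿ → ℂ` at `z`. -/
def wderBar (n : ℕ) (j : Fin n) (u : (Fin n → ℂ) → ℂ) (z : Fin n → ℂ) : ℂ :=
  (1 / 2) * (fderiv ℝ u z (Pi.single j 1) + Complex.I * fderiv ℝ u z (Pi.single j Complex.I))

/-- The complex Hessian `∂²φ/∂z_j∂z̄_k` of a real-valued function `φ` at `z`. -/
def cHess (n : ℕ) (φ : (Fin n → ℂ) → ℝ) (z : Fin n → ℂ) (j k : Fin n) : ℂ :=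
  wderBar n k (fun w => wder n j (fun v => (φ v : ℂ)) w) z

/-- The (real part of the) Hermitian form `Σ_{j,k} H_{jk} X_j conj (Y_k)`. -/
def hermForm (n : ℕ) (H : Fin n → Fin n → ℂ) (X Y : Fin n → ℂ) : ℝ :=
  (∑ j, ∑ k, H j k * X j * starRingEnd ℂ (Y k)).re

/-! ### The Bergman space, Bergman kernel, minimum integrals -/

/-- Membership in the Bergman space `A²(Ω)`: holomorphic and square-integrable on `Ω`. -/
def InBergman (n : ℕ) (Ω : Set (Fin n → ℂ)) (f : (Fin n → ℂ) → ℂ) : Prop :=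
  DifferentiableOn ℂ f Ω ∧ IntegrableOn (fun z => ‖f z‖ ^ 2) Ω

/-- The squared `L²(Ω)`-norm `∫_Ω |f|²`. -/
def l2sq (n : ℕ) (Ω : Set (Fin n → ℂ)) (f : (Fin n → ℂ) → ℂ) : ℝ :=
  ∫ z in Ω, ‖f z‖ ^ 2

/-- The holomorphic directional derivative `Σ_i X_i ∂f/∂z_i(p)`. -/
def holDeriv (n : ℕ) (f : (Fin n → ℂ) → ℂ) (p X : Fin n → ℂ) : ℂ :=
  ∑ i, X i * fderiv ℂ f p (Pi.single i 1)

/-- The second-order holomorphic derivative `Σ_{j,k} X_j Y_k ∂²f/∂z_j∂z_k(p)`. -/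
def holDeriv2 (n : ℕ) (f : (Fin n → ℂ) → ℂ) (p X Y : Fin n → ℂ) : ℂ :=
  ∑ j, ∑ k, X j * Y k * fderiv ℂ (fun z => fderiv ℂ f z (Pi.single k 1)) p (Pi.single j 1)

/-- Bergman's minimum integral `I⁰_Ω(p)`. -/
def I0 (n : ℕ) (Ω : Set (Fin n → ℂ)) (p : Fin n → ℂ) : ℝ :=
  sInf {r | ∃ f, InBergman n Ω f ∧ f p = 1 ∧ r = l2sq n Ω f}

/-- Bergman's minimum integral `I¹_Ω(p; X)`. -/
def I1 (n : ℕ) (Ω : Set (Fin n → ℂ)) (p X : Fin n → ℂ) : ℝ :=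
  sInf {r | ∃ f, InBergman n Ω f ∧ f p = 0 ∧ holDeriv n f p X = 1 ∧ r = l2sq n Ω f}

/-- Bergman's minimum integral `I²_Ω(p; X, Y)`. -/
def I2 (n : ℕ) (Ω : Set (Fin n → ℂ)) (p X Y : Fin n → ℂ) : ℝ :=
  sInf {r | ∃ f, InBergman n Ω f ∧ f p = 0 ∧ fderiv ℂ f p = 0 ∧
    holDeriv2 n f p X Y = 1 ∧ r = l2sq n Ω f}

/-- The Bergman kernel on the diagonal,
`K_Ω(p, p̄) = sup {|f(p)|² : f ∈ A²(Ω), ‖f‖_{L²(Ω)} ≤ 1}`. -/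
def bergmanKernel (n : ℕ) (Ω : Set (Fin n → ℂ)) (p : Fin n → ℂ) : ℝ :=
  sSup {r | ∃ f, InBergman n Ω f ∧ l2sq n Ω f ≤ 1 ∧ r = ‖f p‖ ^ 2}

/-- The components `g_{jk̄}(z) = ∂² log K_Ω(z,z̄)/∂z_j∂z̄_k` of the Bergman metric. -/
def bergMetricMat (n : ℕ) (Ω : Set (Fin n → ℂ)) (z : Fin n → ℂ) (j k : Fin n) : ℂ :=
  cHess n (fun w => Real.log (bergmanKernel n Ω w)) z j k

/-- The Bergman metric `g_Ω(z; X) = Σ_{j,k} g_{jk̄}(z) X_j X̄_k`. -/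
def bergMetric (n : ℕ) (Ω : Set (Fin n → ℂ)) (z X : Fin n → ℂ) : ℝ :=
  hermForm n (bergMetricMat n Ω z) X X

/-- The inverse matrix `(g^{νμ̄})` of the Bergman metric. -/
def bergMetricInv (n : ℕ) (Ω : Set (Fin n → ℂ)) (z : Fin n → ℂ) : Matrix (Fin n) (Fin n) ℂ :=
  (Matrix.of (bergMetricMat n Ω z))⁻¹

/-- The curvature tensor of the Bergman metric,
`R_{h̄jkl̄} = −∂²g_{jh̄}/∂z_k∂z̄_l + g^{νμ̄} (∂g_{jμ̄}/∂z_k)(∂g_{νh̄}/∂z̄_l)`. -/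
def bergCurvTensor (n : ℕ) (Ω : Set (Fin n → ℂ)) (z : Fin n → ℂ) (h j k l : Fin n) : ℂ :=
  - wderBar n l (fun w => wder n k (fun v => bergMetricMat n Ω v j h) w) z
  + ∑ ν, ∑ μ, bergMetricInv n Ω z ν μ *
      wder n k (fun v => bergMetricMat n Ω v j μ) z *
      wderBar n l (fun v => bergMetricMat n Ω v ν h) z

/-- The bisectional curvature of the Bergman metric,
`B_Ω(z;X,Y) = R_{h̄jkl̄} X̄_h X_j Y_k Ȳ_l / (g(z;X) g(z;Y))`. -/
def bisecCurv (n : ℕ) (Ω : Set (Fin n → ℂ)) (z X Y : Fin n → ℂ) : ℝ :=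
  (∑ h, ∑ j, ∑ k, ∑ l, bergCurvTensor n Ω z h j k l *
      starRingEnd ℂ (X h) * X j * Y k * starRingEnd ℂ (Y l)).re /
    (bergMetric n Ω z X * bergMetric n Ω z Y)

/-- The holomorphic sectional curvature `H_Ω(z;X) = B_Ω(z;X,X)`. -/
def holSecCurv (n : ℕ) (Ω : Set (Fin n → ℂ)) (z X : Fin n → ℂ) : ℝ := bisecCurv n Ω z X X

/-- The Ricci curvature `Ric_Ω(z;X) = Σ_j B_Ω(z;E^j,X)` (standard basis). -/
def ricciCurv (n : ℕ) (Ω : Set (Fin n → ℂ)) (z X : Fin n → ℂ) : ℝ :=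
  ∑ j, bisecCurv n Ω z (Pi.single j 1) X

/-! ### Plurisubharmonicity and pseudoconvexity -/

/-- `u` is plurisubharmonic on `Ω`: upper semicontinuous and satisfying the sub-mean value
inequality on circles in complex lines contained in `Ω`. -/
def PSHOn (n : ℕ) (u : (Fin n → ℂ) → ℝ) (Ω : Set (Fin n → ℂ)) : Prop :=
  UpperSemicontinuousOn u Ω ∧
  ∀ z ∈ Ω, ∀ w : Fin n → ℂ, ∀ r : ℝ, 0 < r →
    (∀ t : ℂ, ‖t‖ ≤ r → z + t • w ∈ Ω) →
    u z ≤ (1 / (2 * Real.pi)) *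
      ∫ θ in (0:ℝ)..(2 * Real.pi), u (z + ((r : ℂ) * Complex.exp ((θ : ℂ) * Complex.I)) • w)

/-- A `C²` function `φ` is plurisubharmonic on `Ω` iff its complex Hessian is
positive semidefinite at every point of `Ω`. -/
def PSHOnC2 (n : ℕ) (φ : (Fin n → ℂ) → ℝ) (Ω : Set (Fin n → ℂ)) : Prop :=
  ∀ z ∈ Ω, ∀ X : Fin n → ℂ, 0 ≤ hermForm n (cHess n φ z) X X

/-- `Ω` is pseudoconvex: it admits a continuous plurisubharmonic exhaustion function. -/
def PseudoconvexExh (n : ℕ) (Ω : Set (Fin n → ℂ)) : Prop :=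
  ∃ u : (Fin n → ℂ) → ℝ, ContinuousOn u Ω ∧ PSHOn n u Ω ∧
    ∀ c : ℝ, ∃ K : Set (Fin n → ℂ), IsCompact K ∧ K ⊆ Ω ∧ {z ∈ Ω | u z ≤ c} ⊆ K

/-! ### Smooth boundary, Levi form, Levi rank -/

/-- `ρ` is a (global) smooth defining function for the domain `Ω`. -/
def IsDefining (n : ℕ) (Ω : Set (Fin n → ℂ)) (ρ : (Fin n → ℂ) → ℝ) : Prop :=
  ContDiff ℝ (⊤ : ℕ∞) ρ ∧ (∀ z ∈ Ω, ρ z < 0) ∧ (∀ z ∈ frontier Ω, ρ z = 0) ∧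
    ∀ z ∈ frontier Ω, fderiv ℝ ρ z ≠ 0

/-- The coefficient `∂ρ/∂z_j(q)` of `∂ρ` (for a real-valued `ρ`). -/
def dzCoef (n : ℕ) (ρ : (Fin n → ℂ) → ℝ) (q : Fin n → ℂ) (j : Fin n) : ℂ :=
  wder n j (fun v => (ρ v : ℂ)) q

/-- The ℂ-linear map `X ↦ Σ_j ∂ρ/∂z_j(q) X_j`. -/
def cTangentMap (n : ℕ) (ρ : (Fin n → ℂ) → ℝ) (q : Fin n → ℂ) : (Fin n → ℂ) →ₗ[ℂ] ℂ :=
  ∑ j, dzCoef n ρ q j • (LinearMap.proj j : (Fin n → ℂ) →ₗ[ℂ] ℂ)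

/-- The complex tangent space `T^{1,0}_q(∂Ω) = {X : Σ_j ∂ρ/∂z_j(q) X_j = 0}`. -/
def cTangent (n : ℕ) (ρ : (Fin n → ℂ) → ℝ) (q : Fin n → ℂ) : Submodule ℂ (Fin n → ℂ) :=
  LinearMap.ker (cTangentMap n ρ q)

/-- The Levi form of `ρ` at `q` is positive semidefinite on the complex tangent space. -/
def LeviPSDAt (n : ℕ) (ρ : (Fin n → ℂ) → ℝ) (q : Fin n → ℂ) : Prop :=
  ∀ X ∈ cTangent n ρ q, 0 ≤ hermForm n (cHess n ρ q) X X

/-- The ℂ-linear map `X ↦ Σ_{j,k} ρ_{jk̄}(q) X_j conj (Y_k)` (Levi pairing against `Y`). -/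
def leviPairMap (n : ℕ) (ρ : (Fin n → ℂ) → ℝ) (q Y : Fin n → ℂ) : (Fin n → ℂ) →ₗ[ℂ] ℂ :=
  ∑ j, (∑ k, cHess n ρ q j k * starRingEnd ℂ (Y k)) • (LinearMap.proj j : (Fin n → ℂ) →ₗ[ℂ] ℂ)

/-- The kernel of the Levi form of `ρ` at `q`, as a Hermitian form on `T^{1,0}_q(∂Ω)`. -/
def leviKernel (n : ℕ) (ρ : (Fin n → ℂ) → ℝ) (q : Fin n → ℂ) : Submodule ℂ (Fin n → ℂ) :=
  cTangent n ρ q ⊓ ⨅ Y ∈ cTangent n ρ q, LinearMap.ker (leviPairMap n ρ q Y)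

/-- The Levi form of `ρ` at `q`, as a Hermitian form on `T^{1,0}_q(∂Ω)`, has rank `l`. -/
def LeviRankAt (n : ℕ) (ρ : (Fin n → ℂ) → ℝ) (q : Fin n → ℂ) (l : ℕ) : Prop :=
  Module.finrank ℂ ↥(cTangent n ρ q) - Module.finrank ℂ ↥(leviKernel n ρ q) = l

/-! ### Test functions, polydiscs, Euclidean norms, biholomorphisms -/

/-- A smooth test function compactly supported in `Ω`. -/
def IsTestFun (n : ℕ) (ψ : (Fin n → ℂ) → ℂ) (Ω : Set (Fin n → ℂ)) : Prop :=
  ContDiff ℝ (⊤ : ℕ∞) ψ ∧ HasCompactSupport ψ ∧ tsupport ψ ⊆ Ω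

/-- The polydisc `P(c, β) = {z : |z_j − c_j| < β_j for all j}`. -/
def polydisc (n : ℕ) (c : Fin n → ℂ) (β : Fin n → ℝ) : Set (Fin n → ℂ) :=
  {z | ∀ j, ‖z j - c j‖ < β j}

/-- The Euclidean norm of the components of `ζ` indexed by `s`. -/
def eucNormOn (n : ℕ) (s : Finset (Fin n)) (ζ : Fin n → ℂ) : ℝ :=
  Real.sqrt (∑ j ∈ s, ‖ζ j‖ ^ 2)

/-- The Euclidean ball of radius `r` centered at the origin in ℂⁿ. -/
def eball (n : ℕ) (r : ℝ) : Set (Fin n → ℂ) :=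
  {ζ | eucNormOn n Finset.univ ζ < r}

/-- `f` is a biholomorphism from `A` onto `B`. -/
def Biholo (n : ℕ) (f : (Fin n → ℂ) → (Fin n → ℂ)) (A B : Set (Fin n → ℂ)) : Prop :=
  DifferentiableOn ℂ f A ∧ Set.BijOn f A B ∧
    ∃ g, DifferentiableOn ℂ g B ∧ ∀ z ∈ A, g (f z) = z

/-- The determinant of the complex Jacobian of `f` at `p`. -/
def cJacDet (n : ℕ) (f : (Fin n → ℂ) → (Fin n → ℂ)) (p : Fin n → ℂ) : ℂ :=
  LinearMap.det ((fderiv ℂ f p).toLinearMap)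

/-! ### Mixed derivatives `D^α` in the variables `z_j`, `z̄_j` -/

/-- The multi-index `α : Fin n → ℕ` recording how many of the directions `ι i` hit slot `j`. -/
def multiIdxOf (n : ℕ) {m : ℕ} (ι : Fin m → Fin n) : Fin n → ℕ :=
  fun j => (Finset.univ.filter fun i => ι i = j).card

/-- All mixed derivatives `D^α φ` of total order `≤ mmax`, where in each slot `j` one may
differentiate in the real directions underlying `z_j` and `z̄_j` (i.e. `e_j` and `i·e_j`),
are bounded on `P` by `bound α`. -/
def MixedDerivBound (n : ℕ) (φ : (Fin n → ℂ) → ℝ) (P : Set (Fin n → ℂ))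
    (mmax : ℕ) (bound : (Fin n → ℕ) → ℝ) : Prop :=
  ∀ m : ℕ, m ≤ mmax → ∀ ι : Fin m → Fin n, ∀ ε : Fin m → ℂ,
    (∀ i, ε i = 1 ∨ ε i = Complex.I) → ∀ z ∈ P,
      ‖iteratedFDeriv ℝ m φ z (fun i => Pi.single (ι i) (ε i))‖ ≤ bound (multiIdxOf n ι)

/-- All mixed derivatives `D^α φ` (of any order) are bounded on `P` by `bound α`. -/
def MixedDerivBoundAll (n : ℕ) (φ : (Fin n → ℂ) → ℝ) (P : Set (Fin n → ℂ))
    (bound : (Fin n → ℕ) → ℝ) : Prop :=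
  ∀ m : ℕ, ∀ ι : Fin m → Fin n, ∀ ε : Fin m → ℂ,
    (∀ i, ε i = 1 ∨ ε i = Complex.I) → ∀ z ∈ P,
      ‖iteratedFDeriv ℝ m φ z (fun i => Pi.single (ι i) (ε i))‖ ≤ bound (multiIdxOf n ι)

/-! ### Fu's centering maps and normal forms (constant Levi rank `l`) -/

/-- Lean indices `1,…,l`, i.e. the coordinates `ζ_2,…,ζ_{l+1}` (the block `ζ'`). -/
def primIdx (n l : ℕ) : Finset (Fin n) := Finset.univ.filter fun j => 1 ≤ j.val ∧ j.val ≤ l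

/-- Lean indices `l+1,…,n−1`, i.e. the coordinates `ζ_{l+2},…,ζ_n` (the block `ζ''`). -/
def dprimIdx (n l : ℕ) : Finset (Fin n) := Finset.univ.filter fun j => l + 1 ≤ j.val

/-- Lean indices `1,…,n−l−1`, i.e. the coordinates `ζ_2,…,ζ_{n−l}`. -/
def midIdx (n l : ℕ) : Finset (Fin n) :=
  Finset.univ.filter fun j => 1 ≤ j.val ∧ j.val ≤ n - l - 1

/-- Lean indices `n−l,…,n−1`, i.e. the coordinates `ζ_{n−l+1},…,ζ_n`. -/
def tailIdx (n l : ℕ) : Finset (Fin n) := Finset.univ.filter fun j => n - l ≤ j.val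

/-- `ρ` is a smooth local defining function for the real hypersurface `S` near `0`
(on the Euclidean ball of radius `ε`). -/
def IsLocalDefining (n : ℕ) (S : Set (Fin n → ℂ)) (ρ : (Fin n → ℂ) → ℝ) (ε : ℝ) : Prop :=
  ContDiffOn ℝ (⊤ : ℕ∞) ρ (eball n ε) ∧
    S ∩ eball n ε = {ζ ∈ eball n ε | ρ ζ = 0} ∧
    ∀ ζ ∈ S ∩ eball n ε, fderiv ℝ ρ ζ ≠ 0

/-- `ρ(ζ) = Re ζ₁ + Σ_{j=2}^{l+1} λ_j |ζ_j|² + O(|ζ'|²·|ζ''| + |ζ'|³ + |Im ζ₁|·|ζ|)` near `0`. -/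
def NormalForm (n l : ℕ) [NeZero n] (lam : Fin n → ℝ) (ρ : (Fin n → ℂ) → ℝ) (ε : ℝ) : Prop :=
  ∃ C > (0:ℝ), ∀ ζ ∈ eball n ε,
    |ρ ζ - ((ζ 0).re + ∑ j ∈ primIdx n l, lam j * ‖ζ j‖ ^ 2)| ≤
      C * ((eucNormOn n (primIdx n l) ζ) ^ 2 * eucNormOn n (dprimIdx n l) ζ +
        (eucNormOn n (primIdx n l) ζ) ^ 3 + |(ζ 0).im| * eucNormOn n Finset.univ ζ)

/-- Fu's centering data near a boundary point: for each `q ∈ U ∩ ∂Ω`, `Φ q` is a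
biholomorphism of `U` onto the unit ball with `Φ q q = 0`, depending smoothly on `q`,
such that `Φ q (U ∩ ∂Ω)` has, near `0`, a defining function `ρloc q` in normal form with
positive coefficients `lam q j` (for `j` in the block `ζ'`) depending smoothly on `q`. -/
def CenteringData (n l : ℕ) [NeZero n] (Ω U : Set (Fin n → ℂ))
    (Φ : (Fin n → ℂ) → (Fin n → ℂ) → (Fin n → ℂ))
    (lam : (Fin n → ℂ) → Fin n → ℝ)
    (ρloc : (Fin n → ℂ) → (Fin n → ℂ) → ℝ) (ε : ℝ) : Prop :=
  ContDiffOn ℝ (⊤ : ℕ∞) (fun pq : (Fin n → ℂ) × (Fin n → ℂ) => Φ pq.1 pq.2)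
      ((U ∩ frontier Ω) ×ˢ U) ∧
  (∀ j : Fin n, ContDiffOn ℝ (⊤ : ℕ∞) (fun q => lam q j) (U ∩ frontier Ω)) ∧
  ∀ q ∈ U ∩ frontier Ω,
    Φ q q = 0 ∧ Biholo n (Φ q) U (eball n 1) ∧
    (∀ j ∈ primIdx n l, 0 < lam q j) ∧
    IsLocalDefining n (Φ q '' (U ∩ frontier Ω)) (ρloc q) ε ∧
    NormalForm n l (lam q) (ρloc q) ε

/-- Fu's polydisc-type region
`P_{δ,a} = {ζ : |ζ₁| < aδ, |ζ_j| < aδ^{1/2} (2 ≤ j ≤ n−l), |ζ_k| < a (n−l+1 ≤ k ≤ n)}`. -/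
def PdaSet (n l : ℕ) [NeZero n] (δ a : ℝ) : Set (Fin n → ℂ) :=
  {ζ | ‖ζ 0‖ < a * δ ∧ (∀ j ∈ midIdx n l, ‖ζ j‖ < a * Real.sqrt δ) ∧
    ∀ j ∈ tailIdx n l, ‖ζ j‖ < a}

/-! ### Finite type in the sense of D'Angelo -/

/-- `h` vanishes to order at least `k` at `0`. -/
def vanishGe (E : Type*) [Norm E] (h : ℂ → E) (k : ℕ) : Prop :=
  ∃ C > (0:ℝ), ∃ ε > (0:ℝ), ∀ t : ℂ, ‖t‖ < ε → ‖h t‖ ≤ C * ‖t‖ ^ k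

/-- The vanishing order of `h` at `0`, as an extended natural number. -/
def vOrder (E : Type*) [Norm E] (h : ℂ → E) : ℕ∞ :=
  sSup ((fun k : ℕ => (k : ℕ∞)) '' {k | vanishGe E h k})

/-- `z₀ ∈ ∂Ω` is a point of finite type in the sense of D'Angelo (w.r.t. the defining
function `ρ`): the order of contact of `∂Ω` with nonconstant holomorphic curves through
`z₀` is uniformly bounded. -/
def FiniteTypeAt (n : ℕ) (ρ : (Fin n → ℂ) → ℝ) (z₀ : Fin n → ℂ) : Prop :=
  ∃ T : ℕ, ∀ γ : ℂ → (Fin n → ℂ), AnalyticAt ℂ γ 0 → γ 0 = z₀ →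
    ¬ (∀ᶠ t in 𝓝 (0:ℂ), γ t = z₀) →
    vOrder ℝ (fun t => ρ (γ t)) ≤ (T : ℕ∞) * vOrder (Fin n → ℂ) (fun t => γ t - z₀)

end

section

open scoped ENNReal

section Wirtinger

variable {n : ℕ}

theorem wderBar_mul (j : Fin n) {u v : (Fin n → ℂ) → ℂ} {z : Fin n → ℂ}
    (hu : DifferentiableAt ℝ u z) (hv : DifferentiableAt ℝ v z) :
    wderBar n j (fun w => u w * v w) z = wderBar n j u z * v z + u z * wderBar n j v z := by
  simp only [wderBar]
  rw [fderiv_fun_mul hu hv]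
  simp only [add_apply, smul_apply, smul_eq_mul]
  ring

theorem wder_mul (j : Fin n) {u v : (Fin n → ℂ) → ℂ} {z : Fin n → ℂ}
    (hu : DifferentiableAt ℝ u z) (hv : DifferentiableAt ℝ v z) :
    wder n j (fun w => u w * v w) z = wder n j u z * v z + u z * wder n j v z := by
  simp only [wder]
  rw [fderiv_fun_mul hu hv]
  simp only [add_apply, smul_apply, smul_eq_mul]
  ring

theorem wderBar_sub (j : Fin n) {u v : (Fin n → ℂ) → ℂ} {z : Fin n → ℂ}
    (hu : DifferentiableAt ℝ u z) (hv : DifferentiableAt ℝ v z) :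
    wderBar n j (fun w => u w - v w) z = wderBar n j u z - wderBar n j v z := by
  simp only [wderBar]
  rw [fderiv_fun_sub hu hv]
  simp only [sub_apply]
  ring

theorem wderBar_add (j : Fin n) {u v : (Fin n → ℂ) → ℂ} {z : Fin n → ℂ}
    (hu : DifferentiableAt ℝ u z) (hv : DifferentiableAt ℝ v z) :
    wderBar n j (fun w => u w + v w) z = wderBar n j u z + wderBar n j v z := by
  simp only [wderBar]
  rw [fderiv_fun_add hu hv]
  simp only [add_apply]
  ring

theorem wderBar_const_mul (j : Fin n) {u : (Fin n → ℂ) → ℂ} {z : Fin n → ℂ} (c : ℂ)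
    (hu : DifferentiableAt ℝ u z) :
    wderBar n j (fun w => c * u w) z = c * wderBar n j u z := by
  simp only [wderBar]
  rw [fderiv_const_mul hu]
  simp only [smul_apply, smul_eq_mul]
  ring

theorem fderiv_conj_apply (u : (Fin n → ℂ) → ℂ) (z v : Fin n → ℂ) :
    fderiv ℝ (fun w => starRingEnd ℂ (u w)) z v = starRingEnd ℂ (fderiv ℝ u z v) := by
  have := Complex.conjCLE.comp_fderiv (f := u) (x := z)
  have h2 := congrArg (fun L => L v) this
  simpa [Function.comp_def] using h2

theorem wder_conj (j : Fin n) (u : (Fin n → ℂ) → ℂ) (z : Fin n → ℂ) :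
    wder n j (fun w => starRingEnd ℂ (u w)) z = starRingEnd ℂ (wderBar n j u z) := by
  simp only [wderBar, wder, fderiv_conj_apply, map_mul, map_add, conj_I, map_div₀, map_one,
    map_ofNat]
  ring

theorem contDiff_wderBar (j : Fin n) {u : (Fin n → ℂ) → ℂ} {m k : WithTop ℕ∞}
    (hu : ContDiff ℝ k u) (hm : m + 1 ≤ k) : ContDiff ℝ m (wderBar n j u) := by
  have h := hu.fderiv_right hm
  unfold wderBar
  exact contDiff_const.mul ((h.clm_apply contDiff_const).add
    (contDiff_const.mul (h.clm_apply contDiff_const)))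

theorem contDiff_wder (j : Fin n) {u : (Fin n → ℂ) → ℂ} {m k : WithTop ℕ∞}
    (hu : ContDiff ℝ k u) (hm : m + 1 ≤ k) : ContDiff ℝ m (wder n j u) := by
  have h := hu.fderiv_right hm
  unfold wder
  exact contDiff_const.mul ((h.clm_apply contDiff_const).sub
    (contDiff_const.mul (h.clm_apply contDiff_const)))

theorem wderBar_eq_zero_of_notMem (j : Fin n) {u : (Fin n → ℂ) → ℂ} {z : Fin n → ℂ}
    (hz : z ∉ tsupport u) : wderBar n j u z = 0 := by
  have : fderiv ℝ u z = 0 := by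
    by_contra h
    exact hz (support_fderiv_subset ℝ h)
  simp [wderBar, this]

theorem wder_eq_zero_of_notMem (j : Fin n) {u : (Fin n → ℂ) → ℂ} {z : Fin n → ℂ}
    (hz : z ∉ tsupport u) : wder n j u z = 0 := by
  have : fderiv ℝ u z = 0 := by
    by_contra h
    exact hz (support_fderiv_subset ℝ h)
  simp [wder, this]

theorem tsupport_wderBar_subset (j : Fin n) (u : (Fin n → ℂ) → ℂ) :
    tsupport (wderBar n j u) ⊆ tsupport u :=
  closure_minimal (fun _ hz => by_contra fun h => hz (wderBar_eq_zero_of_notMem j h))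
    (isClosed_tsupport u)

theorem tsupport_wder_subset (j : Fin n) (u : (Fin n → ℂ) → ℂ) :
    tsupport (wder n j u) ⊆ tsupport u :=
  closure_minimal (fun _ hz => by_contra fun h => hz (wder_eq_zero_of_notMem j h))
    (isClosed_tsupport u)

theorem HasCompactSupport.wderBar (j : Fin n) {u : (Fin n → ℂ) → ℂ} (hu : HasCompactSupport u) :
    HasCompactSupport (wderBar n j u) :=
  hu.of_isClosed_subset (isClosed_tsupport _) (tsupport_wderBar_subset j u)

theorem HasCompactSupport.wder (j : Fin n) {u : (Fin n → ℂ) → ℂ} (hu : HasCompactSupport u) :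
    HasCompactSupport (wder n j u) :=
  hu.of_isClosed_subset (isClosed_tsupport _) (tsupport_wder_subset j u)

theorem wderBar_congr (j : Fin n) {u v : (Fin n → ℂ) → ℂ} {z : Fin n → ℂ}
    (h : u =ᶠ[𝓝 z] v) : wderBar n j u z = wderBar n j v z := by
  simp [wderBar, h.fderiv_eq]

theorem fderiv_fderiv_apply {u : (Fin n → ℂ) → ℂ} (hu : ContDiff ℝ 2 u) (z a b : Fin n → ℂ) :
    fderiv ℝ (fun w => fderiv ℝ u w a) z b = fderiv ℝ (fderiv ℝ u) z b a := by
  have h : DifferentiableAt ℝ (fderiv ℝ u) z :=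
    ((hu.fderiv_right (m := 1) (by norm_num)).differentiable (by norm_num)) z
  rw [fderiv_clm_apply h (by fun_prop)]
  simp

theorem fderiv_fderiv_comm {u : (Fin n → ℂ) → ℂ} (hu : ContDiff ℝ 2 u) (z a b : Fin n → ℂ) :
    fderiv ℝ (fderiv ℝ u) z a b = fderiv ℝ (fderiv ℝ u) z b a :=
  (hu.contDiffAt.isSymmSndFDerivAt (by simp)) a b

theorem fderiv_wder {u : (Fin n → ℂ) → ℂ} (hu : ContDiff ℝ 2 u) (j : Fin n) (z b : Fin n → ℂ) :
    fderiv ℝ (wder n j u) z b = (1 / 2) * (fderiv ℝ (fderiv ℝ u) z b (Pi.single j 1)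
      - Complex.I * fderiv ℝ (fderiv ℝ u) z b (Pi.single j Complex.I)) := by
  have h (a : Fin n → ℂ) : DifferentiableAt ℝ (fun w => fderiv ℝ u w a) z :=
    (((hu.fderiv_right (m := 1) (by norm_num)).clm_apply contDiff_const).differentiable
      (by norm_num)) z
  unfold wder
  rw [fderiv_const_mul ((h _).fun_sub ((h _).const_mul _)),
    fderiv_fun_sub (h _) ((h _).const_mul _), fderiv_const_mul (h _)]
  simp only [smul_apply, sub_apply, smul_eq_mul,
    fderiv_fderiv_apply hu]

theorem fderiv_wderBar {u : (Fin n → ℂ) → ℂ} (hu : ContDiff ℝ 2 u) (j : Fin n)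
    (z b : Fin n → ℂ) :
    fderiv ℝ (wderBar n j u) z b = (1 / 2) * (fderiv ℝ (fderiv ℝ u) z b (Pi.single j 1)
      + Complex.I * fderiv ℝ (fderiv ℝ u) z b (Pi.single j Complex.I)) := by
  have h (a : Fin n → ℂ) : DifferentiableAt ℝ (fun w => fderiv ℝ u w a) z :=
    (((hu.fderiv_right (m := 1) (by norm_num)).clm_apply contDiff_const).differentiable
      (by norm_num)) z
  unfold wderBar
  rw [fderiv_const_mul ((h _).fun_add ((h _).const_mul _)),
    fderiv_fun_add (h _) ((h _).const_mul _), fderiv_const_mul (h _)]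
  simp only [smul_apply, add_apply, smul_eq_mul,
    fderiv_fderiv_apply hu]

theorem wderBar_wder_comm {u : (Fin n → ℂ) → ℂ} (hu : ContDiff ℝ 2 u) (j k : Fin n)
    (z : Fin n → ℂ) : wderBar n j (wder n k u) z = wder n k (wderBar n j u) z := by
  rw [wderBar, wder, fderiv_wder hu, fderiv_wder hu, fderiv_wderBar hu, fderiv_wderBar hu,
    fderiv_fderiv_comm hu z (Pi.single k 1), fderiv_fderiv_comm hu z (Pi.single k 1),
    fderiv_fderiv_comm hu z (Pi.single k I), fderiv_fderiv_comm hu z (Pi.single k I)]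
  ring

theorem wderBar_wderBar_comm {u : (Fin n → ℂ) → ℂ} (hu : ContDiff ℝ 2 u) (j k : Fin n)
    (z : Fin n → ℂ) : wderBar n j (wderBar n k u) z = wderBar n k (wderBar n j u) z := by
  rw [wderBar, wderBar, fderiv_wderBar hu, fderiv_wderBar hu, fderiv_wderBar hu,
    fderiv_wderBar hu,
    fderiv_fderiv_comm hu z (Pi.single k 1), fderiv_fderiv_comm hu z (Pi.single k 1),
    fderiv_fderiv_comm hu z (Pi.single k I), fderiv_fderiv_comm hu z (Pi.single k I)]
  ring

/-- Integration by parts in a real direction. -/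
theorem integral_fderiv_mul_eq_neg {u v : (Fin n → ℂ) → ℂ} (hu : ContDiff ℝ 1 u)
    (hv : ContDiff ℝ 1 v) (hc : HasCompactSupport u ∨ HasCompactSupport v) (a : Fin n → ℂ) :
    Integrable (fun z => fderiv ℝ u z a * v z) ∧ Integrable (fun z => u z * fderiv ℝ v z a) ∧
    ∫ z, fderiv ℝ u z a * v z = - ∫ z, u z * fderiv ℝ v z a := by
  have hu' : Continuous (fun z => fderiv ℝ u z a) :=
    (hu.continuous_fderiv (by norm_num)).clm_apply continuous_const
  have hv' : Continuous (fun z => fderiv ℝ v z a) :=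
    (hv.continuous_fderiv (by norm_num)).clm_apply continuous_const
  have hI1 : Integrable (fun z => fderiv ℝ u z a * v z) := by
    refine (hu'.mul hv.continuous).integrable_of_hasCompactSupport ?_
    rcases hc with h | h
    · exact (h.fderiv_apply (𝕜 := ℝ) a).mul_right
    · exact h.mul_left
  have hI2 : Integrable (fun z => u z * fderiv ℝ v z a) := by
    refine (hu.continuous.mul hv').integrable_of_hasCompactSupport ?_
    rcases hc with h | h
    · exact h.mul_right
    · exact (h.fderiv_apply (𝕜 := ℝ) a).mul_left
  have hI3 : Integrable (fun z => u z * v z) := by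
    refine (hu.continuous.mul hv.continuous).integrable_of_hasCompactSupport ?_
    rcases hc with h | h
    · exact h.mul_right
    · exact h.mul_left
  refine ⟨hI1, hI2, ?_⟩
  rw [integral_mul_fderiv_eq_neg_fderiv_mul_of_integrable hI1 hI2 hI3
    (fun x _ => hu.differentiable (by norm_num) x) (fun x _ => hv.differentiable (by norm_num) x),
    neg_neg]

theorem integral_wderBar_mul {u v : (Fin n → ℂ) → ℂ} (hu : ContDiff ℝ 1 u)
    (hv : ContDiff ℝ 1 v) (hc : HasCompactSupport u ∨ HasCompactSupport v) (j : Fin n) :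
    ∫ z, wderBar n j u z * v z = - ∫ z, u z * wderBar n j v z := by
  obtain ⟨a1, a2, a3⟩ := integral_fderiv_mul_eq_neg hu hv hc (Pi.single j 1)
  obtain ⟨b1, b2, b3⟩ := integral_fderiv_mul_eq_neg hu hv hc (Pi.single j Complex.I)
  have e1 : (fun z => wderBar n j u z * v z) = fun z =>
      (1 / 2 : ℂ) * (fderiv ℝ u z (Pi.single j 1) * v z) +
      (1 / 2 * Complex.I) * (fderiv ℝ u z (Pi.single j Complex.I) * v z) := by
    ext z; simp only [wderBar]; ring
  have e2 : (fun z => u z * wderBar n j v z) = fun z =>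
      (1 / 2 : ℂ) * (u z * fderiv ℝ v z (Pi.single j 1)) +
      (1 / 2 * Complex.I) * (u z * fderiv ℝ v z (Pi.single j Complex.I)) := by
    ext z; simp only [wderBar]; ring
  rw [e1, e2, integral_add (a1.const_mul _) (b1.const_mul _),
    integral_add (a2.const_mul _) (b2.const_mul _)]
  simp only [integral_const_mul, a3, b3]
  ring

theorem integral_wder_mul {u v : (Fin n → ℂ) → ℂ} (hu : ContDiff ℝ 1 u)
    (hv : ContDiff ℝ 1 v) (hc : HasCompactSupport u ∨ HasCompactSupport v) (j : Fin n) :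
    ∫ z, wder n j u z * v z = - ∫ z, u z * wder n j v z := by
  obtain ⟨a1, a2, a3⟩ := integral_fderiv_mul_eq_neg hu hv hc (Pi.single j 1)
  obtain ⟨b1, b2, b3⟩ := integral_fderiv_mul_eq_neg hu hv hc (Pi.single j Complex.I)
  have e1 : (fun z => wder n j u z * v z) = fun z =>
      (1 / 2 : ℂ) * (fderiv ℝ u z (Pi.single j 1) * v z) -
      (1 / 2 * Complex.I) * (fderiv ℝ u z (Pi.single j Complex.I) * v z) := by
    ext z; simp only [wder]; ring
  have e2 : (fun z => u z * wder n j v z) = fun z =>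
      (1 / 2 : ℂ) * (u z * fderiv ℝ v z (Pi.single j 1)) -
      (1 / 2 * Complex.I) * (u z * fderiv ℝ v z (Pi.single j Complex.I)) := by
    ext z; simp only [wder]; ring
  rw [e1, e2, integral_sub (a1.const_mul _) (b1.const_mul _),
    integral_sub (a2.const_mul _) (b2.const_mul _)]
  simp only [integral_const_mul, a3, b3]
  ring

end Wirtinger

section BasicIdentity

variable {n : ℕ}

/-- The formal adjoint operator `∂_j - Φ_j` for the weight `exp (-Φ)`. -/
noncomputable def wtDer (n : ℕ) (Φ : (Fin n → ℂ) → ℝ) (j : Fin n) (u : (Fin n → ℂ) → ℂ)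
    (z : Fin n → ℂ) : ℂ :=
  wder n j u z - wder n j (fun v => (Φ v : ℂ)) z * u z

theorem contDiff_ofReal_comp {Φ : (Fin n → ℂ) → ℝ} {k : WithTop ℕ∞} (h : ContDiff ℝ k Φ) :
    ContDiff ℝ k (fun z => (Φ z : ℂ)) :=
  Complex.ofRealCLM.contDiff.comp h

theorem contDiff_conj_comp {u : (Fin n → ℂ) → ℂ} {k : WithTop ℕ∞} (h : ContDiff ℝ k u) :
    ContDiff ℝ k (fun z => starRingEnd ℂ (u z)) :=
  Complex.conjCLE.contDiff.comp h

theorem contDiff_weight {Φ : (Fin n → ℂ) → ℝ} {k : WithTop ℕ∞} (h : ContDiff ℝ k Φ) :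
    ContDiff ℝ k (fun z => (Real.exp (-Φ z) : ℂ)) :=
  contDiff_ofReal_comp (Real.contDiff_exp.comp h.neg)

theorem wder_weight {Φ : (Fin n → ℂ) → ℝ} (h : ContDiff ℝ 1 Φ) (j : Fin n) (z : Fin n → ℂ) :
    wder n j (fun w => (Real.exp (-Φ w) : ℂ)) z =
      -(wder n j (fun v => (Φ v : ℂ)) z * Real.exp (-Φ z)) := by
  have h0 : DifferentiableAt ℝ (fun v => (Φ v : ℂ)) z :=
    (contDiff_ofReal_comp h).differentiable (by norm_num) z
  have h1 : HasFDerivAt (fun w => (Real.exp (-Φ w) : ℂ))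
      (Complex.exp (-(Φ z : ℂ)) • (-(fderiv ℝ (fun v => (Φ v : ℂ)) z))) z := by
    have := (h0.hasFDerivAt.neg).cexp
    simpa [Complex.ofReal_exp] using this
  simp only [wder]
  rw [h1.fderiv]
  simp only [smul_apply, neg_apply, smul_eq_mul, Complex.ofReal_exp, Complex.ofReal_neg]
  ring

theorem contDiff_wtDer {Φ : (Fin n → ℂ) → ℝ} (h : ContDiff ℝ 2 Φ) (j : Fin n)
    {u : (Fin n → ℂ) → ℂ} (hu : ContDiff ℝ 2 u) : ContDiff ℝ 1 (wtDer n Φ j u) :=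
  (contDiff_wder j hu (by norm_num)).sub
    ((contDiff_wder j (contDiff_ofReal_comp h) (by norm_num)).mul (hu.of_le (by norm_num)))

theorem wder_mul_weight {Φ : (Fin n → ℂ) → ℝ} (h : ContDiff ℝ 1 Φ) (j : Fin n)
    {u : (Fin n → ℂ) → ℂ} (hu : ContDiff ℝ 1 u) (z : Fin n → ℂ) :
    wder n j (fun w => u w * Real.exp (-Φ w)) z = wtDer n Φ j u z * Real.exp (-Φ z) := by
  rw [wder_mul j (hu.differentiable (by norm_num) z)
    ((contDiff_weight h).differentiable (by norm_num) z), wder_weight h, wtDer]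
  ring

theorem integral_wtDer_mul_conj {Φ : (Fin n → ℂ) → ℝ} (h : ContDiff ℝ 1 Φ) (j : Fin n)
    {u v : (Fin n → ℂ) → ℂ} (hu : ContDiff ℝ 1 u) (hv : ContDiff ℝ 1 v)
    (hc : HasCompactSupport u ∨ HasCompactSupport v) :
    ∫ z, wtDer n Φ j u z * starRingEnd ℂ (v z) * Real.exp (-Φ z) =
      -∫ z, u z * starRingEnd ℂ (wderBar n j v z) * Real.exp (-Φ z) := by
  have key := integral_wder_mul (u := fun w => u w * Real.exp (-Φ w))
    (v := fun z => starRingEnd ℂ (v z)) (hu.mul (contDiff_weight h)) (contDiff_conj_comp hv)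
    (hc.imp (fun h => h.mul_right) (fun h => h.comp_left (map_zero _))) j
  simp only [wder_mul_weight h j hu, wder_conj] at key
  calc _ = _ := by congr 1; ext z; ring
    _ = _ := key
    _ = _ := by congr 2; ext z; ring

theorem integral_mul_conj_wtDer {Φ : (Fin n → ℂ) → ℝ} (h : ContDiff ℝ 1 Φ) (j : Fin n)
    {u v : (Fin n → ℂ) → ℂ} (hu : ContDiff ℝ 1 u) (hv : ContDiff ℝ 1 v)
    (hc : HasCompactSupport u ∨ HasCompactSupport v) :
    ∫ z, u z * starRingEnd ℂ (wtDer n Φ j v z) * Real.exp (-Φ z) =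
      -∫ z, wderBar n j u z * starRingEnd ℂ (v z) * Real.exp (-Φ z) := by
  have key := congrArg (starRingEnd ℂ) (integral_wtDer_mul_conj h j hv hu hc.symm)
  rw [map_neg, ← integral_conj, ← integral_conj] at key
  simp only [map_mul, Complex.conj_conj, Complex.conj_ofReal] at key
  calc _ = _ := by congr 1; ext z; ring
    _ = _ := key
    _ = _ := by congr 2; ext z; ring

theorem wderBar_wtDer {Φ : (Fin n → ℂ) → ℝ} (h : ContDiff ℝ 2 Φ) (j k : Fin n)
    {u : (Fin n → ℂ) → ℂ} (hu : ContDiff ℝ 2 u) (z : Fin n → ℂ) :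
    wderBar n k (wtDer n Φ j u) z = wtDer n Φ j (wderBar n k u) z - cHess n Φ z j k * u z := by
  have h1 : DifferentiableAt ℝ (wder n j (fun v => (Φ v : ℂ))) z :=
    (contDiff_wder (m := 1) j (contDiff_ofReal_comp h) (by norm_num)).differentiable
      (by norm_num) z
  have h2 : DifferentiableAt ℝ (wder n j u) z :=
    (contDiff_wder (m := 1) j hu (by norm_num)).differentiable (by norm_num) z
  have h3 := hu.differentiable (by norm_num) z
  unfold wtDer cHess
  rw [wderBar_sub k h2 (h1.fun_mul h3), wderBar_mul k h1 h3, wderBar_wder_comm hu]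
  ring

theorem integral_wtDer_mul_conj_wtDer {Φ : (Fin n → ℂ) → ℝ} (h : ContDiff ℝ 2 Φ) (j k : Fin n)
    {u v : (Fin n → ℂ) → ℂ} (hu : ContDiff ℝ 2 u) (hv : ContDiff ℝ 2 v)
    (hcv : HasCompactSupport v) :
    ∫ z, wtDer n Φ j u z * starRingEnd ℂ (wtDer n Φ k v z) * Real.exp (-Φ z) =
      (∫ z, wderBar n k u z * starRingEnd ℂ (wderBar n j v z) * Real.exp (-Φ z)) +
      ∫ z, cHess n Φ z j k * u z * starRingEnd ℂ (v z) * Real.exp (-Φ z) := by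
  have hΦ1 : ContDiff ℝ 1 Φ := h.of_le (by norm_num)
  have hv1 : ContDiff ℝ 1 v := hv.of_le (by norm_num)
  have hub : ContDiff ℝ 1 (wderBar n k u) := contDiff_wderBar k hu (by norm_num)
  rw [integral_mul_conj_wtDer hΦ1 k (contDiff_wtDer h j hu) hv1 (Or.inr hcv)]
  have e : ∀ z, wderBar n k (wtDer n Φ j u) z * starRingEnd ℂ (v z) * Real.exp (-Φ z) =
      wtDer n Φ j (wderBar n k u) z * starRingEnd ℂ (v z) * Real.exp (-Φ z) -
      cHess n Φ z j k * u z * starRingEnd ℂ (v z) * Real.exp (-Φ z) := fun z => by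
    rw [wderBar_wtDer h j k hu]; ring
  have hcv' : HasCompactSupport (fun z => starRingEnd ℂ (v z)) := hcv.comp_left (map_zero _)
  have cW : Continuous (fun z => (Real.exp (-Φ z) : ℂ)) := (contDiff_weight h).continuous
  have cv : Continuous (fun z => starRingEnd ℂ (v z)) := (contDiff_conj_comp hv).continuous
  have cH : Continuous (fun z => cHess n Φ z j k) :=
    (contDiff_wderBar (m := 0) k (contDiff_wder (m := 1) j (contDiff_ofReal_comp h)
      (by norm_num)) (by norm_num)).continuous
  have cD : Continuous (wtDer n Φ j (wderBar n k u)) := by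
    unfold wtDer
    exact (contDiff_wder (m := 0) j hub (by norm_num)).continuous.sub
      ((contDiff_wder (m := 0) j (contDiff_ofReal_comp hΦ1) (by norm_num)).continuous.mul
        hub.continuous)
  simp only [e]
  rw [integral_sub, integral_wtDer_mul_conj hΦ1 j hub hv1 (Or.inr hcv)]
  · ring
  · exact ((cD.mul cv).mul cW).integrable_of_hasCompactSupport hcv'.mul_left.mul_right
  · exact (((cH.mul hu.continuous).mul cv).mul cW).integrable_of_hasCompactSupport
      hcv'.mul_left.mul_right

theorem sum_sum_re_mul_conj_ge (a : Fin n → Fin n → ℂ) :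
    -(1 / 2) * ∑ j, ∑ k, ‖a k j - a j k‖ ^ 2 ≤
      ∑ j, ∑ k, (a k j * starRingEnd ℂ (a j k)).re := by
  have h1 : ∀ j k, ‖a k j - a j k‖ ^ 2 = ‖a k j‖ ^ 2 + ‖a j k‖ ^ 2
      - 2 * (a k j * starRingEnd ℂ (a j k)).re := fun j k => by
    simp only [← Complex.normSq_eq_norm_sq, Complex.normSq_apply, Complex.sub_re, Complex.sub_im,
      Complex.mul_re, Complex.conj_re, Complex.conj_im]
    ring
  have h2 : 0 ≤ ∑ j, ∑ k, ‖a k j‖ ^ 2 := by positivity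
  have h3 : 0 ≤ ∑ j, ∑ k, ‖a j k‖ ^ 2 := by positivity
  simp only [h1, Finset.sum_sub_distrib, Finset.sum_add_distrib, ← Finset.mul_sum]
  linarith

theorem integrable_sum_sum_re {f : Fin n → Fin n → (Fin n → ℂ) → ℂ}
    (hf : ∀ j k, Integrable (f j k)) : Integrable (fun z => ∑ j, ∑ k, (f j k z).re) :=
  integrable_finsetSum _ fun j _ => integrable_finsetSum _ fun k _ => (hf j k).re

theorem integral_sum_sum_re {f : Fin n → Fin n → (Fin n → ℂ) → ℂ}
    (hf : ∀ j k, Integrable (f j k)) :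
    ∫ z, ∑ j, ∑ k, (f j k z).re = ∑ j, ∑ k, (∫ z, f j k z).re := by
  have hr : ∀ j k, Integrable (fun z => (f j k z).re) := fun j k => (hf j k).re
  rw [integral_finsetSum _ fun j _ => integrable_finsetSum _ fun k _ => hr j k]
  refine Finset.sum_congr rfl fun j _ => ?_
  rw [integral_finsetSum _ fun k _ => hr j k]
  exact Finset.sum_congr rfl fun k _ => integral_re (hf j k)

/-- The Morrey–Kohn–Hörmander inequality for compactly supported smooth forms. -/
theorem basic_inequality {Φ : (Fin n → ℂ) → ℝ} (h : ContDiff ℝ 2 Φ)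
    {γ : Fin n → (Fin n → ℂ) → ℂ} (hγ : ∀ j, ContDiff ℝ 2 (γ j))
    (hc : ∀ j, HasCompactSupport (γ j)) :
    ∫ z, hermForm n (cHess n Φ z) (fun j => γ j z) (fun j => γ j z) * Real.exp (-Φ z) ≤
      (∫ z, ‖∑ j, wtDer n Φ j (γ j) z‖ ^ 2 * Real.exp (-Φ z)) +
      (1 / 2) * ∫ z, (∑ j, ∑ k, ‖wderBar n k (γ j) z - wderBar n j (γ k) z‖ ^ 2)
        * Real.exp (-Φ z) := by
  have cW : Continuous (fun z => (Real.exp (-Φ z) : ℂ)) := (contDiff_weight h).continuous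
  have cWr : Continuous (fun z => Real.exp (-Φ z)) := Real.continuous_exp.comp h.continuous.neg
  have cG : ∀ j, Continuous (γ j) := fun j => (hγ j).continuous
  have cD : ∀ j, Continuous (wtDer n Φ j (γ j)) := fun j => (contDiff_wtDer h j (hγ j)).continuous
  have cB : ∀ k j, Continuous (wderBar n k (γ j)) := fun k j =>
    (contDiff_wderBar (m := 1) k (hγ j) (by norm_num)).continuous
  have cH : ∀ j k, Continuous (fun z => cHess n Φ z j k) := fun j k =>
    (contDiff_wderBar (m := 0) k (contDiff_wder (m := 1) j (contDiff_ofReal_comp h)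
      (by norm_num)) (by norm_num)).continuous
  have sD : ∀ j, HasCompactSupport (wtDer n Φ j (γ j)) := fun j =>
    ((hc j).wder j).sub (hc j).mul_left
  have sB : ∀ k j, HasCompactSupport (wderBar n k (γ j)) := fun k j => (hc j).wderBar k
  have iD : ∀ j k, Integrable (fun z => wtDer n Φ j (γ j) z *
      starRingEnd ℂ (wtDer n Φ k (γ k) z) * Real.exp (-Φ z)) := fun j k =>
    (((cD j).mul (continuous_conj.comp (cD k))).mul cW).integrable_of_hasCompactSupport
      (sD j).mul_right.mul_right
  have iB : ∀ j k, Integrable (fun z => wderBar n k (γ j) z *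
      starRingEnd ℂ (wderBar n j (γ k) z) * Real.exp (-Φ z)) := fun j k =>
    (((cB k j).mul (continuous_conj.comp (cB j k))).mul cW).integrable_of_hasCompactSupport
      (sB k j).mul_right.mul_right
  have iH : ∀ j k, Integrable (fun z => cHess n Φ z j k * γ j z *
      starRingEnd ℂ (γ k z) * Real.exp (-Φ z)) := fun j k =>
    ((((cH j k).mul (cG j)).mul (continuous_conj.comp (cG k))).mul
      cW).integrable_of_hasCompactSupport (hc j).mul_left.mul_right.mul_right
  have e1 : ∫ z, ‖∑ j, wtDer n Φ j (γ j) z‖ ^ 2 * Real.exp (-Φ z) =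
      ∑ j, ∑ k, (∫ z, wtDer n Φ j (γ j) z * starRingEnd ℂ (wtDer n Φ k (γ k) z)
        * Real.exp (-Φ z)).re := by
    have : ∀ z, ‖∑ j, wtDer n Φ j (γ j) z‖ ^ 2 * Real.exp (-Φ z) = ∑ j, ∑ k,
        (wtDer n Φ j (γ j) z * starRingEnd ℂ (wtDer n Φ k (γ k) z) * Real.exp (-Φ z)).re := by
      intro z
      rw [← Complex.normSq_eq_norm_sq, ← Complex.ofReal_re (Complex.normSq _ * _),
        Complex.ofReal_mul, ← Complex.mul_conj, map_sum, Finset.sum_mul_sum, Finset.sum_mul,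
        Complex.re_sum]
      simp only [Finset.sum_mul, Complex.re_sum]
    simp only [this]
    exact integral_sum_sum_re iD
  have e2 : ∫ z, hermForm n (cHess n Φ z) (fun j => γ j z) (fun j => γ j z) * Real.exp (-Φ z) =
      ∑ j, ∑ k, (∫ z, cHess n Φ z j k * γ j z * starRingEnd ℂ (γ k z)
        * Real.exp (-Φ z)).re := by
    have : ∀ z, hermForm n (cHess n Φ z) (fun j => γ j z) (fun j => γ j z) * Real.exp (-Φ z) =
        ∑ j, ∑ k, (cHess n Φ z j k * γ j z * starRingEnd ℂ (γ k z) * Real.exp (-Φ z)).re := by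
      intro z
      simp only [hermForm, Complex.re_sum, Finset.sum_mul, Complex.re_mul_ofReal]
    simp only [this]
    exact integral_sum_sum_re iH
  have e3 : -((1 / 2) * ∫ z, (∑ j, ∑ k, ‖wderBar n k (γ j) z - wderBar n j (γ k) z‖ ^ 2)
        * Real.exp (-Φ z)) ≤ ∑ j, ∑ k, (∫ z, wderBar n k (γ j) z *
      starRingEnd ℂ (wderBar n j (γ k) z) * Real.exp (-Φ z)).re := by
    rw [← integral_sum_sum_re iB, ← integral_const_mul, ← integral_neg]
    refine integral_mono ?_ (integrable_sum_sum_re iB) fun z => ?_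
    · refine (Continuous.integrable_of_hasCompactSupport ?_ ?_).neg
      · fun_prop
      · refine HasCompactSupport.mul_left (HasCompactSupport.mul_right ?_)
        have := HasCompactSupport.intro' (f := fun z =>
          ∑ j, ∑ k, ‖wderBar n k (γ j) z - wderBar n j (γ k) z‖ ^ 2)
          (K := ⋃ j, tsupport (γ j)) (isCompact_iUnion fun j => hc j)
          (isCompact_iUnion fun j => hc j).isClosed
        apply this
        intro z hz
        simp only [mem_iUnion, not_exists] at hz
        simp [wderBar_eq_zero_of_notMem _ (hz _)]
    · have := sum_sum_re_mul_conj_ge (fun k j => wderBar n k (γ j) z)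
      have hp := Real.exp_pos (-Φ z)
      have := mul_le_mul_of_nonneg_right this hp.le
      simp only [Complex.re_mul_ofReal, ← Finset.sum_mul]
      linarith
  rw [e1, e2]
  simp only [integral_wtDer_mul_conj_wtDer h _ _ (hγ _) (hγ _) (hc _), Complex.add_re,
    Finset.sum_add_distrib]
  linarith

end BasicIdentity

section Mollifier

variable {n : ℕ}

/-- An unnormalized bump function on `ℂⁿ` depending only on the moduli of the coordinates. -/
noncomputable def bumpAux (n : ℕ) (z : Fin n → ℂ) : ℝ :=
  Real.smoothTransition (1 - ∑ j, ((z j).re ^ 2 + (z j).im ^ 2))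

/-- A smooth nonnegative function of integral one supported in the ball of radius `δ`
and depending only on the moduli of the coordinates. -/
noncomputable def mollifier (n : ℕ) (δ : ℝ) (z : Fin n → ℂ) : ℝ :=
  (∫ w, bumpAux n (δ⁻¹ • w))⁻¹ * bumpAux n (δ⁻¹ • z)

theorem contDiff_bumpAux {k : ℕ∞} : ContDiff ℝ k (bumpAux n) := by
  unfold bumpAux
  refine Real.smoothTransition.contDiff.comp (contDiff_const.sub (ContDiff.sum fun j _ => ?_))
  have h1 : ContDiff ℝ k (fun z : Fin n → ℂ => (z j).re) :=
    Complex.reCLM.contDiff.comp (contDiff_apply ℝ ℂ j)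
  have h2 : ContDiff ℝ k (fun z : Fin n → ℂ => (z j).im) :=
    Complex.imCLM.contDiff.comp (contDiff_apply ℝ ℂ j)
  exact (h1.pow 2).add (h2.pow 2)

theorem bumpAux_nonneg (z : Fin n → ℂ) : 0 ≤ bumpAux n z := Real.smoothTransition.nonneg _

theorem bumpAux_eq_zero {z : Fin n → ℂ} (hz : 1 ≤ ‖z‖) : bumpAux n z = 0 := by
  refine Real.smoothTransition.zero_of_nonpos ?_
  obtain ⟨j, hj⟩ : ∃ j, 1 ≤ ‖z j‖ := by
    by_contra! h
    exact absurd ((pi_norm_lt_iff one_pos).2 h) (not_lt.2 hz)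
  have h1 : (z j).re ^ 2 + (z j).im ^ 2 = ‖z j‖ ^ 2 := by
    rw [← Complex.normSq_eq_norm_sq, Complex.normSq_apply]; ring
  have h2 : (z j).re ^ 2 + (z j).im ^ 2 ≤ ∑ j, ((z j).re ^ 2 + (z j).im ^ 2) :=
    Finset.single_le_sum (f := fun j => (z j).re ^ 2 + (z j).im ^ 2)
      (fun _ _ => by positivity) (Finset.mem_univ j)
  have h3 : 1 ≤ ‖z j‖ ^ 2 := by nlinarith
  linarith

theorem contDiff_bumpAux_smul {k : ℕ∞} (δ : ℝ) : ContDiff ℝ k (fun z => bumpAux n (δ⁻¹ • z)) :=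
  contDiff_bumpAux.comp (contDiff_const_smul _)

theorem contDiff_mollifier {k : ℕ∞} (δ : ℝ) : ContDiff ℝ k (mollifier n δ) :=
  contDiff_const.mul (contDiff_bumpAux_smul δ)

theorem bumpAux_smul_eq_zero {δ : ℝ} (hδ : 0 < δ) {z : Fin n → ℂ} (hz : δ ≤ ‖z‖) :
    bumpAux n (δ⁻¹ • z) = 0 := by
  refine bumpAux_eq_zero ?_
  rw [norm_smul, Real.norm_eq_abs, abs_of_pos (inv_pos.2 hδ), inv_mul_eq_div]
  exact (one_le_div hδ).2 hz

theorem mollifier_eq_zero {δ : ℝ} (hδ : 0 < δ) {z : Fin n → ℂ} (hz : δ ≤ ‖z‖) :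
    mollifier n δ z = 0 := by
  rw [mollifier, bumpAux_smul_eq_zero hδ hz, mul_zero]

theorem hasCompactSupport_bumpAux_smul {δ : ℝ} (hδ : 0 < δ) :
    HasCompactSupport (fun z => bumpAux n (δ⁻¹ • z)) :=
  HasCompactSupport.intro (isCompact_closedBall (0 : Fin n → ℂ) δ) fun z hz => by
    refine bumpAux_smul_eq_zero hδ ?_
    simp only [Metric.mem_closedBall, dist_zero_right, not_le] at hz
    exact hz.le

theorem hasCompactSupport_mollifier {δ : ℝ} (hδ : 0 < δ) : HasCompactSupport (mollifier n δ) :=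
  (hasCompactSupport_bumpAux_smul hδ).mul_left

theorem integral_bumpAux_smul_pos {δ : ℝ} (hδ : 0 < δ) : 0 < ∫ w, bumpAux n (δ⁻¹ • w) := by
  have hc : Continuous (fun z => bumpAux n (δ⁻¹ • z)) :=
    (contDiff_bumpAux_smul (k := 0) δ).continuous
  refine hc.integral_pos_of_hasCompactSupport_nonneg_nonzero (hasCompactSupport_bumpAux_smul hδ)
    (fun z => bumpAux_nonneg _) (x := 0) ?_
  simp [bumpAux, Real.smoothTransition.one_of_one_le]

theorem mollifier_nonneg {δ : ℝ} (hδ : 0 < δ) (z : Fin n → ℂ) : 0 ≤ mollifier n δ z :=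
  mul_nonneg (inv_nonneg.2 (integral_bumpAux_smul_pos hδ).le) (bumpAux_nonneg _)

theorem integral_mollifier {δ : ℝ} (hδ : 0 < δ) : ∫ z, mollifier n δ z = 1 := by
  simp only [mollifier, integral_const_mul]
  exact inv_mul_cancel₀ (integral_bumpAux_smul_pos hδ).ne'

theorem continuous_mollifier (δ : ℝ) : Continuous (mollifier n δ) :=
  (contDiff_mollifier (k := 0) δ).continuous

theorem integrable_mollifier {δ : ℝ} (hδ : 0 < δ) : Integrable (mollifier n δ) :=
  (continuous_mollifier δ).integrable_of_hasCompactSupport (hasCompactSupport_mollifier hδ)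

theorem mollifier_congr (δ : ℝ) {z w : Fin n → ℂ} (h : ∀ j, ‖z j‖ = ‖w j‖) :
    mollifier n δ z = mollifier n δ w := by
  have h1 : ∀ a : ℂ, a.re ^ 2 + a.im ^ 2 = ‖a‖ ^ 2 := fun a => by
    rw [← Complex.normSq_eq_norm_sq, Complex.normSq_apply]; ring
  simp only [mollifier, bumpAux, h1, Pi.smul_apply, norm_smul, h]

theorem mollifier_neg (δ : ℝ) (z : Fin n → ℂ) : mollifier n δ (-z) = mollifier n δ z :=
  mollifier_congr δ fun j => by simp

/-- The regularization of `f` at scale `δ`. -/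
noncomputable def mol {F : Type*} [NormedAddCommGroup F] [NormedSpace ℝ F] (n : ℕ) (δ : ℝ)
    (f : (Fin n → ℂ) → F) : (Fin n → ℂ) → F :=
  convolution f (mollifier n δ) (ContinuousLinearMap.lsmul ℝ ℝ).flip volume

variable {F : Type*} [NormedAddCommGroup F] [NormedSpace ℝ F]

theorem mol_apply (δ : ℝ) (f : (Fin n → ℂ) → F) (z : Fin n → ℂ) :
    mol n δ f z = ∫ t, mollifier n δ (z - t) • f t := rfl

theorem mol_apply_swap (δ : ℝ) (f : (Fin n → ℂ) → F) (z : Fin n → ℂ) :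
    mol n δ f z = ∫ t, mollifier n δ t • f (z - t) := convolution_eq_swap _

theorem contDiff_mol {k : ℕ∞} {δ : ℝ} (hδ : 0 < δ) {f : (Fin n → ℂ) → F}
    (hf : LocallyIntegrable f) : ContDiff ℝ k (mol n δ f) :=
  (hasCompactSupport_mollifier hδ).contDiff_convolution_right _ hf (contDiff_mollifier δ)

theorem integrable_mollifier_smul {δ : ℝ} (hδ : 0 < δ) {f : (Fin n → ℂ) → F}
    (hf : LocallyIntegrable f) (z : Fin n → ℂ) :
    Integrable (fun t => mollifier n δ (z - t) • f t) :=
  (hasCompactSupport_mollifier hδ).convolutionExists_right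
    (ContinuousLinearMap.lsmul ℝ ℝ).flip hf (continuous_mollifier δ) z

theorem integrable_mollifier_smul_swap {δ : ℝ} (hδ : 0 < δ) {f : (Fin n → ℂ) → F}
    (hf : LocallyIntegrable f) (z : Fin n → ℂ) :
    Integrable (fun t => mollifier n δ t • f (z - t)) :=
  ConvolutionExistsAt.integrable_swap
    ((hasCompactSupport_mollifier hδ).convolutionExists_right
      (ContinuousLinearMap.lsmul ℝ ℝ).flip hf (continuous_mollifier δ) z)

theorem fderiv_mol {δ : ℝ} (hδ : 0 < δ) {f : (Fin n → ℂ) → ℂ}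
    (hf : LocallyIntegrable f) (z v : Fin n → ℂ) :
    fderiv ℝ (mol n δ f) z v = ∫ t, f t * (fderiv ℝ (mollifier n δ) (z - t) v : ℝ) ∧
    Integrable (fun t => f t * (fderiv ℝ (mollifier n δ) (z - t) v : ℝ)) := by
  have h1 : ContDiff ℝ 1 (mollifier n δ) := contDiff_mollifier (k := 1) δ
  have h := (hasCompactSupport_mollifier hδ).hasFDerivAt_convolution_right
    ((ContinuousLinearMap.lsmul ℝ ℝ).flip : ℂ →L[ℝ] ℝ →L[ℝ] ℂ) hf h1 z
  have hex := ((hasCompactSupport_mollifier hδ).fderiv ℝ).convolutionExists_right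
    (((ContinuousLinearMap.lsmul ℝ ℝ).flip : ℂ →L[ℝ] ℝ →L[ℝ] ℂ).precompR (Fin n → ℂ)) hf
    (h1.continuous_fderiv (by norm_num)) z
  have hi : Integrable (fun t => f t * (fderiv ℝ (mollifier n δ) (z - t) v : ℝ)) := by
    have := hex.integrable.apply_continuousLinearMap v
    refine this.congr (ae_of_all _ fun t => ?_)
    simp [mul_comm]
  refine ⟨?_, hi⟩
  change fderiv ℝ (convolution f (mollifier n δ) (ContinuousLinearMap.lsmul ℝ ℝ).flip volume) z v
    = _
  rw [h.fderiv, convolution_def, ContinuousLinearMap.integral_apply hex.integrable]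
  refine integral_congr_ae (ae_of_all _ fun t => ?_)
  simp [mul_comm]

/-- The kernel `t ↦ κ_δ(z - t)` as a complex valued test function. -/
noncomputable def molTest (n : ℕ) (δ : ℝ) (z t : Fin n → ℂ) : ℂ := (mollifier n δ (z - t) : ℂ)

theorem contDiff_molTest {k : ℕ∞} (δ : ℝ) (z : Fin n → ℂ) : ContDiff ℝ k (molTest n δ z) :=
  contDiff_ofReal_comp ((contDiff_mollifier δ).comp (contDiff_const.sub contDiff_id))

theorem tsupport_molTest_subset {δ : ℝ} (hδ : 0 < δ) (z : Fin n → ℂ) :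
    tsupport (molTest n δ z) ⊆ Metric.closedBall z δ :=
  closure_minimal (fun t ht => by
    by_contra h
    simp only [Metric.mem_closedBall, not_le, dist_comm t z, dist_eq_norm] at h
    exact ht (by simp [molTest, mollifier_eq_zero hδ h.le])) Metric.isClosed_closedBall

theorem hasCompactSupport_molTest {δ : ℝ} (hδ : 0 < δ) (z : Fin n → ℂ) :
    HasCompactSupport (molTest n δ z) :=
  (isCompact_closedBall z δ).of_isClosed_subset (isClosed_tsupport _)
    (tsupport_molTest_subset hδ z)

theorem mol_eq_integral_molTest (δ : ℝ) (f : (Fin n → ℂ) → ℂ) (z : Fin n → ℂ) :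
    mol n δ f z = ∫ t, f t * molTest n δ z t := by
  rw [mol_apply]
  congr 1; ext t
  rw [molTest, Complex.real_smul, mul_comm]

theorem fderiv_molTest (δ : ℝ) (z t v : Fin n → ℂ) :
    fderiv ℝ (molTest n δ z) t v = -((fderiv ℝ (mollifier n δ) (z - t) v : ℝ) : ℂ) := by
  have h1 : HasFDerivAt (mollifier n δ) (fderiv ℝ (mollifier n δ) (z - t)) (z - t) :=
    ((contDiff_mollifier (k := 1) δ).differentiable (by norm_num) _).hasFDerivAt
  have h2 := h1.comp t ((hasFDerivAt_id t).const_sub z)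
  have h3 := (Complex.ofRealCLM.hasFDerivAt (x := mollifier n δ (z - t))).comp t h2
  have h4 : HasFDerivAt (molTest n δ z) _ t := h3
  rw [h4.fderiv]
  simp

theorem wderBar_mol {δ : ℝ} (hδ : 0 < δ) {f : (Fin n → ℂ) → ℂ}
    (hf : LocallyIntegrable f) (j : Fin n) (z : Fin n → ℂ) :
    wderBar n j (mol n δ f) z = -∫ t, f t * wderBar n j (molTest n δ z) t := by
  obtain ⟨a1, a2⟩ := fderiv_mol hδ hf z (Pi.single j 1)
  obtain ⟨b1, b2⟩ := fderiv_mol hδ hf z (Pi.single j Complex.I)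
  rw [wderBar, a1, b1, ← integral_neg, ← integral_const_mul, ← integral_add a2 (b2.const_mul _),
    ← integral_const_mul]
  congr 1; ext t
  simp only [wderBar, fderiv_molTest]
  ring

theorem wder_mol {δ : ℝ} (hδ : 0 < δ) {f : (Fin n → ℂ) → ℂ}
    (hf : LocallyIntegrable f) (j : Fin n) (z : Fin n → ℂ) :
    wder n j (mol n δ f) z = -∫ t, f t * wder n j (molTest n δ z) t := by
  obtain ⟨a1, a2⟩ := fderiv_mol hδ hf z (Pi.single j 1)
  obtain ⟨b1, b2⟩ := fderiv_mol hδ hf z (Pi.single j Complex.I)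
  rw [wder, a1, b1, ← integral_neg, ← integral_const_mul, ← integral_sub a2 (b2.const_mul _),
    ← integral_const_mul]
  congr 1; ext t
  simp only [wder, fderiv_molTest]
  ring

theorem mol_congr_ae (δ : ℝ) {f g : (Fin n → ℂ) → F} (h : f =ᵐ[volume] g) :
    mol n δ f = mol n δ g := by
  ext z
  rw [mol_apply, mol_apply]
  exact integral_congr_ae (h.mono fun t ht => by simp only [ht])

theorem mol_eq_zero {δ : ℝ} (hδ : 0 < δ) {f : (Fin n → ℂ) → F} {z : Fin n → ℂ}
    (h : ∀ t ∈ Metric.ball z δ, f t = 0) : mol n δ f z = 0 := by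
  rw [mol_apply, ← integral_zero (Fin n → ℂ) F]
  congr 1; ext t
  by_cases ht : t ∈ Metric.ball z δ
  · rw [h t ht, smul_zero]
  · rw [Metric.mem_ball, not_lt, dist_comm, dist_eq_norm] at ht
    rw [mollifier_eq_zero hδ ht, zero_smul]

theorem mol_congr {δ : ℝ} (hδ : 0 < δ) {f g : (Fin n → ℂ) → F} {z : Fin n → ℂ}
    (h : ∀ t ∈ Metric.ball z δ, f t = g t) : mol n δ f z = mol n δ g z := by
  rw [mol_apply, mol_apply]
  congr 1; ext t
  by_cases ht : t ∈ Metric.ball z δ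
  · rw [h t ht]
  · rw [Metric.mem_ball, not_lt, dist_comm, dist_eq_norm] at ht
    rw [mollifier_eq_zero hδ ht, zero_smul, zero_smul]

theorem tsupport_mol_subset {δ : ℝ} (hδ : 0 < δ) (f : (Fin n → ℂ) → F) :
    tsupport (mol n δ f) ⊆ Metric.cthickening δ (tsupport f) :=
  closure_minimal (fun z hz => by
    by_contra h
    refine hz (mol_eq_zero hδ fun t ht => ?_)
    by_contra h0
    refine h (Metric.mem_cthickening_of_dist_le z t δ _ (subset_tsupport _ h0) ?_)
    rw [dist_comm]; exact (Metric.mem_ball.1 ht).le) Metric.isClosed_cthickening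

end Mollifier

section MollifierConvergence

variable {n : ℕ}

theorem tendsto_eLpNorm_translate {f : (Fin n → ℂ) → ℂ} (hf : MemLp f 2) :
    Tendsto (fun y : Fin n → ℂ => eLpNorm (fun x => f (x - y) - f x) 2) (𝓝 0) (𝓝 0) := by
  let g : (Fin n → ℂ) → C(Fin n → ℂ, Fin n → ℂ) := fun y => ⟨fun x => x - y, by fun_prop⟩
  have hg : Continuous g := ContinuousMap.continuous_of_continuous_uncurry _ (by
    simp only [g, Function.uncurry_def]; exact continuous_snd.sub continuous_fst)
  have hgm : ∀ y, MeasurePreserving (g y) volume volume := fun y =>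
    measurePreserving_sub_right volume y
  have h1 : Tendsto (fun y => Lp.compMeasurePreserving (g y) (hgm y) (hf.toLp f)) (𝓝 0)
      (𝓝 (Lp.compMeasurePreserving (g 0) (hgm 0) (hf.toLp f))) :=
    Filter.Tendsto.compMeasurePreservingLp tendsto_const_nhds (hg.tendsto 0) hgm (hgm 0)
      (by simp)
  rw [tendsto_iff_edist_tendsto_0] at h1
  refine h1.congr fun y => ?_
  rw [Lp.edist_def]
  refine eLpNorm_congr_ae ?_
  have h2 : ∀ y, Lp.compMeasurePreserving (g y) (hgm y) (hf.toLp f) =ᵐ[volume]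
      fun x => f (x - y) := fun y =>
    (Lp.coeFn_compMeasurePreserving _ (hgm y)).trans
      ((hgm y).quasiMeasurePreserving.ae_eq_comp hf.coeFn_toLp)
  filter_upwards [h2 y, h2 0] with x hx hx0
  rw [Pi.sub_apply, hx, hx0, sub_zero]

theorem lintegral_mul_sq_le {α : Type*} [MeasurableSpace α] {μ : Measure α} {k g : α → ℝ≥0∞}
    (hk : Measurable k) (hg : AEMeasurable g μ) (h1 : ∫⁻ t, k t ∂μ = 1) :
    (∫⁻ t, k t * g t ∂μ) ^ 2 ≤ ∫⁻ t, k t * g t ^ 2 ∂μ := by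
  have hac : μ.withDensity k ≪ μ := withDensity_absolutelyContinuous μ k
  have hg' : AEMeasurable g (μ.withDensity k) := hg.mono_ac hac
  have h := ENNReal.lintegral_mul_le_Lp_mul_Lq (μ.withDensity k)
    (p := 2) (q := 2) (by constructor <;> norm_num) hg' (aemeasurable_const (b := (1 : ℝ≥0∞)))
  simp only [Pi.mul_apply, mul_one, ENNReal.one_rpow] at h
  rw [lintegral_withDensity_eq_lintegral_mul₀ hk.aemeasurable hg,
    lintegral_withDensity_eq_lintegral_mul₀ hk.aemeasurable (hg.pow_const _), lintegral_one,
    withDensity_apply _ MeasurableSet.univ, setLIntegral_univ, h1, ENNReal.one_rpow, mul_one] at h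
  simp only [Pi.mul_apply, ENNReal.rpow_two] at h
  calc _ ≤ ((∫⁻ t, k t * g t ^ 2 ∂μ) ^ (1 / (2 : ℝ))) ^ 2 := by gcongr
    _ = _ := by
      rw [← ENNReal.rpow_natCast, ← ENNReal.rpow_mul]
      norm_num

theorem lintegral_mollifier {δ : ℝ} (hδ : 0 < δ) :
    ∫⁻ z, ENNReal.ofReal (mollifier n δ z) = 1 := by
  rw [← ofReal_integral_eq_lintegral_ofReal (integrable_mollifier hδ)
    (ae_of_all _ (mollifier_nonneg hδ)), integral_mollifier hδ, ENNReal.ofReal_one]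

theorem enorm_mol_sub_sq_le {δ : ℝ} (hδ : 0 < δ) {f : (Fin n → ℂ) → ℂ}
    (hf : LocallyIntegrable f) (x : Fin n → ℂ) :
    ‖mol n δ f x - f x‖ₑ ^ 2 ≤
      ∫⁻ t, ENNReal.ofReal (mollifier n δ t) * ‖f (x - t) - f x‖ₑ ^ 2 := by
  have e : mol n δ f x - f x = ∫ t, mollifier n δ t • (f (x - t) - f x) := by
    simp only [smul_sub]
    rw [integral_sub (integrable_mollifier_smul_swap hδ hf x)
      ((integrable_mollifier hδ).smul_const _), ← mol_apply_swap, integral_smul_const,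
      integral_mollifier hδ, one_smul]
  have hm : AEMeasurable (fun t => ‖f (x - t) - f x‖ₑ) :=
    ((hf.aestronglyMeasurable.comp_quasiMeasurePreserving
      (quasiMeasurePreserving_sub_left_of_right_invariant volume x)).sub
      aestronglyMeasurable_const).enorm
  refine le_trans ?_ (lintegral_mul_sq_le
    (continuous_mollifier δ).measurable.ennreal_ofReal hm (lintegral_mollifier hδ))
  rw [e]
  gcongr
  refine (enorm_integral_le_lintegral_enorm _).trans (le_of_eq ?_)
  congr 1; ext t
  rw [enorm_smul, Real.enorm_eq_ofReal (mollifier_nonneg hδ t)]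

theorem eLpNorm_two_sq {α : Type*} [MeasurableSpace α] {μ : Measure α} (f : α → ℂ) :
    eLpNorm f 2 μ ^ 2 = ∫⁻ x, ‖f x‖ₑ ^ 2 ∂μ := by
  rw [eLpNorm_eq_lintegral_rpow_enorm_toReal (by norm_num) (by norm_num)]
  simp only [ENNReal.toReal_ofNat, ENNReal.rpow_two]
  rw [← ENNReal.rpow_natCast, ← ENNReal.rpow_mul]
  norm_num

theorem eLpNorm_mol_sub_sq_le {δ : ℝ} (hδ : 0 < δ) {f : (Fin n → ℂ) → ℂ} (hf : MemLp f 2) :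
    eLpNorm (fun x => mol n δ f x - f x) 2 volume ^ 2 ≤
      ∫⁻ t, ENNReal.ofReal (mollifier n δ t) *
        eLpNorm (fun x => f (x - t) - f x) 2 volume ^ 2 := by
  wlog hs : StronglyMeasurable f generalizing f
  · have h1 := hf.1.ae_eq_mk
    have h2 := this (f := hf.1.mk f) (hf.ae_eq h1) hf.1.stronglyMeasurable_mk
    rw [← mol_congr_ae δ h1] at h2
    have e1 : (fun x => mol n δ f x - f x) =ᵐ[volume] (fun x => mol n δ f x - hf.1.mk f x) :=
      h1.mono fun x hx => by simp only [hx]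
    have e2 : ∀ t, (fun x => f (x - t) - f x) =ᵐ[volume]
        (fun x => hf.1.mk f (x - t) - hf.1.mk f x) := fun t => by
      filter_upwards [h1,
        (measurePreserving_sub_right volume t).quasiMeasurePreserving.ae_eq_comp h1] with x hx hx'
      simp only [Function.comp_def] at hx'
      rw [hx, hx']
    rw [eLpNorm_congr_ae e1]
    simp only [fun t => eLpNorm_congr_ae (p := 2) (e2 t)]
    exact h2
  have hl : LocallyIntegrable f := hf.locallyIntegrable (by norm_num)
  rw [eLpNorm_two_sq]
  simp only [eLpNorm_two_sq]
  refine (lintegral_mono fun x => enorm_mol_sub_sq_le hδ hl x).trans ?_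
  have hm : Measurable (fun p : (Fin n → ℂ) × (Fin n → ℂ) =>
      ENNReal.ofReal (mollifier n δ p.2) * ‖f (p.1 - p.2) - f p.1‖ₑ ^ 2) := by
    have h1 : Measurable f := hs.measurable
    have h2 := (continuous_mollifier (n := n) δ).measurable
    refine ((h2.comp measurable_snd).ennreal_ofReal).mul (Measurable.pow_const ?_ 2)
    exact ((h1.comp (measurable_fst.sub measurable_snd)).sub (h1.comp measurable_fst)).enorm
  rw [lintegral_lintegral_swap hm.aemeasurable]
  refine lintegral_mono fun t => ?_
  rw [lintegral_const_mul']
  exact ENNReal.ofReal_ne_top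

theorem tendsto_eLpNorm_mol_sub {f : (Fin n → ℂ) → ℂ} (hf : MemLp f 2) :
    Tendsto (fun δ : ℝ => eLpNorm (fun x => mol n δ f x - f x) 2 volume) (𝓝[>] 0) (𝓝 0) := by
  rw [ENNReal.tendsto_nhds_zero]
  intro ε hε
  have h := (ENNReal.tendsto_nhds_zero.1 (tendsto_eLpNorm_translate hf)) ε hε
  obtain ⟨r, hr, hb⟩ := Metric.eventually_nhds_iff.1 h
  filter_upwards [Ioo_mem_nhdsGT hr] with δ hδ
  have h1 := eLpNorm_mol_sub_sq_le hδ.1 hf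
  have h2 : ∫⁻ t, ENNReal.ofReal (mollifier n δ t) *
        eLpNorm (fun x => f (x - t) - f x) 2 volume ^ 2 ≤ ε ^ 2 := by
    calc _ ≤ ∫⁻ t, ENNReal.ofReal (mollifier n δ t) * ε ^ 2 := by
          refine lintegral_mono fun t => ?_
          by_cases ht : δ ≤ ‖t‖
          · simp [mollifier_eq_zero hδ.1 ht]
          · gcongr
            exact hb (by rw [dist_zero_right]; exact (not_le.1 ht).trans hδ.2)
      _ = ε ^ 2 := by
          rw [lintegral_mul_const _ (continuous_mollifier δ).measurable.ennreal_ofReal,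
            lintegral_mollifier hδ.1, one_mul]
  exact (ENNReal.pow_le_pow_left_iff (by norm_num)).1 (h1.trans h2)

end MollifierConvergence

section WeakBasicInequality

variable {n : ℕ}

theorem integral_norm_sq_eq_toReal {α : Type*} [MeasurableSpace α] {μ : Measure α} {f : α → ℂ}
    (hf : MemLp f 2 μ) : ∫ x, ‖f x‖ ^ 2 ∂μ = (eLpNorm f 2 μ).toReal ^ 2 := by
  rw [← ENNReal.toReal_pow, eLpNorm_two_sq, integral_eq_lintegral_of_nonneg_ae
    (f := fun x => ‖f x‖ ^ 2) (ae_of_all _ fun x => by positivity) (hf.1.norm.pow 2)]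
  congr 2; ext x
  rw [ENNReal.ofReal_pow (norm_nonneg _), ofReal_norm]

/-- Convergence in `L²` of functions vanishing off a fixed compact set. -/
structure L2Tend (K : Set (Fin n → ℂ)) (F : ℕ → (Fin n → ℂ) → ℂ) (f : (Fin n → ℂ) → ℂ) :
    Prop where
  memLp_seq : ∀ k, MemLp (F k) 2
  memLp_lim : MemLp f 2
  seq_zero : ∀ k, ∀ x ∉ K, F k x = 0
  lim_zero : ∀ x ∉ K, f x = 0
  tendsto : Tendsto (fun k => eLpNorm (F k - f) 2 volume) atTop (𝓝 0)

namespace L2Tend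

variable {K : Set (Fin n → ℂ)} {F H : ℕ → (Fin n → ℂ) → ℂ} {f h : (Fin n → ℂ) → ℂ}

theorem sub (h1 : L2Tend K F f) (h2 : L2Tend K H h) :
    L2Tend K (fun k x => F k x - H k x) (fun x => f x - h x) where
  memLp_seq k := (h1.memLp_seq k).sub (h2.memLp_seq k)
  memLp_lim := h1.memLp_lim.sub h2.memLp_lim
  seq_zero k x hx := by rw [h1.seq_zero k x hx, h2.seq_zero k x hx, sub_zero]
  lim_zero x hx := by rw [h1.lim_zero x hx, h2.lim_zero x hx, sub_zero]
  tendsto := by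
    have := h1.tendsto.add h2.tendsto
    rw [add_zero] at this
    refine tendsto_of_tendsto_of_tendsto_of_le_of_le tendsto_const_nhds this
      (fun _ => zero_le) fun k => ?_
    have e : (fun x => F k x - H k x) - (fun x => f x - h x) = (F k - f) - (H k - h) := by
      ext x; simp only [Pi.sub_apply]; ring
    rw [e]
    exact eLpNorm_sub_le ((h1.memLp_seq k).sub h1.memLp_lim).1
      ((h2.memLp_seq k).sub h2.memLp_lim).1 (by norm_num)

theorem zero : L2Tend K (fun _ _ => 0) (fun _ => 0) where
  memLp_seq _ := MemLp.zero'
  memLp_lim := MemLp.zero'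
  seq_zero _ _ _ := rfl
  lim_zero _ _ := rfl
  tendsto := by
    simp

theorem neg (h1 : L2Tend K F f) : L2Tend K (fun k x => -F k x) (fun x => -f x) := by
  simpa using zero.sub h1

theorem add (h1 : L2Tend K F f) (h2 : L2Tend K H h) :
    L2Tend K (fun k x => F k x + H k x) (fun x => f x + h x) := by
  simpa using h1.sub h2.neg

theorem sum {ι : Type*} (s : Finset ι) {F : ι → ℕ → (Fin n → ℂ) → ℂ}
    {f : ι → (Fin n → ℂ) → ℂ} (hF : ∀ i ∈ s, L2Tend K (F i) (f i)) :
    L2Tend K (fun k x => ∑ i ∈ s, F i k x) (fun x => ∑ i ∈ s, f i x) := by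
  classical
  induction s using Finset.induction_on with
  | empty => simpa using zero
  | insert a s ha ih =>
    simp only [Finset.sum_insert ha]
    exact (hF a (Finset.mem_insert_self a s)).add
      (ih fun i hi => hF i (Finset.mem_insert_of_mem hi))

theorem mul_continuous (hK : IsCompact K) (h1 : L2Tend K F f) {g : (Fin n → ℂ) → ℂ}
    (hg : Continuous g) : L2Tend K (fun k x => g x * F k x) (fun x => g x * f x) := by
  obtain ⟨C, hC⟩ := hK.exists_bound_of_continuousOn hg.continuousOn
  have key : ∀ u : (Fin n → ℂ) → ℂ, (∀ x ∉ K, u x = 0) → ∀ x, ‖g x * u x‖ ≤ C * ‖u x‖ := by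
    intro u hu x
    by_cases hx : x ∈ K
    · rw [norm_mul]; gcongr; exact hC x hx
    · simp [hu x hx]
  have mem : ∀ u : (Fin n → ℂ) → ℂ, (∀ x ∉ K, u x = 0) → MemLp u 2 →
      MemLp (fun x => g x * u x) 2 := fun u hu hm =>
    MemLp.of_le_mul hm (hg.aestronglyMeasurable.mul hm.1) (ae_of_all _ (key u hu))
  refine ⟨fun k => mem _ (h1.seq_zero k) (h1.memLp_seq k), mem _ h1.lim_zero h1.memLp_lim,
    fun k x hx => by rw [h1.seq_zero k x hx, mul_zero],
    fun x hx => by rw [h1.lim_zero x hx, mul_zero], ?_⟩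
  have h2 : Tendsto (fun k => ENNReal.ofReal C * eLpNorm (F k - f) 2 volume) atTop (𝓝 0) := by
    have := ENNReal.Tendsto.const_mul h1.tendsto (Or.inr (ENNReal.ofReal_ne_top (r := C)))
    rwa [mul_zero] at this
  refine tendsto_of_tendsto_of_tendsto_of_le_of_le tendsto_const_nhds h2
    (fun _ => zero_le) fun k => ?_
  refine eLpNorm_le_mul_eLpNorm_of_ae_le_mul (ae_of_all _ fun x => ?_) 2
  have := key (F k - f) (fun x hx => by simp [h1.seq_zero k x hx, h1.lim_zero x hx]) x
  simpa only [Pi.sub_apply, mul_sub] using this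

theorem tendsto_integral (h1 : L2Tend K F f) :
    Tendsto (fun k => ∫ x, ‖F k x‖ ^ 2) atTop (𝓝 (∫ x, ‖f x‖ ^ 2)) := by
  have h2 := ((Lp.tendsto_Lp_iff_tendsto_eLpNorm'' F h1.memLp_seq f h1.memLp_lim).2
    h1.tendsto).norm.pow 2
  simp only [Lp.norm_toLp] at h2
  rw [integral_norm_sq_eq_toReal h1.memLp_lim]
  refine h2.congr fun k => (integral_norm_sq_eq_toReal (h1.memLp_seq k)).symm

theorem tendsto_integral_mul (hK : IsCompact K) (h1 : L2Tend K F f) {g : (Fin n → ℂ) → ℝ}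
    (hg : Continuous g) (hg0 : ∀ z, 0 ≤ g z) :
    Tendsto (fun k => ∫ x, ‖F k x‖ ^ 2 * g x) atTop (𝓝 (∫ x, ‖f x‖ ^ 2 * g x)) := by
  have h2 := (h1.mul_continuous hK (g := fun z => (Real.sqrt (g z) : ℂ))
    (by fun_prop)).tendsto_integral
  have e : ∀ u : (Fin n → ℂ) → ℂ, ∀ x, ‖(Real.sqrt (g x) : ℂ) * u x‖ ^ 2 = ‖u x‖ ^ 2 * g x :=
    fun u x => by
      rw [norm_mul, mul_pow, Complex.norm_real, Real.norm_eq_abs, sq_abs, Real.sq_sqrt (hg0 x),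
        mul_comm]
  simpa only [e] using h2

theorem integrable_mul (hK : IsCompact K) (h1 : L2Tend K F f) {g : (Fin n → ℂ) → ℝ}
    (hg : Continuous g) (hg0 : ∀ z, 0 ≤ g z) :
    (∀ k, Integrable (fun x => ‖F k x‖ ^ 2 * g x)) ∧ Integrable (fun x => ‖f x‖ ^ 2 * g x) := by
  have h2 := h1.mul_continuous hK (g := fun z => (Real.sqrt (g z) : ℂ)) (by fun_prop)
  have e : ∀ u : (Fin n → ℂ) → ℂ, ∀ x, ‖(Real.sqrt (g x) : ℂ) * u x‖ ^ 2 = ‖u x‖ ^ 2 * g x :=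
    fun u x => by
      rw [norm_mul, mul_pow, Complex.norm_real, Real.norm_eq_abs, sq_abs, Real.sq_sqrt (hg0 x),
        mul_comm]
  refine ⟨fun k => ?_, ?_⟩
  · simpa only [e] using (h2.memLp_seq k).integrable_norm_pow (by norm_num)
  · simpa only [e] using h2.memLp_lim.integrable_norm_pow (by norm_num)

end L2Tend

theorem memLp_two_of_continuous {u : (Fin n → ℂ) → ℂ} (hu : Continuous u)
    (hc : HasCompactSupport u) : MemLp u 2 :=
  hu.memLp_of_hasCompactSupport hc

theorem l2Tend_mol {K K' : Set (Fin n → ℂ)} (hK : IsCompact K) (hK' : IsCompact K') {r : ℝ}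
    (hr : 0 < r) (hsub : Metric.cthickening r K ⊆ K') {f : (Fin n → ℂ) → ℂ} (hf : MemLp f 2)
    (h0 : ∀ x ∉ K, f x = 0) : L2Tend K' (fun k : ℕ => mol n (r / (k + 1)) f) f := by
  have hpos : ∀ k : ℕ, 0 < r / ((k : ℝ) + 1) := fun k => by positivity
  have hle : ∀ k : ℕ, r / ((k : ℝ) + 1) ≤ r := fun k =>
    div_le_self hr.le (by have := Nat.cast_nonneg (α := ℝ) k; linarith)
  have hl : LocallyIntegrable f := hf.locallyIntegrable (by norm_num)
  have hts : tsupport f ⊆ K := closure_minimal (fun x hx => by_contra fun h => hx (h0 x h))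
    hK.isClosed
  have hs : ∀ k : ℕ, tsupport (mol n (r / ((k : ℝ) + 1)) f) ⊆ K' := fun k =>
    (tsupport_mol_subset (hpos k) f).trans
      (((Metric.cthickening_mono (hle k) _).trans (Metric.cthickening_subset_of_subset r hts)).trans
        hsub)
  refine ⟨fun k => ?_, hf, fun k x hx => ?_, fun x hx => h0 x fun h => hx
    (hsub (Metric.self_subset_cthickening K h)), ?_⟩
  · exact memLp_two_of_continuous (contDiff_mol (k := 0) (hpos k) hl).continuous
      (hK'.of_isClosed_subset (isClosed_tsupport _) (hs k))
  · by_contra h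
    exact hx (hs k (subset_tsupport _ h))
  · have ht : Tendsto (fun k : ℕ => r / ((k : ℝ) + 1)) atTop (𝓝[>] 0) := by
      refine tendsto_nhdsWithin_iff.2 ⟨?_, Eventually.of_forall hpos⟩
      have := (tendsto_one_div_add_atTop_nhds_zero_nat (𝕜 := ℝ)).const_mul r
      simpa [div_eq_mul_inv] using this
    exact (tendsto_eLpNorm_mol_sub hf).comp ht

theorem continuous_cHess {Φ : (Fin n → ℂ) → ℝ} (h : ContDiff ℝ 2 Φ) (j k : Fin n) :
    Continuous (fun z => cHess n Φ z j k) :=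
  (contDiff_wderBar (m := 0) k (contDiff_wder (m := 1) j (contDiff_ofReal_comp h)
    (by norm_num)) (by norm_num)).continuous

theorem integrable_mul_continuous_compact {f θ : (Fin n → ℂ) → ℂ} (hf : LocallyIntegrable f)
    (hθ : Continuous θ) (hc : HasCompactSupport θ) : Integrable (fun z => f z * θ z) := by
  simpa [mul_comm] using hf.integrable_smul_left_of_hasCompactSupport hθ hc

/-- The Morrey–Kohn–Hörmander inequality for compactly supported square integrable forms
whose derivatives in the sense of distributions are square integrable. -/
theorem weak_basic_inequality {Φ : (Fin n → ℂ) → ℝ} (h : ContDiff ℝ 2 Φ)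
    {G K : Set (Fin n → ℂ)} (hG : IsOpen G) (hK : IsCompact K) (hKG : K ⊆ G)
    {m : (Fin n → ℂ) → ℝ} (hmc : Continuous m) (hm0 : ∀ z, 0 ≤ m z)
    (hm : ∀ z ∈ G, ∀ X : Fin n → ℂ, m z * ∑ j, ‖X j‖ ^ 2 ≤ hermForm n (cHess n Φ z) X X)
    {γ : Fin n → (Fin n → ℂ) → ℂ} {B : (Fin n → ℂ) → ℂ} {A : Fin n → Fin n → (Fin n → ℂ) → ℂ}
    (hγ : ∀ j, MemLp (γ j) 2) (hB : MemLp B 2) (hA : ∀ j k, MemLp (A j k) 2)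
    (hγ0 : ∀ j, ∀ z ∉ K, γ j z = 0) (hB0 : ∀ z ∉ K, B z = 0) (hA0 : ∀ j k, ∀ z ∉ K, A j k z = 0)
    (hwB : ∀ θ : (Fin n → ℂ) → ℂ, ContDiff ℝ 2 θ → HasCompactSupport θ →
      ∫ z, ∑ j, γ j z * wder n j θ z = -∫ z, B z * θ z)
    (hwA : ∀ θ : (Fin n → ℂ) → ℂ, ContDiff ℝ 2 θ → HasCompactSupport θ → ∀ j k,
      ∫ z, (γ j z * wderBar n k θ z - γ k z * wderBar n j θ z) = -∫ z, A j k z * θ z) :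
    ∫ z, (∑ j, ‖γ j z‖ ^ 2) * (m z * Real.exp (-Φ z)) ≤
      (∫ z, ‖B z - ∑ j, wder n j (fun v => (Φ v : ℂ)) z * γ j z‖ ^ 2 * Real.exp (-Φ z)) +
      (1 / 2) * ∫ z, (∑ j, ∑ k, ‖A j k z‖ ^ 2) * Real.exp (-Φ z) := by
  obtain ⟨r, hr, hrG⟩ := hK.exists_cthickening_subset_open hG hKG
  set K' := Metric.cthickening r K with hK'def
  have hK' : IsCompact K' := hK.cthickening
  have hli : ∀ {f : (Fin n → ℂ) → ℂ}, MemLp f 2 → LocallyIntegrable f := fun hf =>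
    hf.locallyIntegrable (by norm_num)
  set δ : ℕ → ℝ := fun k => r / (k + 1) with hδ
  have hpos : ∀ k, 0 < δ k := fun k => by simp only [hδ]; positivity
  have tγ : ∀ j, L2Tend K' (fun k => mol n (δ k) (γ j)) (γ j) := fun j =>
    l2Tend_mol hK hK' hr subset_rfl (hγ j) (hγ0 j)
  have tB : L2Tend K' (fun k => mol n (δ k) B) B := l2Tend_mol hK hK' hr subset_rfl hB hB0
  have tA : ∀ j l, L2Tend K' (fun k => mol n (δ k) (A j l)) (A j l) := fun j l =>
    l2Tend_mol hK hK' hr subset_rfl (hA j l) (hA0 j l)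
  have cγ : ∀ k j, ContDiff ℝ 2 (mol n (δ k) (γ j)) := fun k j =>
    contDiff_mol (k := 2) (hpos k) (hli (hγ j))
  have sγ : ∀ k j, HasCompactSupport (mol n (δ k) (γ j)) := fun k j =>
    HasCompactSupport.intro hK' ((tγ j).seq_zero k)
  have cΦ : ∀ j, Continuous (wder n j (fun v => (Φ v : ℂ))) := fun j =>
    (contDiff_wder (m := 1) j (contDiff_ofReal_comp h) (by norm_num)).continuous
  have cW : Continuous (fun z => Real.exp (-Φ z)) := Real.continuous_exp.comp h.continuous.neg
  have cmW : Continuous (fun z => m z * Real.exp (-Φ z)) := hmc.mul cW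
  have pW : ∀ z, 0 ≤ Real.exp (-Φ z) := fun z => (Real.exp_pos _).le
  have pmW : ∀ z, 0 ≤ m z * Real.exp (-Φ z) := fun z => mul_nonneg (hm0 z) (pW z)
  have tC : L2Tend K' (fun k z => mol n (δ k) B z -
      ∑ j, wder n j (fun v => (Φ v : ℂ)) z * mol n (δ k) (γ j) z)
      (fun z => B z - ∑ j, wder n j (fun v => (Φ v : ℂ)) z * γ j z) :=
    tB.sub (L2Tend.sum _ fun j _ => (tγ j).mul_continuous hK' (cΦ j))
  have wct : ∀ (k : ℕ) (z : Fin n → ℂ) (j : Fin n),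
      Continuous (wderBar n j (molTest n (δ k) z)) ∧ Continuous (wder n j (molTest n (δ k) z)) :=
    fun k z j => ⟨(contDiff_wderBar (m := 0) j (contDiff_molTest (k := 1) (δ k) z)
        (by norm_num)).continuous,
      (contDiff_wder (m := 0) j (contDiff_molTest (k := 1) (δ k) z) (by norm_num)).continuous⟩
  have dB : ∀ k z, ∑ j, wder n j (mol n (δ k) (γ j)) z = mol n (δ k) B z := by
    intro k z
    have hs := hasCompactSupport_molTest (hpos k) z
    have := hwB _ (contDiff_molTest (k := 2) (δ k) z) hs
    rw [integral_finsetSum _ fun j _ => integrable_mul_continuous_compact (hli (hγ j))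
      (wct k z j).2 (hs.wder j)] at this
    rw [mol_eq_integral_molTest]
    simp only [wder_mol (hpos k) (hli (hγ _)), Finset.sum_neg_distrib, this, neg_neg]
  have dA : ∀ k z j l, wderBar n l (mol n (δ k) (γ j)) z - wderBar n j (mol n (δ k) (γ l)) z =
      mol n (δ k) (A j l) z := by
    intro k z j l
    have hs := hasCompactSupport_molTest (hpos k) z
    have := hwA _ (contDiff_molTest (k := 2) (δ k) z) hs j l
    rw [integral_sub (integrable_mul_continuous_compact (hli (hγ j)) (wct k z l).1 (hs.wderBar l))
      (integrable_mul_continuous_compact (hli (hγ l)) (wct k z j).1 (hs.wderBar j))] at this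
    rw [mol_eq_integral_molTest, wderBar_mol (hpos k) (hli (hγ j)),
      wderBar_mol (hpos k) (hli (hγ l))]
    linear_combination -this
  have main : ∀ k, ∑ j, ∫ z, ‖mol n (δ k) (γ j) z‖ ^ 2 * (m z * Real.exp (-Φ z)) ≤
      (∫ z, ‖mol n (δ k) B z - ∑ j, wder n j (fun v => (Φ v : ℂ)) z * mol n (δ k) (γ j) z‖ ^ 2
        * Real.exp (-Φ z)) +
      (1 / 2) * ∑ j, ∑ l, ∫ z, ‖mol n (δ k) (A j l) z‖ ^ 2 * Real.exp (-Φ z) := by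
    intro k
    have hb := basic_inequality h (cγ k) (sγ k)
    simp only [dA, wtDer, Finset.sum_sub_distrib, dB] at hb
    have e : ∫ z, (∑ j, ∑ l, ‖mol n (δ k) (A j l) z‖ ^ 2) * Real.exp (-Φ z) =
        ∑ j, ∑ l, ∫ z, ‖mol n (δ k) (A j l) z‖ ^ 2 * Real.exp (-Φ z) := by
      simp only [Finset.sum_mul]
      have hi : ∀ j l, Integrable fun z => ‖mol n (δ k) (A j l) z‖ ^ 2 * Real.exp (-Φ z) :=
        fun j l => ((tA j l).integrable_mul hK' cW pW).1 k
      rw [integral_finsetSum _ fun j _ => integrable_finsetSum _ fun l _ => hi j l]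
      exact Finset.sum_congr rfl fun j _ => integral_finsetSum _ fun l _ => hi j l
    rw [e] at hb
    refine le_trans ?_ hb
    have hi : ∀ j, Integrable fun z => ‖mol n (δ k) (γ j) z‖ ^ 2 * (m z * Real.exp (-Φ z)) :=
      fun j => ((tγ j).integrable_mul hK' cmW pmW).1 k
    rw [← integral_finsetSum _ fun j _ => hi j]
    refine integral_mono (integrable_finsetSum _ fun j _ => hi j) ?_ fun z => ?_
    · refine Continuous.integrable_of_hasCompactSupport ?_ ?_
      · have h1 := continuous_cHess h
        have h2 : ∀ j, Continuous (mol n (δ k) (γ j)) := fun j => (cγ k j).continuous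
        have h3 : ∀ j, Continuous (fun z => starRingEnd ℂ (mol n (δ k) (γ j) z)) := fun j =>
          continuous_conj.comp (h2 j)
        unfold hermForm
        refine Continuous.mul (Complex.continuous_re.comp ?_) cW
        fun_prop
      · refine HasCompactSupport.intro hK' fun z hz => ?_
        simp [hermForm, (tγ _).seq_zero k z hz]
    · by_cases hz : z ∈ K'
      · have := mul_le_mul_of_nonneg_right (hm z (hrG hz) fun j => mol n (δ k) (γ j) z) (pW z)
        rw [← Finset.sum_mul]
        linarith
      · simp [hermForm, (tγ _).seq_zero k z hz]
  have lim1 : Tendsto (fun k => ∑ j, ∫ z, ‖mol n (δ k) (γ j) z‖ ^ 2 * (m z * Real.exp (-Φ z)))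
      atTop (𝓝 (∑ j, ∫ z, ‖γ j z‖ ^ 2 * (m z * Real.exp (-Φ z)))) :=
    tendsto_finsetSum _ fun j _ => (tγ j).tendsto_integral_mul hK' cmW pmW
  have lim2 := (tC.tendsto_integral_mul hK' cW pW).add
    ((tendsto_finsetSum Finset.univ fun j _ => tendsto_finsetSum Finset.univ fun l _ =>
      (tA j l).tendsto_integral_mul hK' cW pW).const_mul (1 / 2))
  have fin := le_of_tendsto_of_tendsto' lim1 lim2 main
  have e1 : ∫ z, (∑ j, ‖γ j z‖ ^ 2) * (m z * Real.exp (-Φ z)) =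
      ∑ j, ∫ z, ‖γ j z‖ ^ 2 * (m z * Real.exp (-Φ z)) := by
    simp only [Finset.sum_mul]
    exact integral_finsetSum _ fun j _ => ((tγ j).integrable_mul hK' cmW pmW).2
  have e2 : ∫ z, (∑ j, ∑ l, ‖A j l z‖ ^ 2) * Real.exp (-Φ z) =
      ∑ j, ∑ l, ∫ z, ‖A j l z‖ ^ 2 * Real.exp (-Φ z) := by
    simp only [Finset.sum_mul]
    have hi : ∀ j l, Integrable fun z => ‖A j l z‖ ^ 2 * Real.exp (-Φ z) :=
      fun j l => ((tA j l).integrable_mul hK' cW pW).2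
    rw [integral_finsetSum _ fun j _ => integrable_finsetSum _ fun l _ => hi j l]
    exact Finset.sum_congr rfl fun j _ => integral_finsetSum _ fun l _ => hi j l
  rw [e1, e2]
  exact fin

end WeakBasicInequality

section LocalizedEstimate

variable {n : ℕ}

theorem conj_integral_sum_mul (b θ : Fin n → (Fin n → ℂ) → ℂ) :
    starRingEnd ℂ (∫ z, ∑ j, b j z * θ j z) =
      ∫ z, ∑ j, starRingEnd ℂ (b j z) * starRingEnd ℂ (θ j z) := by
  rw [← integral_conj]
  simp only [map_sum, map_mul]

theorem contDiff_exp_ofReal {Φ : (Fin n → ℂ) → ℝ} {k : WithTop ℕ∞} (h : ContDiff ℝ k Φ) (c : ℝ) :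
    ContDiff ℝ k (fun z => (Real.exp (c * Φ z) : ℂ)) :=
  contDiff_ofReal_comp (Real.contDiff_exp.comp (contDiff_const.mul h))

theorem wder_exp {Φ : (Fin n → ℂ) → ℝ} (h : ContDiff ℝ 1 Φ) (j : Fin n) (z : Fin n → ℂ) :
    wder n j (fun w => (Real.exp (Φ w) : ℂ)) z =
      wder n j (fun v => (Φ v : ℂ)) z * Real.exp (Φ z) := by
  have h1 := wder_weight h.neg j z
  have h2 : wder n j (fun v => ((-Φ v : ℝ) : ℂ)) z = -wder n j (fun v => (Φ v : ℂ)) z := by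
    simp only [wder, Complex.ofReal_neg, fderiv_fun_neg, neg_apply]
    ring
  simp only [neg_neg, h2] at h1
  rw [h1]; ring

theorem conj_wderBar_ofReal (u : (Fin n → ℂ) → ℝ) (j : Fin n) (z : Fin n → ℂ) :
    starRingEnd ℂ (wderBar n j (fun w => (u w : ℂ)) z) = wder n j (fun w => (u w : ℂ)) z := by
  rw [← wder_conj]
  simp only [Complex.conj_ofReal]

theorem tsupport_mul_ofReal_subset (η : (Fin n → ℂ) → ℝ) (f : (Fin n → ℂ) → ℂ) :
    tsupport (fun z => (η z : ℂ) * f z) ⊆ tsupport η :=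
  closure_mono fun z hz => by
    rw [Function.mem_support] at hz ⊢
    exact fun h => hz (by rw [h]; simp)

theorem tsupport_ofReal (η : (Fin n → ℂ) → ℝ) :
    tsupport (fun z => (η z : ℂ)) = tsupport η := by
  unfold tsupport
  congr 1; ext z; simp

theorem sq_norm_add_le (a b : ℂ) : ‖a + b‖ ^ 2 ≤ 2 * ‖a‖ ^ 2 + 2 * ‖b‖ ^ 2 := by
  have := norm_add_le a b
  nlinarith [sq_nonneg (‖a‖ - ‖b‖), norm_nonneg (a + b), norm_nonneg a, norm_nonneg b]

theorem sq_norm_sum_mul_le (a b : Fin n → ℂ) :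
    ‖∑ j, a j * b j‖ ^ 2 ≤ (∑ j, ‖a j‖ ^ 2) * ∑ j, ‖b j‖ ^ 2 := by
  have h1 : ‖∑ j, a j * b j‖ ≤ ∑ j, ‖a j‖ * ‖b j‖ :=
    (norm_sum_le _ _).trans (le_of_eq (by simp only [norm_mul]))
  exact (pow_le_pow_left₀ (norm_nonneg _) h1 2).trans (Finset.sum_mul_sq_le_sq_mul_sq _ _ _)

theorem sum_sum_sq_norm_sub_le (b c : Fin n → ℂ) :
    ∑ j, ∑ k, ‖b j * c k - b k * c j‖ ^ 2 ≤ 4 * ((∑ j, ‖b j‖ ^ 2) * ∑ j, ‖c j‖ ^ 2) := by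
  have h1 : ∀ j k, ‖b j * c k - b k * c j‖ ^ 2 ≤
      2 * (‖b j‖ ^ 2 * ‖c k‖ ^ 2) + 2 * (‖b k‖ ^ 2 * ‖c j‖ ^ 2) := fun j k => by
    have := sq_norm_add_le (b j * c k) (-(b k * c j))
    rw [← sub_eq_add_neg, norm_neg, norm_mul, norm_mul, mul_pow, mul_pow] at this
    exact this
  refine (Finset.sum_le_sum fun j _ => Finset.sum_le_sum fun k _ => h1 j k).trans (le_of_eq ?_)
  simp only [Finset.sum_add_distrib, ← Finset.mul_sum, ← Finset.sum_mul]
  ring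

/-- The localized `L²` estimate for a form which is `∂̄`-closed and has prescribed formal
adjoint in an open set `G`. -/
theorem localized_estimate {Φ : (Fin n → ℂ) → ℝ} (h : ContDiff ℝ 2 Φ)
    {G : Set (Fin n → ℂ)} (hG : IsOpen G)
    {m : (Fin n → ℂ) → ℝ} (hmc : Continuous m) (hm0 : ∀ z, 0 ≤ m z)
    (hm : ∀ z ∈ G, ∀ X : Fin n → ℂ, m z * ∑ j, ‖X j‖ ^ 2 ≤ hermForm n (cHess n Φ z) X X)
    {b : Fin n → (Fin n → ℂ) → ℂ} {d : (Fin n → ℂ) → ℂ}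
    (hb : ∀ j, MemLp (b j) 2) (hd : Continuous d)
    (hcl : ∀ θ : (Fin n → ℂ) → ℂ, ContDiff ℝ 2 θ → HasCompactSupport θ → tsupport θ ⊆ G →
      ∀ j k, ∫ z, (b j z * wderBar n k θ z - b k z * wderBar n j θ z) *
        Real.exp ((1 / 2) * Φ z) = 0)
    (hdiv : ∀ θ : (Fin n → ℂ) → ℂ, ContDiff ℝ 2 θ → HasCompactSupport θ → tsupport θ ⊆ G →
      ∫ z, ∑ j, starRingEnd ℂ (b j z) * (wderBar n j θ z * Real.exp (-(1 / 2) * Φ z)) =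
        -∫ z, d z * θ z)
    {η : (Fin n → ℂ) → ℝ} (hη : ContDiff ℝ 2 η) (hηc : HasCompactSupport η)
    (hηG : tsupport η ⊆ G) :
    ∫ z, (∑ j, ‖b j z‖ ^ 2) * (m z * η z ^ 2) ≤
      2 * (∫ z, ‖d z‖ ^ 2 * (η z ^ 2 * Real.exp (Φ z))) +
      4 * ∫ z, (∑ j, ‖b j z‖ ^ 2) * ∑ k, ‖wderBar n k (fun w => (η w : ℂ)) z‖ ^ 2 := by
  have hli : ∀ j, LocallyIntegrable (b j) := fun j => (hb j).locallyIntegrable (by norm_num)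
  have hηC : ContDiff ℝ 2 (fun z => (η z : ℂ)) := contDiff_ofReal_comp hη
  have hηs : HasCompactSupport (fun z => (η z : ℂ)) := by
    rw [HasCompactSupport, tsupport_ofReal]; exact hηc
  have hE : ContDiff ℝ 2 (fun z => (Real.exp ((1 / 2) * Φ z) : ℂ)) := contDiff_exp_ofReal h _
  have hEm : ContDiff ℝ 2 (fun z => (Real.exp (-(1 / 2) * Φ z) : ℂ)) := contDiff_exp_ofReal h _
  have hE1 : ContDiff ℝ 2 (fun z => (Real.exp (Φ z) : ℂ)) := by
    simpa using contDiff_exp_ofReal h 1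
  have hdη : ∀ k, Continuous (wderBar n k (fun w => (η w : ℂ))) := fun k =>
    (contDiff_wderBar (m := 1) k hηC (by norm_num)).continuous
  have hdη' : ∀ k, Continuous (wder n k (fun w => (η w : ℂ))) := fun k =>
    (contDiff_wder (m := 1) k hηC (by norm_num)).continuous
  have hdΦ : ∀ k, Continuous (wder n k (fun w => (Φ w : ℂ))) := fun k =>
    (contDiff_wder (m := 1) k (contDiff_ofReal_comp h) (by norm_num)).continuous
  have zη : ∀ z ∉ tsupport η, η z = 0 := fun z hz => image_eq_zero_of_notMem_tsupport hz
  have zdη : ∀ z ∉ tsupport η, ∀ k, wderBar n k (fun w => (η w : ℂ)) z = 0 := fun z hz k =>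
    wderBar_eq_zero_of_notMem k (by rwa [tsupport_ofReal])
  have zdη' : ∀ z ∉ tsupport η, ∀ k, wder n k (fun w => (η w : ℂ)) z = 0 := fun z hz k =>
    wder_eq_zero_of_notMem k (by rwa [tsupport_ofReal])
  have cE := hE.continuous
  have cE1 := hE1.continuous
  have cη := hηC.continuous
  -- a continuous function supported in `tsupport η` times an `L²` function is `L²`
  have mem : ∀ (p : (Fin n → ℂ) → ℂ) (j : Fin n), Continuous p → (∀ z ∉ tsupport η, p z = 0) →
      MemLp (fun z => p z * b j z) 2 := by
    intro p j hp hp0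
    obtain ⟨C, hC⟩ := (HasCompactSupport.intro hηc hp0).exists_bound_of_continuous hp
    refine MemLp.of_le_mul (c := C) (hb j) (hp.aestronglyMeasurable.mul (hb j).1)
      (ae_of_all _ fun z => ?_)
    rw [norm_mul]; gcongr; exact hC z
  set γ : Fin n → (Fin n → ℂ) → ℂ := fun j z => (η z * Real.exp ((1 / 2) * Φ z)) * b j z with hγ
  set A : Fin n → Fin n → (Fin n → ℂ) → ℂ := fun j k z =>
    (wderBar n k (fun w => (η w : ℂ)) z * Real.exp ((1 / 2) * Φ z)) * b j z -
    (wderBar n j (fun w => (η w : ℂ)) z * Real.exp ((1 / 2) * Φ z)) * b k z with hA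
  set B : (Fin n → ℂ) → ℂ := fun z => starRingEnd ℂ (d z) * (η z * Real.exp (Φ z)) +
    ∑ j, ((wder n j (fun w => (η w : ℂ)) z + η z * wder n j (fun w => (Φ w : ℂ)) z) *
      Real.exp ((1 / 2) * Φ z)) * b j z with hB
  have mγ : ∀ j, MemLp (γ j) 2 := fun j => mem (fun z => η z * Real.exp ((1 / 2) * Φ z)) j
    (cη.mul cE) fun z hz => by simp [zη z hz]
  have mA : ∀ j k, MemLp (A j k) 2 := fun j k =>
    (mem (fun z => wderBar n k (fun w => (η w : ℂ)) z * Real.exp ((1 / 2) * Φ z)) j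
      ((hdη k).mul cE) fun z hz => by simp [zdη z hz]).sub
    (mem (fun z => wderBar n j (fun w => (η w : ℂ)) z * Real.exp ((1 / 2) * Φ z)) k
      ((hdη j).mul cE) fun z hz => by simp [zdη z hz])
  have mB : MemLp B 2 := by
    refine MemLp.add ?_ (memLp_finsetSum _ fun j _ => ?_)
    · refine memLp_two_of_continuous ((continuous_conj.comp hd).mul (cη.mul cE1)) ?_
      exact hηs.mul_right.mul_left
    · exact mem (fun z => (wder n j (fun w => (η w : ℂ)) z + η z * wder n j (fun w => (Φ w : ℂ)) z)
        * Real.exp ((1 / 2) * Φ z)) j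
        (((hdη' j).add (cη.mul (hdΦ j))).mul cE) fun z hz => by simp [zdη' z hz, zη z hz]
  have expand : ∀ z, Real.exp (Φ z) = Real.exp ((1 / 2) * Φ z) * Real.exp ((1 / 2) * Φ z) :=
    fun z => by rw [← Real.exp_add]; congr 1; ring
  have cancel : ∀ z, Real.exp ((1 / 2) * Φ z) * Real.exp (-(1 / 2) * Φ z) = 1 :=
    fun z => by rw [← Real.exp_add, Real.exp_eq_one_iff]; ring
  have cancel' : ∀ z, Real.exp ((1 / 2) * Φ z) * Real.exp ((1 / 2) * Φ z) * Real.exp (-Φ z) = 1 :=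
    fun z => by rw [← Real.exp_add, ← Real.exp_add, Real.exp_eq_one_iff]; ring
  have key := weak_basic_inequality h hG hηc hηG hmc hm0 hm mγ mB mA
    (fun j z hz => by simp [hγ, zη z hz])
    (fun z hz => by simp [hB, zη z hz, zdη' z hz])
    (fun j k z hz => by simp [hA, zdη z hz])
    (by
      intro θ hθ hθc
      have hθ' : ContDiff ℝ 2 (fun z => starRingEnd ℂ (θ z)) := contDiff_conj_comp hθ
      have hp : ContDiff ℝ 2 (fun z => (η z : ℂ) * (Real.exp (Φ z) * starRingEnd ℂ (θ z))) :=
        hηC.mul (hE1.mul hθ')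
      have h1 := congrArg (starRingEnd ℂ) (hdiv _ hp hηs.mul_right
        ((tsupport_mul_ofReal_subset _ _).trans hηG))
      rw [conj_integral_sum_mul (fun j z => starRingEnd ℂ (b j z)), map_neg, ← integral_conj] at h1
      have e : ∀ z j, starRingEnd ℂ (starRingEnd ℂ (b j z)) * starRingEnd ℂ
          (wderBar n j (fun z => (η z : ℂ) * (Real.exp (Φ z) * starRingEnd ℂ (θ z))) z *
            Real.exp (-(1 / 2) * Φ z)) =
          γ j z * wder n j θ z + (((wder n j (fun w => (η w : ℂ)) z + η z *
            wder n j (fun w => (Φ w : ℂ)) z) * Real.exp ((1 / 2) * Φ z)) * b j z) * θ z := by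
        intro z j
        rw [map_mul, ← wder_conj]
        simp only [map_mul, Complex.conj_conj, Complex.conj_ofReal]
        rw [wder_mul j (hηC.differentiable (by norm_num) z)
          ((hE1.mul hθ).differentiable (by norm_num) z),
          wder_mul j (hE1.differentiable (by norm_num) z) (hθ.differentiable (by norm_num) z),
          wder_exp (h.of_le (by norm_num))]
        have e1 : (Real.exp (Φ z) : ℂ) =
          Real.exp ((1 / 2) * Φ z) * Real.exp ((1 / 2) * Φ z) := by
            rw [expand z]; push_cast; ring
        have e2 : (Real.exp ((1 / 2) * Φ z) : ℂ) * Real.exp (-(1 / 2) * Φ z) = 1 := by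
          rw [← Complex.ofReal_mul, cancel, Complex.ofReal_one]
        rw [e1]
        simp only [hγ]
        linear_combination (Real.exp ((1 / 2) * Φ z) * b j z * (wder n j (fun w => (η w : ℂ)) z *
          θ z + η z * (wder n j (fun w => (Φ w : ℂ)) z * θ z + wder n j θ z))) * e2
      simp only [e] at h1
      have cθ := hθ.continuous
      have i1 : ∀ j, Integrable fun z => γ j z * wder n j θ z := fun j =>
        integrable_mul_continuous_compact ((mγ j).locallyIntegrable (by norm_num))
          (contDiff_wder (m := 1) j hθ (by norm_num)).continuous (hθc.wder j)
      have i2 : Integrable fun z => B z * θ z :=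
        integrable_mul_continuous_compact (mB.locallyIntegrable (by norm_num)) cθ hθc
      have i3 : Integrable fun z => starRingEnd ℂ (d z) * (η z * (Real.exp (Φ z) * θ z)) :=
        ((continuous_conj.comp hd).mul (cη.mul (cE1.mul cθ))).integrable_of_hasCompactSupport
          hηs.mul_right.mul_left
      have e3 : ∀ z, ∑ j, (γ j z * wder n j θ z + (((wder n j (fun w => (η w : ℂ)) z + η z *
            wder n j (fun w => (Φ w : ℂ)) z) * Real.exp ((1 / 2) * Φ z)) * b j z) * θ z) =
          ((∑ j, γ j z * wder n j θ z) + B z * θ z) -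
            starRingEnd ℂ (d z) * (η z * (Real.exp (Φ z) * θ z)) := by
        intro z
        simp only [hB, Finset.sum_add_distrib, ← Finset.sum_mul]
        ring
      simp only [e3, map_mul, Complex.conj_conj, Complex.conj_ofReal] at h1
      have i1s : Integrable fun z => ∑ j, γ j z * wder n j θ z :=
        integrable_finsetSum _ fun j _ => i1 j
      have i12 : Integrable fun z => (∑ j, γ j z * wder n j θ z) + B z * θ z := i1s.add i2
      rw [integral_sub i12 i3, integral_add i1s i2] at h1
      linear_combination h1)
    (by
      intro θ hθ hθc j k
      have h1 := hcl _ (hηC.mul hθ) hηs.mul_right ((tsupport_mul_ofReal_subset _ _).trans hηG) j k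
      have dη := hηC.differentiable (by norm_num)
      have dθ := hθ.differentiable (by norm_num)
      have e : ∀ z, (b j z * wderBar n k (fun z => (η z : ℂ) * θ z) z -
          b k z * wderBar n j (fun z => (η z : ℂ) * θ z) z) * Real.exp ((1 / 2) * Φ z) =
          (γ j z * wderBar n k θ z - γ k z * wderBar n j θ z) + A j k z * θ z := by
        intro z
        rw [wderBar_mul k (dη z) (dθ z), wderBar_mul j (dη z) (dθ z)]
        simp only [hγ, hA]
        ring
      simp only [e] at h1
      have i1 : ∀ j k, Integrable fun z => γ j z * wderBar n k θ z := fun j k =>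
        integrable_mul_continuous_compact ((mγ j).locallyIntegrable (by norm_num))
          (contDiff_wderBar (m := 1) k hθ (by norm_num)).continuous (hθc.wderBar k)
      have i2 : Integrable fun z => A j k z * θ z :=
        integrable_mul_continuous_compact ((mA j k).locallyIntegrable (by norm_num))
          hθ.continuous hθc
      have i12 : Integrable fun z => γ j z * wderBar n k θ z - γ k z * wderBar n j θ z :=
        (i1 j k).sub (i1 k j)
      rw [integral_add i12 i2] at h1
      linear_combination h1)
  have nr : ∀ r : ℝ, 0 ≤ r → ‖(r : ℂ)‖ = r := fun r hr => by
    rw [Complex.norm_real, Real.norm_of_nonneg hr]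
  have nsq : ∀ r : ℝ, ‖(r : ℂ)‖ ^ 2 = r ^ 2 := fun r => by
    rw [Complex.norm_real, Real.norm_eq_abs, sq_abs]
  have L : ∀ z, (∑ j, ‖γ j z‖ ^ 2) * (m z * Real.exp (-Φ z)) =
      (∑ j, ‖b j z‖ ^ 2) * (m z * η z ^ 2) := by
    intro z
    simp only [hγ, norm_mul, mul_pow, nsq, ← Finset.mul_sum]
    linear_combination ((∑ j, ‖b j z‖ ^ 2) * (m z * η z ^ 2)) * cancel' z
  have b2i : ∀ j, Integrable fun z => ‖b j z‖ ^ 2 := fun j => (hb j).integrable_norm_pow (by norm_num)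
  set S : (Fin n → ℂ) → ℝ := fun z => ∑ k, ‖wderBar n k (fun w => (η w : ℂ)) z‖ ^ 2 with hS
  have cS : Continuous S := by simp only [hS]; fun_prop
  have sS : HasCompactSupport S := HasCompactSupport.intro hηc fun z hz => by
    simp [hS, zdη z hz]
  have iS : Integrable fun z => (∑ j, ‖b j z‖ ^ 2) * S z := by
    obtain ⟨C, hC⟩ := sS.exists_bound_of_continuous cS
    exact (integrable_finsetSum _ fun j _ => b2i j).mul_bdd (c := C) cS.aestronglyMeasurable
      (ae_of_all _ hC)
  have iD : Integrable fun z => ‖d z‖ ^ 2 * (η z ^ 2 * Real.exp (Φ z)) := by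
    refine Continuous.integrable_of_hasCompactSupport ?_ (HasCompactSupport.intro hηc fun z hz => by
      simp [zη z hz])
    have := hη.continuous
    have := h.continuous
    fun_prop
  have R1 : ∀ z, ‖B z - ∑ j, wder n j (fun v => (Φ v : ℂ)) z * γ j z‖ ^ 2 * Real.exp (-Φ z) ≤
      2 * (‖d z‖ ^ 2 * (η z ^ 2 * Real.exp (Φ z))) + 2 * ((∑ j, ‖b j z‖ ^ 2) * S z) := by
    intro z
    have e : B z - ∑ j, wder n j (fun v => (Φ v : ℂ)) z * γ j z =
        Real.exp ((1 / 2) * Φ z) * (starRingEnd ℂ (d z) * (η z * Real.exp ((1 / 2) * Φ z)) +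
          ∑ j, wder n j (fun w => (η w : ℂ)) z * b j z) := by
      have e1 : (Real.exp (Φ z) : ℂ) =
          Real.exp ((1 / 2) * Φ z) * Real.exp ((1 / 2) * Φ z) := by
        rw [← Complex.ofReal_mul, ← expand z]
      simp only [hB, hγ]
      rw [e1, mul_add, Finset.mul_sum, add_sub_assoc, ← Finset.sum_sub_distrib]
      congr 1
      · ring
      · exact Finset.sum_congr rfl fun j _ => by ring
    have h1 := sq_norm_add_le (starRingEnd ℂ (d z) * (η z * Real.exp ((1 / 2) * Φ z)))
      (∑ j, wder n j (fun w => (η w : ℂ)) z * b j z)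
    have h2 := sq_norm_sum_mul_le (fun j => wder n j (fun w => (η w : ℂ)) z) (fun j => b j z)
    have h3 : ∑ j, ‖wder n j (fun w => (η w : ℂ)) z‖ ^ 2 = S z := by
      simp only [hS, ← conj_wderBar_ofReal, RCLike.norm_conj]
    rw [h3] at h2
    have h4 : ‖starRingEnd ℂ (d z) * (η z * Real.exp ((1 / 2) * Φ z))‖ ^ 2 =
        ‖d z‖ ^ 2 * (η z ^ 2 * Real.exp (Φ z)) := by
      rw [norm_mul, norm_mul, RCLike.norm_conj, mul_pow, mul_pow, nsq, nsq, expand z]; ring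
    rw [h4] at h1
    rw [e, norm_mul, mul_pow, nsq]
    calc _ = (Real.exp ((1 / 2) * Φ z) * Real.exp ((1 / 2) * Φ z) * Real.exp (-Φ z)) *
          ‖starRingEnd ℂ (d z) * (η z * Real.exp ((1 / 2) * Φ z)) +
          ∑ j, wder n j (fun w => (η w : ℂ)) z * b j z‖ ^ 2 := by ring
      _ ≤ _ := by rw [cancel', one_mul]; linarith
  have R2 : ∀ z, (∑ j, ∑ k, ‖A j k z‖ ^ 2) * Real.exp (-Φ z) ≤
      4 * ((∑ j, ‖b j z‖ ^ 2) * S z) := by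
    intro z
    have e : ∀ j k, A j k z = Real.exp ((1 / 2) * Φ z) *
        (b j z * wderBar n k (fun w => (η w : ℂ)) z - b k z * wderBar n j (fun w => (η w : ℂ)) z) :=
      fun j k => by simp only [hA]; ring
    have h1 := sum_sum_sq_norm_sub_le (fun j => b j z)
      (fun k => wderBar n k (fun w => (η w : ℂ)) z)
    have h2 : ∑ j, ∑ k, ‖A j k z‖ ^ 2 = (Real.exp ((1 / 2) * Φ z) * Real.exp ((1 / 2) * Φ z)) *
        ∑ j, ∑ k, ‖b j z * wderBar n k (fun w => (η w : ℂ)) z -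
          b k z * wderBar n j (fun w => (η w : ℂ)) z‖ ^ 2 := by
      simp only [e, norm_mul, mul_pow, nsq, ← Finset.mul_sum, ← sq]
    rw [h2, mul_right_comm, cancel', one_mul]
    exact h1
  have I1 : ∫ z, ‖B z - ∑ j, wder n j (fun v => (Φ v : ℂ)) z * γ j z‖ ^ 2 * Real.exp (-Φ z) ≤
      2 * (∫ z, ‖d z‖ ^ 2 * (η z ^ 2 * Real.exp (Φ z))) +
        2 * ∫ z, (∑ j, ‖b j z‖ ^ 2) * S z := by
    rw [← integral_const_mul, ← integral_const_mul, ← integral_add (iD.const_mul _)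
      (iS.const_mul _)]
    exact integral_mono_of_nonneg (ae_of_all _ fun z => by positivity)
      ((iD.const_mul _).add (iS.const_mul _)) (ae_of_all _ R1)
  have I2 : ∫ z, (∑ j, ∑ k, ‖A j k z‖ ^ 2) * Real.exp (-Φ z) ≤
      4 * ∫ z, (∑ j, ‖b j z‖ ^ 2) * S z := by
    rw [← integral_const_mul]
    exact integral_mono_of_nonneg (ae_of_all _ fun z => by positivity)
      (iS.const_mul _) (ae_of_all _ R2)
  simp only [L] at key
  linarith

end LocalizedEstimate

section Projection

variable {n : ℕ}

/-- The `L²` vector attached to an `n`-tuple of square-integrable functions. -/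
noncomputable def toL2 {n : ℕ} (a : Fin n → (Fin n → ℂ) → ℂ) (ha : ∀ j, MemLp (a j) 2) :
    PiLp 2 (fun _ : Fin n => Lp ℂ 2 (volume : Measure (Fin n → ℂ))) :=
  WithLp.toLp 2 fun j => (ha j).toLp (a j)

theorem integrable_conj_mul {f g : (Fin n → ℂ) → ℂ} (hf : MemLp f 2) (hg : MemLp g 2) :
    Integrable fun z => starRingEnd ℂ (f z) * g z :=
  hf.star.integrable_mul hg

theorem inner_toL2 {a b : Fin n → (Fin n → ℂ) → ℂ} (ha : ∀ j, MemLp (a j) 2)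
    (hb : ∀ j, MemLp (b j) 2) :
    inner ℂ (toL2 a ha) (toL2 b hb) = ∫ z, ∑ j, starRingEnd ℂ (a j z) * b j z := by
  rw [integral_finsetSum _ fun j _ => integrable_conj_mul (ha j) (hb j), PiLp.inner_apply]
  refine Finset.sum_congr rfl fun j _ => ?_
  rw [L2.inner_def]
  refine integral_congr_ae ?_
  filter_upwards [(ha j).coeFn_toLp, (hb j).coeFn_toLp] with z h1 h2
  simp only [toL2, h1, h2, RCLike.inner_apply]
  ring

theorem norm_toL2_sq {a : Fin n → (Fin n → ℂ) → ℂ} (ha : ∀ j, MemLp (a j) 2) :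
    ‖toL2 a ha‖ ^ 2 = ∫ z, ∑ j, ‖a j z‖ ^ 2 := by
  have h := inner_self_eq_norm_sq_to_K (𝕜 := ℂ) (toL2 a ha)
  rw [inner_toL2] at h
  have e : ∀ z, ∑ j, starRingEnd ℂ (a j z) * a j z = ((∑ j, ‖a j z‖ ^ 2 : ℝ) : ℂ) := by
    intro z
    push_cast
    exact Finset.sum_congr rfl fun j _ => by rw [Complex.conj_mul']
  simp only [e] at h
  rw [integral_complex_ofReal] at h
  apply Complex.ofReal_injective
  rw [h, Complex.ofReal_pow]
  rfl

theorem exists_toL2 (x : PiLp 2 (fun _ : Fin n => Lp ℂ 2 (volume : Measure (Fin n → ℂ)))) :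
    ∃ (a : Fin n → (Fin n → ℂ) → ℂ) (ha : ∀ j, MemLp (a j) 2), toL2 a ha = x :=
  ⟨fun j => x j, fun _ => Lp.memLp _, PiLp.ext fun _ => Lp.toLp_coeFn _ (Lp.memLp _)⟩

theorem exists_orthogonal_proj {H : Type*} [NormedAddCommGroup H] [InnerProductSpace ℂ H]
    [CompleteSpace H] {ι : Type*} (v : ι → H) (q : H) :
    ∃ b : H, (∀ i, inner ℂ (v i) b = 0) ∧
      (∀ a, (∀ i, inner ℂ (v i) a = 0) → inner ℂ q a = inner ℂ b a) ∧ ‖b‖ ≤ ‖q‖ := by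
  set K := (Submodule.span ℂ (range v))ᗮ with hK
  have mK : ∀ x, x ∈ K ↔ ∀ i, inner ℂ (v i) x = 0 := by
    intro x
    rw [hK, Submodule.mem_orthogonal]
    constructor
    · exact fun h i => h _ (Submodule.subset_span ⟨i, rfl⟩)
    · intro h u hu
      induction hu using Submodule.span_induction with
      | mem x hx => obtain ⟨i, rfl⟩ := hx; exact h i
      | zero => simp
      | add x y _ _ hx hy => rw [inner_add_left, hx, hy, add_zero]
      | smul c x _ hx => rw [inner_smul_left, hx, mul_zero]
  refine ⟨K.starProjection q, (mK _).1 (K.starProjection_apply_mem _), fun a ha => ?_,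
    K.norm_starProjection_apply_le _⟩
  have := K.starProjection_inner_eq_zero q a ((mK a).2 ha)
  rwa [inner_sub_left, sub_eq_zero] at this

theorem exists_projection {ι : Type*} {V : ι → Fin n → (Fin n → ℂ) → ℂ}
    (hV : ∀ i j, MemLp (V i j) 2) {q : Fin n → (Fin n → ℂ) → ℂ} (hq : ∀ j, MemLp (q j) 2) :
    ∃ b : Fin n → (Fin n → ℂ) → ℂ, (∀ j, MemLp (b j) 2) ∧
      (∀ i, ∫ z, ∑ j, starRingEnd ℂ (V i j z) * b j z = 0) ∧
      (∀ a : Fin n → (Fin n → ℂ) → ℂ, (∀ j, MemLp (a j) 2) →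
        (∀ i, ∫ z, ∑ j, starRingEnd ℂ (V i j z) * a j z = 0) →
        ∫ z, ∑ j, starRingEnd ℂ (q j z) * a j z = ∫ z, ∑ j, starRingEnd ℂ (b j z) * a j z) ∧
      ∫ z, ∑ j, ‖b j z‖ ^ 2 ≤ ∫ z, ∑ j, ‖q j z‖ ^ 2 := by
  obtain ⟨x, h1, h2, h3⟩ := exists_orthogonal_proj (fun i => toL2 (V i) (hV i)) (toL2 q hq)
  obtain ⟨b, hb, rfl⟩ := exists_toL2 x
  refine ⟨b, hb, fun i => ?_, fun a ha h => ?_, ?_⟩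
  · rw [← inner_toL2 (hV i) hb]
    exact h1 i
  · rw [← inner_toL2 hq ha, ← inner_toL2 hb ha]
    exact h2 _ fun i => by rw [inner_toL2]; exact h i
  · rw [← norm_toL2_sq hb, ← norm_toL2_sq hq]
    exact pow_le_pow_left₀ (norm_nonneg _) h3 2

end Projection

section Levi

variable {n : ℕ}

/-- The Levi form of `Φ` in terms of its second real derivative. -/
noncomputable def levi {n : ℕ} (Φ : (Fin n → ℂ) → ℝ) (z X : Fin n → ℂ) : ℝ :=
  (1 / 4) * (fderiv ℝ (fderiv ℝ Φ) z X X +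
    fderiv ℝ (fderiv ℝ Φ) z (Complex.I • X) (Complex.I • X))

theorem fderiv_fderiv_apply_real {u : (Fin n → ℂ) → ℝ} (hu : ContDiff ℝ 2 u)
    (z a b : Fin n → ℂ) :
    fderiv ℝ (fun w => fderiv ℝ u w a) z b = fderiv ℝ (fderiv ℝ u) z b a := by
  have h : DifferentiableAt ℝ (fderiv ℝ u) z :=
    ((hu.fderiv_right (m := 1) (by norm_num)).differentiable (by norm_num)) z
  rw [fderiv_clm_apply h (by fun_prop)]
  simp

theorem fderiv_ofReal_comp {u : (Fin n → ℂ) → ℝ} {z : Fin n → ℂ} (hu : DifferentiableAt ℝ u z)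
    (a : Fin n → ℂ) : fderiv ℝ (fun w => (u w : ℂ)) z a = (fderiv ℝ u z a : ℝ) := by
  have := (Complex.ofRealCLM.hasFDerivAt.comp z hu.hasFDerivAt).fderiv
  have e : (fun w => (u w : ℂ)) = Complex.ofRealCLM ∘ u := rfl
  rw [e, this]; rfl

theorem fderiv_fderiv_ofReal {u : (Fin n → ℂ) → ℝ} (hu : ContDiff ℝ 2 u) (z a b : Fin n → ℂ) :
    fderiv ℝ (fderiv ℝ (fun w => (u w : ℂ))) z b a = (fderiv ℝ (fderiv ℝ u) z b a : ℝ) := by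
  rw [← fderiv_fderiv_apply (contDiff_ofReal_comp hu), ← fderiv_fderiv_apply_real hu]
  have e : (fun w => fderiv ℝ (fun w => (u w : ℂ)) w a) = fun w => ((fderiv ℝ u w a : ℝ) : ℂ) :=
    funext fun w => fderiv_ofReal_comp (hu.differentiable (by norm_num) w) a
  rw [e, fderiv_ofReal_comp]
  exact (((hu.fderiv_right (m := 1) (by norm_num)).clm_apply contDiff_const).differentiable
      (by norm_num)) z

theorem eq_sum_re_im (X : Fin n → ℂ) :
    X = ∑ j, ((X j).re • (Pi.single j 1 : Fin n → ℂ) +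
      (X j).im • (Pi.single j Complex.I : Fin n → ℂ)) := by
  ext k
  simp only [Finset.sum_apply, Pi.add_apply, Pi.smul_apply, Pi.single_apply]
  simp [Finset.sum_add_distrib]

theorem bilin_expand (B : (Fin n → ℂ) →L[ℝ] (Fin n → ℂ) →L[ℝ] ℝ) (X : Fin n → ℂ) :
    B X X = ∑ j, ∑ k,
      ((X k).re * (X j).re * B (Pi.single k 1) (Pi.single j 1) +
       (X k).re * (X j).im * B (Pi.single k 1) (Pi.single j Complex.I) +
       (X k).im * (X j).re * B (Pi.single k Complex.I) (Pi.single j 1) +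
       (X k).im * (X j).im * B (Pi.single k Complex.I) (Pi.single j Complex.I)) := by
  conv_lhs => rw [eq_sum_re_im X]
  simp only [map_sum, map_add, map_smul, sum_apply, add_apply, smul_apply, smul_eq_mul]
  refine Finset.sum_congr rfl fun j _ => ?_
  rw [Finset.mul_sum, Finset.mul_sum, ← Finset.sum_add_distrib]
  exact Finset.sum_congr rfl fun k _ => by ring

theorem hermForm_cHess {Φ : (Fin n → ℂ) → ℝ} (h : ContDiff ℝ 2 Φ) (z X : Fin n → ℂ) :
    hermForm n (cHess n Φ z) X X = levi Φ z X := by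
  have hC := contDiff_ofReal_comp h
  have e : ∀ j k, cHess n Φ z j k = (1 / 4 : ℂ) *
      ((fderiv ℝ (fderiv ℝ Φ) z (Pi.single k 1) (Pi.single j 1) : ℝ) -
        Complex.I * (fderiv ℝ (fderiv ℝ Φ) z (Pi.single k 1) (Pi.single j Complex.I) : ℝ) +
      Complex.I * ((fderiv ℝ (fderiv ℝ Φ) z (Pi.single k Complex.I) (Pi.single j 1) : ℝ) -
        Complex.I * (fderiv ℝ (fderiv ℝ Φ) z (Pi.single k Complex.I)
          (Pi.single j Complex.I) : ℝ))) := by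
    intro j k
    simp only [← fderiv_fderiv_ofReal h]
    show wderBar n k (wder n j (fun v => (Φ v : ℂ))) z = _
    rw [wderBar, fderiv_wder hC, fderiv_wder hC]
    ring
  rw [levi, bilin_expand, bilin_expand, hermForm, ← Finset.sum_add_distrib, Complex.re_sum,
    Finset.mul_sum]
  refine Finset.sum_congr rfl fun j _ => ?_
  rw [← Finset.sum_add_distrib, Complex.re_sum, Finset.mul_sum]
  refine Finset.sum_congr rfl fun k _ => ?_
  rw [e]
  generalize fderiv ℝ (fderiv ℝ Φ) z (Pi.single k 1) (Pi.single j 1) = b1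
  generalize fderiv ℝ (fderiv ℝ Φ) z (Pi.single k 1) (Pi.single j Complex.I) = b2
  generalize fderiv ℝ (fderiv ℝ Φ) z (Pi.single k Complex.I) (Pi.single j 1) = b3
  generalize fderiv ℝ (fderiv ℝ Φ) z (Pi.single k Complex.I) (Pi.single j Complex.I) = b4
  have h4 : (1 / 4 : ℂ) = ((1 / 4 : ℝ) : ℂ) := by norm_num
  rw [h4]
  simp
  ring

theorem fderiv_fderiv_add {u v : (Fin n → ℂ) → ℝ} (hu : ContDiff ℝ 2 u) (hv : ContDiff ℝ 2 v)
    (z : Fin n → ℂ) : fderiv ℝ (fderiv ℝ (fun w => u w + v w)) z =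
      fderiv ℝ (fderiv ℝ u) z + fderiv ℝ (fderiv ℝ v) z := by
  have e : fderiv ℝ (fun w => u w + v w) = fun w => fderiv ℝ u w + fderiv ℝ v w := funext fun w =>
    fderiv_fun_add (hu.differentiable (by norm_num) w) (hv.differentiable (by norm_num) w)
  rw [e]
  exact fderiv_fun_add
    ((hu.fderiv_right (m := 1) (by norm_num)).differentiable (by norm_num) z)
    ((hv.fderiv_right (m := 1) (by norm_num)).differentiable (by norm_num) z)

theorem levi_add {u v : (Fin n → ℂ) → ℝ} (hu : ContDiff ℝ 2 u) (hv : ContDiff ℝ 2 v)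
    (z X : Fin n → ℂ) : levi (fun w => u w + v w) z X = levi u z X + levi v z X := by
  simp only [levi, fderiv_fderiv_add hu hv, add_apply]
  ring

theorem levi_const (c : ℝ) (z X : Fin n → ℂ) : levi (fun _ => c) z X = 0 := by
  have : fderiv ℝ (fun _ : Fin n → ℂ => c) = fun _ => 0 := funext fun _ => fderiv_const_apply c
  simp [levi, this]

theorem fderiv_fderiv_comp {g : ℝ → ℝ} {u : (Fin n → ℂ) → ℝ} {g' g'' : ℝ → ℝ}
    (hg : ∀ w, HasDerivAt g (g' (u w)) (u w)) (hu : ContDiff ℝ 2 u) (z X : Fin n → ℂ)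
    (hg' : HasDerivAt g' (g'' (u z)) (u z)) :
    fderiv ℝ (fderiv ℝ (fun w => g (u w))) z X X =
      g' (u z) * fderiv ℝ (fderiv ℝ u) z X X + g'' (u z) * (fderiv ℝ u z X) ^ 2 := by
  have du : ∀ w, DifferentiableAt ℝ u w := hu.differentiable (by norm_num)
  have e : fderiv ℝ (fun w => g (u w)) = fun w => g' (u w) • fderiv ℝ u w := funext fun w =>
    ((hg w).comp_hasFDerivAt w (du w).hasFDerivAt).fderiv
  rw [e]
  have h1 : HasFDerivAt (fun w => g' (u w)) (g'' (u z) • fderiv ℝ u z) z :=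
    hg'.comp_hasFDerivAt z (du z).hasFDerivAt
  have h2 : HasFDerivAt (fderiv ℝ u) (fderiv ℝ (fderiv ℝ u) z) z :=
    ((hu.fderiv_right (m := 1) (by norm_num)).differentiable (by norm_num) z).hasFDerivAt
  rw [(h1.fun_smul h2).fderiv]
  simp
  ring

theorem levi_comp {g : ℝ → ℝ} {u : (Fin n → ℂ) → ℝ} {g' g'' : ℝ → ℝ}
    (hg : ∀ w, HasDerivAt g (g' (u w)) (u w)) (hu : ContDiff ℝ 2 u) (z X : Fin n → ℂ)
    (hg' : HasDerivAt g' (g'' (u z)) (u z)) :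
    levi (fun w => g (u w)) z X = g' (u z) * levi u z X +
      (1 / 4) * g'' (u z) * ((fderiv ℝ u z X) ^ 2 + (fderiv ℝ u z (Complex.I • X)) ^ 2) := by
  simp only [levi, fderiv_fderiv_comp hg hu z _ hg']
  ring

theorem levi_const_mul (c : ℝ) {u : (Fin n → ℂ) → ℝ} (hu : ContDiff ℝ 2 u)
    (z X : Fin n → ℂ) : levi (fun w => c * u w) z X = c * levi u z X := by
  rw [levi_comp (g := fun x => c * x) (g' := fun _ => c) (g'' := fun _ => 0)
    (fun w => by simpa using (hasDerivAt_id (u w)).const_mul c) hu z X (hasDerivAt_const _ _)]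
  ring

/-- The squared Euclidean distance to `p`. -/
noncomputable def sqDist {n : ℕ} (p z : Fin n → ℂ) : ℝ := ∑ j, ‖z j - p j‖ ^ 2

theorem hasFDerivAt_sqDist (p z : Fin n → ℂ) :
    HasFDerivAt (sqDist p) (∑ j, ((2 * (z j - p j).re) • (Complex.reCLM.comp
      (ContinuousLinearMap.proj (R := ℝ) (φ := fun _ : Fin n => ℂ) j)) +
      (2 * (z j - p j).im) • (Complex.imCLM.comp
      (ContinuousLinearMap.proj (R := ℝ) (φ := fun _ : Fin n => ℂ) j)))) z := by
  have e : sqDist p = fun z : Fin n → ℂ =>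
      ∑ j, ((Complex.reCLM.comp (ContinuousLinearMap.proj (R := ℝ) (φ := fun _ : Fin n => ℂ) j) z -
        (p j).re) ^ 2 + (Complex.imCLM.comp
        (ContinuousLinearMap.proj (R := ℝ) (φ := fun _ : Fin n => ℂ) j) z - (p j).im) ^ 2) := by
    funext z
    refine Finset.sum_congr rfl fun j _ => ?_
    rw [← Complex.normSq_eq_norm_sq, Complex.normSq_apply]
    simp
    ring
  rw [e]
  refine HasFDerivAt.fun_sum fun j _ => ?_
  have h1 := (((Complex.reCLM.comp (ContinuousLinearMap.proj (R := ℝ)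
    (φ := fun _ : Fin n => ℂ) j)).hasFDerivAt (x := z)).sub_const (p j).re).pow 2
  have h2 := (((Complex.imCLM.comp (ContinuousLinearMap.proj (R := ℝ)
    (φ := fun _ : Fin n => ℂ) j)).hasFDerivAt (x := z)).sub_const (p j).im).pow 2
  convert h1.fun_add h2 using 1
  simp

theorem fderiv_sqDist (p z a : Fin n → ℂ) : fderiv ℝ (sqDist p) z a =
    ∑ j, (2 * (z j - p j).re * (a j).re + 2 * (z j - p j).im * (a j).im) := by
  rw [(hasFDerivAt_sqDist p z).fderiv]
  simp [sum_apply]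

theorem contDiff_sqDist (p : Fin n → ℂ) {k : WithTop ℕ∞} : ContDiff ℝ k (sqDist p) := by
  unfold sqDist
  refine ContDiff.sum fun j _ => ContDiff.norm_sq ℝ ?_
  exact (contDiff_apply ℝ ℂ j).sub contDiff_const

theorem levi_sqDist (p z X : Fin n → ℂ) : levi (sqDist p) z X = ∑ j, ‖X j‖ ^ 2 := by
  have h : ∀ a b : Fin n → ℂ, fderiv ℝ (fderiv ℝ (sqDist p)) z b a =
      ∑ j, (2 * (b j).re * (a j).re + 2 * (b j).im * (a j).im) := by
    intro a b
    rw [← fderiv_fderiv_apply_real (contDiff_sqDist p)]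
    have e : (fun w => fderiv ℝ (sqDist p) w a) = fun w => fderiv ℝ (sqDist (-a)) 0 (w - p) := by
      funext w
      rw [fderiv_sqDist, fderiv_sqDist]
      refine Finset.sum_congr rfl fun j _ => ?_
      simp; ring
    rw [e]
    have h2 := ((fderiv ℝ (sqDist (-a)) 0).hasFDerivAt (x := z - p)).comp z
      ((hasFDerivAt_id z).sub_const p)
    rw [show (fun w => fderiv ℝ (sqDist (-a)) 0 (w - p)) =
      (fderiv ℝ (sqDist (-a)) 0) ∘ (fun w => id w - p) from rfl, h2.fderiv]
    simp only [ContinuousLinearMap.comp_apply, ContinuousLinearMap.id_apply, fderiv_sqDist]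
    refine Finset.sum_congr rfl fun j _ => ?_
    simp; ring
  rw [levi, h, h, ← Finset.sum_add_distrib, Finset.mul_sum]
  refine Finset.sum_congr rfl fun j _ => ?_
  rw [← Complex.normSq_eq_norm_sq, Complex.normSq_apply]
  simp
  ring

theorem fderiv_sqDist_sq_add (p z X : Fin n → ℂ) :
    (fderiv ℝ (sqDist p) z X) ^ 2 + (fderiv ℝ (sqDist p) z (Complex.I • X)) ^ 2 ≤
      4 * (sqDist p z * ∑ j, ‖X j‖ ^ 2) := by
  have h := sq_norm_sum_mul_le (fun j => starRingEnd ℂ (z j - p j)) X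
  have e1 : (∑ j, starRingEnd ℂ (z j - p j) * X j).re = (1 / 2) * fderiv ℝ (sqDist p) z X := by
    rw [fderiv_sqDist, Complex.re_sum, Finset.mul_sum]
    exact Finset.sum_congr rfl fun j _ => by simp; ring
  have e2 : (∑ j, starRingEnd ℂ (z j - p j) * X j).im =
      -((1 / 2) * fderiv ℝ (sqDist p) z (Complex.I • X)) := by
    rw [fderiv_sqDist, Complex.im_sum, Finset.mul_sum, ← Finset.sum_neg_distrib]
    exact Finset.sum_congr rfl fun j _ => by simp; ring
  rw [← Complex.normSq_eq_norm_sq, Complex.normSq_apply, e1, e2] at h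
  simp only [RCLike.norm_conj] at h
  unfold sqDist at h ⊢
  linarith

end Levi

section Cutoff

variable {n : ℕ}

theorem exists_cutoff {K G : Set (Fin n → ℂ)} (hK : IsCompact K) (hG : IsOpen G) (hKG : K ⊆ G) :
    ∃ η : (Fin n → ℂ) → ℝ, ContDiff ℝ 2 η ∧ HasCompactSupport η ∧ tsupport η ⊆ G ∧
      (∀ z ∈ K, η =ᶠ[𝓝 z] fun _ => 1) ∧ ∀ z, η z ∈ Icc (0 : ℝ) 1 := by
  obtain ⟨K', hK', h1, h2⟩ := exists_compact_between hK hG hKG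
  obtain ⟨f, hf1, hf0, hf⟩ := exists_contMDiffMap_one_nhds_of_subset_interior
    (n := 2) (modelWithCornersSelf ℝ (Fin n → ℂ)) hK.isClosed h1
  have hs : tsupport (f : (Fin n → ℂ) → ℝ) ⊆ K' := closure_minimal (fun z hz => by
    by_contra h; exact hz (hf0 z h)) hK'.isClosed
  refine ⟨f, f.contMDiff.contDiff, hK'.of_isClosed_subset (isClosed_tsupport _) hs,
    hs.trans h2, fun z hz => ?_, hf⟩
  exact (eventually_nhdsSet_iff_forall.1 hf1) z hz

theorem hasDerivAt_max_pow (k : ℕ) (x : ℝ) :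
    HasDerivAt (fun x : ℝ => max x 0 ^ (k + 2)) ((k + 2) * max x 0 ^ (k + 1)) x := by
  rcases lt_trichotomy x 0 with h | rfl | h
  · rw [max_eq_right h.le, zero_pow (by omega), mul_zero]
    refine (hasDerivAt_const x (0 : ℝ)).congr_of_eventuallyEq ?_
    filter_upwards [gt_mem_nhds h] with y hy
    rw [max_eq_right hy.le, zero_pow (by omega)]
  · have h1 : HasDerivWithinAt (fun x : ℝ => max x 0 ^ (k + 2)) 0 (Iic 0) 0 :=
      (hasDerivWithinAt_const (0 : ℝ) (Iic 0) (0 : ℝ)).congr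
        (fun y hy => by rw [max_eq_right hy, zero_pow (by omega)]) (by simp)
    have h2 : HasDerivWithinAt (fun x : ℝ => max x 0 ^ (k + 2)) 0 (Ici 0) 0 := by
      have := (hasDerivAt_pow (k + 2) (0 : ℝ)).hasDerivWithinAt (s := Ici 0)
      simp only [zero_pow (show k + 2 - 1 ≠ 0 by omega), mul_zero] at this
      exact this.congr (fun y hy => by rw [max_eq_left hy]) (by simp)
    have := h1.union h2
    rw [Iic_union_Ici, hasDerivWithinAt_univ] at this
    simpa using this
  · rw [max_eq_left h.le]
    have := hasDerivAt_pow (k + 2) x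
    push_cast at this
    refine this.congr_of_eventuallyEq ?_
    filter_upwards [lt_mem_nhds h] with y hy
    rw [max_eq_left hy.le]

theorem contDiff_max_pow : ContDiff ℝ 2 (fun x : ℝ => max x 0 ^ 3) := by
  have h2 : ContDiff ℝ 1 (fun x : ℝ => max x 0 ^ 2) := by
    rw [contDiff_one_iff_deriv]
    refine ⟨fun x => (hasDerivAt_max_pow 0 x).differentiableAt, ?_⟩
    have : deriv (fun x : ℝ => max x 0 ^ 2) = _ := funext fun x => (hasDerivAt_max_pow 0 x).deriv
    rw [this]
    fun_prop
  rw [show (2 : WithTop ℕ∞) = 1 + 1 from by norm_num, contDiff_succ_iff_deriv]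
  refine ⟨fun x => (hasDerivAt_max_pow 1 x).differentiableAt, by simp, ?_⟩
  have : deriv (fun x : ℝ => max x 0 ^ 3) = _ := funext fun x => (hasDerivAt_max_pow 1 x).deriv
  rw [this]
  exact contDiff_const.mul h2

end Cutoff

section KeyInequality

variable {n : ℕ}

theorem wderBar_conj_two_form_integral {θ θ' : (Fin n → ℂ) → ℂ} (hθ : ContDiff ℝ 2 θ)
    (hθc : HasCompactSupport θ) (hθ' : ContDiff ℝ 2 θ') (hθc' : HasCompactSupport θ')
    (j k : Fin n) :
    ∫ z, (wderBar n j θ' z * wderBar n k θ z - wderBar n k θ' z * wderBar n j θ z) = 0 := by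
  have c1 : ∀ j, ContDiff ℝ 1 (wderBar n j θ) := fun j => contDiff_wderBar j hθ (by norm_num)
  have c2 : ∀ j, ContDiff ℝ 1 (wderBar n j θ') := fun j => contDiff_wderBar j hθ' (by norm_num)
  have i1 : ∀ j k, Integrable fun z => wderBar n j θ' z * wderBar n k θ z := fun j k =>
    ((c2 j).continuous.mul (c1 k).continuous).integrable_of_hasCompactSupport
      (hθc.wderBar k).mul_left
  have e : ∀ j k, ∫ z, wderBar n j θ' z * wderBar n k θ z =
      -∫ z, θ' z * wderBar n j (wderBar n k θ) z := fun j k =>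
    integral_wderBar_mul (hθ'.of_le (by norm_num)) (c1 k) (Or.inl hθc') j
  rw [integral_sub (i1 j k) (i1 k j), e, e]
  simp only [wderBar_wderBar_comm hθ k j, sub_self]

theorem exists_dual_form {Φ : (Fin n → ℂ) → ℝ} (h : ContDiff ℝ 2 Φ) (G : Set (Fin n → ℂ))
    {ψ : Fin n → (Fin n → ℂ) → ℂ} (hψ : ∀ j, ContDiff ℝ 2 (ψ j))
    (hψc : ∀ j, HasCompactSupport (ψ j))
    {α : Fin n → (Fin n → ℂ) → ℂ} (hα : ∀ j, MemLp (α j) 2) {T : Set (Fin n → ℂ)}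
    (hT : IsCompact T) (hαT : ∀ j, ∀ z ∉ T, α j z = 0)
    (hαcl : ∀ θ : (Fin n → ℂ) → ℂ, ContDiff ℝ 2 θ → HasCompactSupport θ → tsupport θ ⊆ G →
      ∀ j k, ∫ z, (α j z * wderBar n k θ z - α k z * wderBar n j θ z) = 0) :
    ∃ b : Fin n → (Fin n → ℂ) → ℂ, (∀ j, MemLp (b j) 2) ∧
      (∀ θ : (Fin n → ℂ) → ℂ, ContDiff ℝ 2 θ → HasCompactSupport θ → tsupport θ ⊆ G →
        ∀ j k, ∫ z, (b j z * wderBar n k θ z - b k z * wderBar n j θ z) *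
          Real.exp ((1 / 2) * Φ z) = 0) ∧
      (∀ θ : (Fin n → ℂ) → ℂ, ContDiff ℝ 2 θ → HasCompactSupport θ →
        ∫ z, ∑ j, starRingEnd ℂ (b j z) * (wderBar n j θ z * Real.exp (-(1 / 2) * Φ z)) =
          -∫ z, (∑ j, wderBar n j (ψ j) z) * θ z) ∧
      (∫ z, ∑ j, ψ j z * α j z =
        ∫ z, ∑ j, starRingEnd ℂ (b j z) * (α j z * Real.exp (-(1 / 2) * Φ z))) ∧
      ∫ z, ∑ j, ‖b j z‖ ^ 2 ≤ ∫ z, (∑ j, ‖ψ j z‖ ^ 2) * Real.exp (Φ z) := by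
  have hE : ContDiff ℝ 2 (fun z => (Real.exp ((1 / 2) * Φ z) : ℂ)) := contDiff_exp_ofReal h _
  have hEm : ContDiff ℝ 2 (fun z => (Real.exp (-(1 / 2) * Φ z) : ℂ)) := contDiff_exp_ofReal h _
  have cancel : ∀ z, (Real.exp ((1 / 2) * Φ z) : ℂ) * Real.exp (-(1 / 2) * Φ z) = 1 := fun z => by
    rw [← Complex.ofReal_mul, ← Real.exp_add, ← Complex.ofReal_one]
    congr 1; rw [Real.exp_eq_one_iff]; ring
  set ι := {θ : (Fin n → ℂ) → ℂ // ContDiff ℝ 2 θ ∧ HasCompactSupport θ ∧ tsupport θ ⊆ G} ×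
    Fin n × Fin n
  set V : ι → Fin n → (Fin n → ℂ) → ℂ := fun i l z => starRingEnd ℂ
    (((if l = i.2.1 then wderBar n i.2.2 i.1.1 z else 0) -
      (if l = i.2.2 then wderBar n i.2.1 i.1.1 z else 0)) * Real.exp ((1 / 2) * Φ z)) with hV
  have hVm : ∀ i l, MemLp (V i l) 2 := by
    rintro ⟨⟨θ, h1, h2, h3⟩, j, k⟩ l
    have c := fun j => (contDiff_wderBar (m := 1) j h1 (by norm_num)).continuous
    have s := fun j => h2.wderBar j
    have c0 : ∀ (P : Prop) [Decidable P] j, Continuous fun z => if P then wderBar n j θ z else 0 := by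
      intro P _ j; split_ifs
      · exact c j
      · exact continuous_const
    refine memLp_two_of_continuous (continuous_conj.comp
      (((c0 _ _).sub (c0 _ _)).mul hE.continuous)) ?_
    refine HasCompactSupport.intro (K := tsupport θ) h2 fun z hz => ?_
    simp [hV, wderBar_eq_zero_of_notMem _ hz]
  have hVs : ∀ (i : ι) (a : Fin n → (Fin n → ℂ) → ℂ) z, ∑ l, starRingEnd ℂ (V i l z) * a l z =
      (a i.2.1 z * wderBar n i.2.2 i.1.1 z - a i.2.2 z * wderBar n i.2.1 i.1.1 z) *
        Real.exp ((1 / 2) * Φ z) := by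
    intro i a z
    simp only [hV, Complex.conj_conj, sub_mul, ite_mul, zero_mul, Finset.sum_sub_distrib,
      Finset.sum_ite_eq', Finset.mem_univ, if_true]
    ring
  have hq : ∀ j, MemLp (fun z => starRingEnd ℂ (ψ j z) * Real.exp ((1 / 2) * Φ z)) 2 := fun j =>
    memLp_two_of_continuous ((continuous_conj.comp (hψ j).continuous).mul hE.continuous)
      (HasCompactSupport.intro (K := tsupport (ψ j)) (hψc j) fun z hz => by
        simp [image_eq_zero_of_notMem_tsupport hz])
  obtain ⟨b, hb, h1, h2, h3⟩ := exists_projection hVm hq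
  have q1 : ∀ (x : Fin n → (Fin n → ℂ) → ℂ) z, ∑ j, starRingEnd ℂ (starRingEnd ℂ (ψ j z) *
      Real.exp ((1 / 2) * Φ z)) * (x j z * Real.exp (-(1 / 2) * Φ z)) = ∑ j, ψ j z * x j z := by
    intro x z
    refine Finset.sum_congr rfl fun j _ => ?_
    simp only [map_mul, Complex.conj_conj, Complex.conj_ofReal]
    linear_combination (ψ j z * x j z) * cancel z
  refine ⟨b, hb, fun θ hθ hθc hθG j k => ?_, fun θ hθ hθc => ?_, ?_, ?_⟩
  · have := h1 (⟨θ, hθ, hθc, hθG⟩, j, k)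
    simpa only [hVs] using this
  · have cθ := fun j => contDiff_wderBar (m := 1) j hθ (by norm_num)
    have := h2 (fun j z => wderBar n j θ z * Real.exp (-(1 / 2) * Φ z))
      (fun j => memLp_two_of_continuous ((cθ j).continuous.mul hEm.continuous)
        (hθc.wderBar j).mul_right)
      (fun i => by
        rw [integral_congr_ae (ae_of_all _ (hVs i
          (fun j z => wderBar n j θ z * Real.exp (-(1 / 2) * Φ z))))]
        rw [← wderBar_conj_two_form_integral i.1.2.1 i.1.2.2.1 hθ hθc i.2.1 i.2.2]
        congr 1; ext z
        linear_combination (wderBar n i.2.1 θ z * wderBar n i.2.2 i.1.1 z -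
          wderBar n i.2.2 θ z * wderBar n i.2.1 i.1.1 z) * cancel z)
    rw [← this]
    simp only [q1]
    have i1 : ∀ j, Integrable fun z => ψ j z * wderBar n j θ z := fun j =>
      ((hψ j).continuous.mul (cθ j).continuous).integrable_of_hasCompactSupport
        (hψc j).mul_right
    have i2 : ∀ j, Integrable fun z => wderBar n j (ψ j) z * θ z := fun j =>
      ((contDiff_wderBar (m := 1) j (hψ j) (by norm_num)).continuous.mul
        hθ.continuous).integrable_of_hasCompactSupport hθc.mul_left
    simp only [Finset.sum_mul]
    rw [integral_finsetSum _ fun j _ => i1 j, integral_finsetSum _ fun j _ => i2 j,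
      ← Finset.sum_neg_distrib]
    refine Finset.sum_congr rfl fun j _ => ?_
    rw [integral_wderBar_mul ((hψ j).of_le (by norm_num)) (hθ.of_le (by norm_num))
      (Or.inl (hψc j)), neg_neg]
  · have := h2 (fun j z => α j z * Real.exp (-(1 / 2) * Φ z)) (fun j => by
      obtain ⟨C, hC⟩ := hT.exists_bound_of_continuousOn hEm.continuous.continuousOn
      refine MemLp.of_le_mul (c := C) (hα j) ((hα j).1.mul hEm.continuous.aestronglyMeasurable)
        (ae_of_all _ fun z => ?_)
      by_cases hz : z ∈ T
      · rw [norm_mul, mul_comm]; gcongr; exact hC z hz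
      · simp [hαT j z hz])
      (fun i => by
        rw [integral_congr_ae (ae_of_all _ (hVs i
          (fun j z => α j z * Real.exp (-(1 / 2) * Φ z))))]
        rw [← hαcl i.1.1 i.1.2.1 i.1.2.2.1 i.1.2.2.2 i.2.1 i.2.2]
        congr 1; ext z
        linear_combination (α i.2.1 z * wderBar n i.2.2 i.1.1 z -
          α i.2.2 z * wderBar n i.2.1 i.1.1 z) * cancel z)
    rw [← this]
    simp only [q1]
  · refine h3.trans (le_of_eq ?_)
    congr 1; ext z
    rw [Finset.sum_mul]
    refine Finset.sum_congr rfl fun j _ => ?_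
    rw [norm_mul, mul_pow, RCLike.norm_conj, Complex.norm_real, Real.norm_eq_abs, sq_abs, ← Real.exp_nat_mul]
    congr 2; push_cast; ring

end KeyInequality

section KeyInequalityLocal

variable {n : ℕ}

theorem sq_norm_integral_sum_le {a b : Fin n → (Fin n → ℂ) → ℂ} (ha : ∀ j, MemLp (a j) 2)
    (hb : ∀ j, MemLp (b j) 2) :
    ‖∫ z, ∑ j, starRingEnd ℂ (a j z) * b j z‖ ^ 2 ≤
      (∫ z, ∑ j, ‖a j z‖ ^ 2) * ∫ z, ∑ j, ‖b j z‖ ^ 2 := by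
  rw [← inner_toL2 ha hb, ← norm_toL2_sq ha, ← norm_toL2_sq hb, ← mul_pow]
  exact pow_le_pow_left₀ (norm_nonneg _) (norm_inner_le_norm _ _) 2

theorem integrable_sum_norm_sq_mul {b : Fin n → (Fin n → ℂ) → ℂ} (hb : ∀ j, MemLp (b j) 2)
    {g : (Fin n → ℂ) → ℝ} (hg : Continuous g) {C : ℝ} (hC : ∀ z, ‖g z‖ ≤ C) :
    Integrable fun z => (∑ j, ‖b j z‖ ^ 2) * g z :=
  (integrable_finsetSum _ fun j _ => (hb j).integrable_norm_pow (by norm_num)).mul_bdd (c := C)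
    hg.aestronglyMeasurable (ae_of_all _ hC)

set_option maxHeartbeats 2000000 in
theorem key_inequality_step {φ ρ : (Fin n → ℂ) → ℝ} (hφ : ContDiff ℝ 2 φ) (hρ : ContDiff ℝ 2 ρ)
    (hφL : ∀ z X : Fin n → ℂ, ∑ j, ‖X j‖ ^ 2 ≤ levi φ z X)
    {G : Set (Fin n → ℂ)} (hG : IsOpen G) {e : ℝ} (he : 0 < e)
    (hρL : ∀ z ∈ G, ∀ X : Fin n → ℂ, e * ∑ j, ‖X j‖ ^ 2 ≤ levi ρ z X)
    {η₀ η₁ : (Fin n → ℂ) → ℝ} (h0 : ContDiff ℝ 2 η₀) (h0c : HasCompactSupport η₀)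
    (h0G : tsupport η₀ ⊆ G) (h0I : ∀ z, η₀ z ∈ Icc (0 : ℝ) 1)
    (h0ρ : ∀ z ∈ G, ρ z ≤ 1 → η₀ =ᶠ[𝓝 z] fun _ => 1)
    (h1 : ContDiff ℝ 2 η₁) (h1c : HasCompactSupport η₁)
    (h1G : tsupport η₁ ⊆ G) (h1I : ∀ z, η₁ z ∈ Icc (0 : ℝ) 1)
    (h10 : ∀ z ∈ tsupport η₀, η₁ z = 1)
    {C₀ C₁ : ℝ} (hC₀ : ∀ z, ∑ k, ‖wderBar n k (fun w => (η₀ w : ℂ)) z‖ ^ 2 ≤ C₀)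
    (hC₁ : ∀ z, ∑ k, ‖wderBar n k (fun w => (η₁ w : ℂ)) z‖ ^ 2 ≤ C₁)
    {ψ : Fin n → (Fin n → ℂ) → ℂ} (hψ : ∀ j, ContDiff ℝ 2 (ψ j))
    (hψc : ∀ j, HasCompactSupport (ψ j))
    (hψρ : ∀ j, ∀ z ∈ tsupport (ψ j), ρ z ≤ 0)
    {α : Fin n → (Fin n → ℂ) → ℂ} (hα : ∀ j, MemLp (α j) 2) {T : Set (Fin n → ℂ)}
    (hT : IsCompact T) (hαT : ∀ j, ∀ z ∉ T, α j z = 0) (hαG : ∀ j, ∀ z ∉ G, α j z = 0)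
    (hαcl : ∀ θ : (Fin n → ℂ) → ℂ, ContDiff ℝ 2 θ → HasCompactSupport θ → tsupport θ ⊆ G →
      ∀ j k, ∫ z, (α j z * wderBar n k θ z - α k z * wderBar n j θ z) = 0)
    {D Q A : ℝ} (hD : D = ∫ z, ‖∑ j, wderBar n j (ψ j) z‖ ^ 2 * Real.exp (φ z))
    (hQ : Q = ∫ z, (∑ j, ‖ψ j z‖ ^ 2) * Real.exp (φ z))
    (hA : A = ∫ z, (∑ j, ‖α j z‖ ^ 2) * Real.exp (-φ z)) {N : ℝ} (hN : 0 < N) :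
    ‖∫ z, ∑ j, ψ j z * α j z‖ ^ 2 ≤
      (2 * D + (4 * (C₀ / (3 * e)) * (2 * D + 4 * C₁ * Q) + 6 * Q) / N) * A := by
  set g : ℝ → ℝ := fun x => max x 0 ^ 3 with hg
  set g' : ℝ → ℝ := fun x => 3 * max x 0 ^ 2 with hg'
  set g'' : ℝ → ℝ := fun x => 3 * (2 * max x 0 ^ 1) with hg''
  have dg : ∀ x, HasDerivAt g (g' x) x := fun x => by
    have h := hasDerivAt_max_pow 1 x
    norm_num at h
    exact h
  have dg' : ∀ x, HasDerivAt g' (g'' x) x := fun x => by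
    have h := (hasDerivAt_max_pow 0 x).const_mul 3
    norm_num at h
    simpa only [hg', hg'', pow_one] using h
  set Φ : (Fin n → ℂ) → ℝ := fun z => φ z + N * g (ρ z) with hΦ
  have cgρ : ContDiff ℝ 2 (fun z => g (ρ z)) := contDiff_max_pow.comp hρ
  have cΦ : ContDiff ℝ 2 Φ := hφ.add (contDiff_const.mul cgρ)
  have g'0 : ∀ x, 0 ≤ g' x := fun x => by simp only [hg']; positivity
  have g0 : ∀ x, 0 ≤ g x := fun x => by simp only [hg]; positivity
  have lev : ∀ z ∈ G, ∀ X : Fin n → ℂ,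
      (1 + N * (e * g' (ρ z))) * ∑ j, ‖X j‖ ^ 2 ≤ levi Φ z X := by
    intro z hz X
    rw [hΦ, levi_add hφ (contDiff_const.mul cgρ), levi_const_mul N cgρ, levi_comp
      (fun w => dg (ρ w)) hρ z X (dg' _)]
    have h2 : 0 ≤ g'' (ρ z) := by simp only [hg'']; positivity
    have h3 := mul_le_mul_of_nonneg_left (hρL z hz X) (g'0 (ρ z))
    have h4 : 0 ≤ 1 / 4 * g'' (ρ z) *
      (fderiv ℝ ρ z X ^ 2 + fderiv ℝ ρ z (Complex.I • X) ^ 2) := by positivity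
    have h5 := mul_nonneg hN.le h4
    have h6 := mul_le_mul_of_nonneg_left h3 hN.le
    have := hφL z X
    linarith
  have sum0 : ∀ X : Fin n → ℂ, 0 ≤ ∑ j, ‖X j‖ ^ 2 := fun X => by positivity
  obtain ⟨b, hb, hbcl, hbdiv, hbα, hbQ⟩ := exists_dual_form cΦ G hψ hψc hα hT hαT hαcl
  have cd : Continuous fun z => ∑ j, wderBar n j (ψ j) z :=
    continuous_finsetSum _ fun j _ => (contDiff_wderBar (m := 1) j (hψ j) (by norm_num)).continuous
  -- `Φ = φ` on the support of `ψ`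
  have Φψ : ∀ j, ∀ z ∈ tsupport (ψ j), Φ z = φ z := fun j z hz => by
    simp only [hΦ, hg, max_eq_right (hψρ j z hz)]; norm_num
  have hdz : ∀ z, (∀ j, z ∉ tsupport (ψ j)) → ∑ j, wderBar n j (ψ j) z = 0 := fun z hz =>
    Finset.sum_eq_zero fun j _ => wderBar_eq_zero_of_notMem j (hz j)
  have dΦ : ∀ z, ‖∑ j, wderBar n j (ψ j) z‖ ^ 2 * Real.exp (Φ z) =
      ‖∑ j, wderBar n j (ψ j) z‖ ^ 2 * Real.exp (φ z) := by
    intro z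
    by_cases hz : ∃ j, z ∈ tsupport (ψ j)
    · obtain ⟨j, hj⟩ := hz; rw [Φψ j z hj]
    · push Not at hz; rw [hdz z hz]; simp
  have qΦ : ∀ z, (∑ j, ‖ψ j z‖ ^ 2) * Real.exp (Φ z) = (∑ j, ‖ψ j z‖ ^ 2) * Real.exp (φ z) := by
    intro z
    by_cases hz : ∃ j, z ∈ tsupport (ψ j)
    · obtain ⟨j, hj⟩ := hz; rw [Φψ j z hj]
    · push Not at hz
      rw [Finset.sum_eq_zero fun j _ => by rw [image_eq_zero_of_notMem_tsupport (hz j)]; simp]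
      simp
  simp only [qΦ] at hbQ
  rw [← hQ] at hbQ
  set d : (Fin n → ℂ) → ℂ := fun z => ∑ j, wderBar n j (ψ j) z with hd
  have dc : HasCompactSupport d := by
    refine HasCompactSupport.intro (K := ⋃ j, tsupport (ψ j))
      (isCompact_iUnion fun j => hψc j) fun z hz => ?_
    simp only [mem_iUnion, not_exists] at hz
    exact hdz z hz
  have iD : Integrable fun z => ‖d z‖ ^ 2 * Real.exp (φ z) := by
    refine Continuous.integrable_of_hasCompactSupport
      ((cd.norm.pow 2).mul (Real.continuous_exp.comp hφ.continuous)) ?_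
    refine HasCompactSupport.intro (K := tsupport d) dc fun z hz => ?_
    simp [image_eq_zero_of_notMem_tsupport hz]
  have hDη : ∀ η : (Fin n → ℂ) → ℝ, (∀ z, η z ∈ Icc (0 : ℝ) 1) →
      ∫ z, ‖d z‖ ^ 2 * (η z ^ 2 * Real.exp (Φ z)) ≤ D := by
    intro η hη
    rw [hD]
    refine integral_mono_of_nonneg (ae_of_all _ fun z => by positivity) iD
      (ae_of_all _ fun z => ?_)
    have := pow_le_one₀ (n := 2) (hη z).1 (hη z).2
    show _ * (_ * _) ≤ _
    rw [mul_left_comm, dΦ]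
    exact mul_le_of_le_one_left (by positivity) this
  have S_bd : ∀ (η : (Fin n → ℂ) → ℝ), ContDiff ℝ 2 η →
      Continuous fun z => ∑ k, ‖wderBar n k (fun w => (η w : ℂ)) z‖ ^ 2 := fun η hη =>
    continuous_finsetSum _ fun k _ =>
      ((contDiff_wderBar (m := 1) k (contDiff_ofReal_comp hη) (by norm_num)).continuous.norm.pow 2)
  have C₁0 : 0 ≤ C₁ := (sum0 _).trans (hC₁ 0)
  have C₀0 : 0 ≤ C₀ := (sum0 _).trans (hC₀ 0)
  have bb : Integrable fun z => ∑ j, ‖b j z‖ ^ 2 :=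
    integrable_finsetSum _ fun j _ => (hb j).integrable_norm_pow (by norm_num)
  have est1 := localized_estimate cΦ hG (m := fun z => N * (e * g' (ρ z)))
    (by have := hρ.continuous; simp only [hg']; fun_prop)
    (fun z => mul_nonneg hN.le (mul_nonneg he.le (g'0 _)))
    (fun z hz X => by
      rw [hermForm_cHess cΦ]
      exact (mul_le_mul_of_nonneg_right (by linarith) (sum0 X)).trans (lev z hz X))
    hb cd hbcl (fun θ h1 h2 _ => hbdiv θ h1 h2) h1 h1c h1G
  have est0 := localized_estimate cΦ hG (m := fun _ => 1) continuous_const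
    (fun z => zero_le_one)
    (fun z hz X => by
      rw [hermForm_cHess cΦ]
      exact (mul_le_mul_of_nonneg_right (by
        have := mul_nonneg hN.le (mul_nonneg he.le (g'0 (ρ z))); linarith) (sum0 X)).trans
        (lev z hz X))
    hb cd hbcl (fun θ h1 h2 _ => hbdiv θ h1 h2) h0 h0c h0G
  have iS : ∀ {η : (Fin n → ℂ) → ℝ} {C : ℝ}, ContDiff ℝ 2 η →
      (∀ z, ∑ k, ‖wderBar n k (fun w => (η w : ℂ)) z‖ ^ 2 ≤ C) →
      Integrable fun z => (∑ j, ‖b j z‖ ^ 2) * ∑ k, ‖wderBar n k (fun w => (η w : ℂ)) z‖ ^ 2 :=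
    fun hη hC => integrable_sum_norm_sq_mul hb (S_bd _ hη) fun z => by
      rw [Real.norm_of_nonneg (sum0 _)]; exact hC z
  have r1 : ∫ z, (∑ j, ‖b j z‖ ^ 2) * (N * (e * g' (ρ z)) * η₁ z ^ 2) ≤ 2 * D + 4 * C₁ * Q := by
    have h2 : ∫ z, (∑ j, ‖b j z‖ ^ 2) * ∑ k, ‖wderBar n k (fun w => (η₁ w : ℂ)) z‖ ^ 2 ≤
        C₁ * Q := by
      refine le_trans ?_ (mul_le_mul_of_nonneg_left hbQ C₁0)
      rw [← integral_const_mul]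
      refine integral_mono (iS h1 hC₁) (bb.const_mul _) fun z => ?_
      rw [mul_comm C₁]
      exact mul_le_mul_of_nonneg_left (hC₁ z) (sum0 _)
    have := hDη η₁ h1I
    linarith
  have iM : Integrable fun z => (∑ j, ‖b j z‖ ^ 2) * (N * (e * g' (ρ z)) * η₁ z ^ 2) := by
    have hc : Continuous fun z => N * (e * g' (ρ z)) * η₁ z ^ 2 := by
      have := hρ.continuous; have := h1.continuous; simp only [hg']; fun_prop
    obtain ⟨C, hC⟩ := (HasCompactSupport.intro (K := tsupport η₁) h1c fun z hz => by
      simp [image_eq_zero_of_notMem_tsupport hz] :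
      HasCompactSupport fun z => N * (e * g' (ρ z)) * η₁ z ^ 2).exists_bound_of_continuous hc
    exact integrable_sum_norm_sq_mul hb hc hC
  have r0 : ∫ z, (∑ j, ‖b j z‖ ^ 2) * ∑ k, ‖wderBar n k (fun w => (η₀ w : ℂ)) z‖ ^ 2 ≤
      C₀ / (3 * e) * (2 * D + 4 * C₁ * Q) / N := by
    have h2 : ∫ z, (∑ j, ‖b j z‖ ^ 2) * ∑ k, ‖wderBar n k (fun w => (η₀ w : ℂ)) z‖ ^ 2 ≤
        ∫ z, (C₀ / (3 * e * N)) * ((∑ j, ‖b j z‖ ^ 2) * (N * (e * g' (ρ z)) * η₁ z ^ 2)) := by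
      refine integral_mono (iS h0 hC₀) (iM.const_mul _) fun z => ?_
      show (∑ j, ‖b j z‖ ^ 2) * _ ≤ _ * ((∑ j, ‖b j z‖ ^ 2) * _)
      rw [mul_left_comm]
      refine mul_le_mul_of_nonneg_left ?_ (sum0 _)
      by_cases hz : z ∈ tsupport η₀
      · by_cases hz1 : ρ z ≤ 1
        · have : ∀ k, wderBar n k (fun w => (η₀ w : ℂ)) z = 0 := fun k => by
            rw [wderBar_congr k (v := fun _ => 1)
              ((h0ρ z (h0G hz) hz1).mono fun w hw => by simp [hw])]
            simp [wderBar]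
          simp only [this, norm_zero]
          have := g'0 (ρ z)
          simp; positivity
        · push Not at hz1
          refine (hC₀ z).trans ?_
          have h3 : 3 ≤ g' (ρ z) := by
            simp only [hg', max_eq_left (by linarith : (0 : ℝ) ≤ ρ z)]; nlinarith
          rw [h10 z hz]
          have : C₀ / (3 * e * N) * (N * (e * g' (ρ z)) * 1 ^ 2) = C₀ * (g' (ρ z) / 3) := by
            field_simp
          rw [this]
          nlinarith
      · have : ∀ k, wderBar n k (fun w => (η₀ w : ℂ)) z = 0 := fun k =>
          wderBar_eq_zero_of_notMem k (by rwa [tsupport_ofReal])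
        simp only [this, norm_zero]
        have := g'0 (ρ z)
        simp; positivity
    refine h2.trans ?_
    rw [integral_const_mul]
    calc _ ≤ C₀ / (3 * e * N) * (2 * D + 4 * C₁ * Q) :=
          mul_le_mul_of_nonneg_left r1 (by positivity)
      _ = _ := by field_simp
  have r : ∫ z, (∑ j, ‖b j z‖ ^ 2) * η₀ z ^ 2 ≤
      2 * D + 4 * (C₀ / (3 * e) * (2 * D + 4 * C₁ * Q) / N) := by
    have := hDη η₀ h0I
    simp only [one_mul] at est0
    linarith
  -- Cauchy–Schwarz against the cut-off form
  set t : ℝ := Real.exp (-(N / 2)) with ht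
  have t0 : 0 < t := Real.exp_pos _
  have t1 : t ≤ 1 := Real.exp_le_one_iff.2 (by linarith)
  have tN : t ≤ 2 / N := by
    have h := Real.add_one_le_exp (N / 2)
    rw [ht, Real.exp_neg, ← inv_div N 2]
    exact inv_anti₀ (half_pos hN) (by linarith)
  have p0 : ∀ z, 0 < η₀ z + t := fun z => by linarith [(h0I z).1]
  have wt : ∀ z ∈ G, Real.exp (-(1 / 2) * Φ z) / (η₀ z + t) ≤ Real.exp (-(1 / 2) * φ z) := by
    intro z hz
    rw [div_le_iff₀ (p0 z)]
    by_cases hz1 : ρ z ≤ 1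
    · have h2 : η₀ z = 1 := (h0ρ z hz hz1).eq_of_nhds
      have h3 : Real.exp (-(1 / 2) * Φ z) ≤ Real.exp (-(1 / 2) * φ z) := by
        apply Real.exp_le_exp.2
        have := mul_nonneg hN.le (g0 (ρ z))
        simp only [hΦ]; linarith
      rw [h2]
      nlinarith [Real.exp_pos (-(1 / 2) * φ z)]
    · push Not at hz1
      have h3 : Real.exp (-(1 / 2) * Φ z) ≤ Real.exp (-(1 / 2) * φ z) * t := by
        rw [ht, ← Real.exp_add]
        apply Real.exp_le_exp.2
        have : 1 ≤ g (ρ z) := by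
          simp only [hg, max_eq_left (by linarith : (0 : ℝ) ≤ ρ z)]
          exact one_le_pow₀ hz1.le
        simp only [hΦ]; nlinarith
      have := mul_nonneg (Real.exp_pos (-(1 / 2) * φ z)).le (h0I z).1
      linarith
  have cη₀ : Continuous fun z => ((η₀ z + t : ℝ) : ℂ) :=
    Complex.continuous_ofReal.comp (h0.continuous.add continuous_const)
  have cw : Continuous fun z => ((Real.exp (-(1 / 2) * Φ z) / (η₀ z + t) : ℝ) : ℂ) := by
    refine Complex.continuous_ofReal.comp (Continuous.div ?_ (h0.continuous.add continuous_const)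
      fun z => (p0 z).ne')
    have := cΦ.continuous
    fun_prop
  have hb' : ∀ j, MemLp (fun z => b j z * ((η₀ z + t : ℝ) : ℂ)) 2 := fun j => by
    refine MemLp.of_le_mul (c := 2) (hb j) ((hb j).1.mul cη₀.aestronglyMeasurable)
      (ae_of_all _ fun z => ?_)
    rw [norm_mul, mul_comm, Complex.norm_real, Real.norm_of_nonneg (p0 z).le]
    gcongr
    linarith [(h0I z).2]
  have hα' : ∀ j, MemLp (fun z => α j z *
      ((Real.exp (-(1 / 2) * Φ z) / (η₀ z + t) : ℝ) : ℂ)) 2 := fun j => by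
    obtain ⟨C, hC⟩ := hT.exists_bound_of_continuousOn cw.continuousOn
    refine MemLp.of_le_mul (c := C) (hα j) ((hα j).1.mul cw.aestronglyMeasurable)
      (ae_of_all _ fun z => ?_)
    by_cases hz : z ∈ T
    · rw [norm_mul, mul_comm]; gcongr; exact hC z hz
    · simp [hαT j z hz]
  have cs := sq_norm_integral_sum_le hb' hα'
  have e1 : ∀ z, ∑ j, starRingEnd ℂ (b j z * ((η₀ z + t : ℝ) : ℂ)) * (α j z *
      ((Real.exp (-(1 / 2) * Φ z) / (η₀ z + t) : ℝ) : ℂ)) =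
      ∑ j, starRingEnd ℂ (b j z) * (α j z * Real.exp (-(1 / 2) * Φ z)) := by
    intro z
    refine Finset.sum_congr rfl fun j _ => ?_
    have : ((η₀ z + t : ℝ) : ℂ) ≠ 0 := by exact_mod_cast (p0 z).ne'
    rw [map_mul, Complex.conj_ofReal, Complex.ofReal_div]
    field_simp
  simp only [e1] at cs
  rw [← hbα] at cs
  have f1 : ∫ z, ∑ j, ‖b j z * ((η₀ z + t : ℝ) : ℂ)‖ ^ 2 ≤
      2 * D + 4 * (C₀ / (3 * e) * (2 * D + 4 * C₁ * Q) / N) + 6 * Q / N := by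
    have h2 : ∀ z, ∑ j, ‖b j z * ((η₀ z + t : ℝ) : ℂ)‖ ^ 2 ≤
        (∑ j, ‖b j z‖ ^ 2) * η₀ z ^ 2 + (3 * t) * ∑ j, ‖b j z‖ ^ 2 := by
      intro z
      simp only [norm_mul, mul_pow, Complex.norm_real, Real.norm_eq_abs, sq_abs, ← Finset.sum_mul]
      have h3 : (η₀ z + t) ^ 2 ≤ η₀ z ^ 2 + 3 * t := by
        have := (h0I z).1; have := (h0I z).2; nlinarith
      nlinarith [mul_le_mul_of_nonneg_left h3 (sum0 fun j => b j z)]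
    have i0 : Integrable fun z => (∑ j, ‖b j z‖ ^ 2) * η₀ z ^ 2 :=
      integrable_sum_norm_sq_mul hb (h0.continuous.pow 2) (C := 1) fun z => by
        rw [Real.norm_of_nonneg (sq_nonneg _)]; exact pow_le_one₀ (h0I z).1 (h0I z).2
    have h4 := integral_mono_of_nonneg (ae_of_all _ fun z => by positivity)
      (i0.add (bb.const_mul (3 * t))) (ae_of_all _ h2)
    have h5 : ∫ z, ((fun z => (∑ j, ‖b j z‖ ^ 2) * η₀ z ^ 2) +
        fun z => (3 * t) * ∑ j, ‖b j z‖ ^ 2) z = (∫ z, (∑ j, ‖b j z‖ ^ 2) * η₀ z ^ 2) +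
        (3 * t) * ∫ z, ∑ j, ‖b j z‖ ^ 2 := by
      rw [integral_add' i0 (bb.const_mul _), integral_const_mul]
    have Q0 : 0 ≤ ∫ z, ∑ j, ‖b j z‖ ^ 2 := integral_nonneg fun z => by positivity
    have h6 : (3 * t) * ∫ z, ∑ j, ‖b j z‖ ^ 2 ≤ 6 * Q / N := by
      calc _ ≤ (3 * (2 / N)) * Q := by gcongr
        _ = _ := by ring
    calc _ ≤ _ := h4
      _ = _ := h5
      _ ≤ _ := by linarith
  have f2 : ∫ z, ∑ j, ‖α j z * ((Real.exp (-(1 / 2) * Φ z) / (η₀ z + t) : ℝ) : ℂ)‖ ^ 2 ≤ A := by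
    rw [hA]
    have iA : Integrable fun z => (∑ j, ‖α j z‖ ^ 2) * Real.exp (-φ z) := by
      have hc : Continuous fun z => Real.exp (-φ z) := by have := hφ.continuous; fun_prop
      obtain ⟨C, hC⟩ := hT.exists_bound_of_continuousOn hc.continuousOn
      refine ((integrable_finsetSum Finset.univ fun j _ =>
        (hα j).integrable_norm_pow (by norm_num : (2 : ℕ) ≠ 0)).const_mul C).mono'
        ((AEStronglyMeasurable.mul (Finset.aestronglyMeasurable_fun_sum _
          fun j _ => (hα j).1.norm.pow 2)) hc.aestronglyMeasurable) (ae_of_all _ fun z => ?_)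
      by_cases hz : z ∈ T
      · rw [norm_mul, mul_comm, Real.norm_of_nonneg (sum0 fun j => α j z)]
        exact mul_le_mul_of_nonneg_right (hC z hz) (sum0 fun j => α j z)
      · simp [hαT _ z hz]
    refine integral_mono_of_nonneg (ae_of_all _ fun z => by positivity) iA
      (ae_of_all _ fun z => ?_)
    show ∑ j, _ ≤ _
    simp only [norm_mul, mul_pow, Complex.norm_real, Real.norm_eq_abs, sq_abs, ← Finset.sum_mul]
    by_cases hz : z ∈ G
    · refine mul_le_mul_of_nonneg_left ?_ (sum0 fun j => α j z)
      have h2 := pow_le_pow_left₀ (div_pos (Real.exp_pos _) (p0 z)).le (wt z hz) 2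
      rwa [← Real.exp_nat_mul, show ((2 : ℕ) : ℝ) * (-(1 / 2) * φ z) = -φ z by
        push_cast; ring] at h2
    · simp [hαG _ z hz]
  have A0 : 0 ≤ ∫ z, ∑ j, ‖α j z * ((Real.exp (-(1 / 2) * Φ z) / (η₀ z + t) : ℝ) : ℂ)‖ ^ 2 :=
    integral_nonneg fun z => by positivity
  have B0 : 0 ≤ ∫ z, ∑ j, ‖b j z * ((η₀ z + t : ℝ) : ℂ)‖ ^ 2 :=
    integral_nonneg fun z => by positivity
  have fin := cs.trans (mul_le_mul f1 f2 A0 (B0.trans f1))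
  have e2 : 2 * D + 4 * (C₀ / (3 * e) * (2 * D + 4 * C₁ * Q) / N) + 6 * Q / N =
      2 * D + (4 * (C₀ / (3 * e)) * (2 * D + 4 * C₁ * Q) + 6 * Q) / N := by ring
  rwa [e2] at fin

theorem key_inequality_local {φ ρ : (Fin n → ℂ) → ℝ} (hφ : ContDiff ℝ 2 φ) (hρ : ContDiff ℝ 2 ρ)
    (hφL : ∀ z X : Fin n → ℂ, ∑ j, ‖X j‖ ^ 2 ≤ levi φ z X)
    {G : Set (Fin n → ℂ)} (hG : IsOpen G) {e : ℝ} (he : 0 < e)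
    (hρL : ∀ z ∈ G, ∀ X : Fin n → ℂ, e * ∑ j, ‖X j‖ ^ 2 ≤ levi ρ z X)
    {K : Set (Fin n → ℂ)} (hK : IsCompact K) (hKG : K ⊆ G) (hρK : ∀ z ∈ G, ρ z ≤ 1 → z ∈ K)
    {ψ : Fin n → (Fin n → ℂ) → ℂ} (hψ : ∀ j, ContDiff ℝ 2 (ψ j))
    (hψc : ∀ j, HasCompactSupport (ψ j))
    (hψρ : ∀ j, ∀ z ∈ tsupport (ψ j), ρ z ≤ 0)
    {α : Fin n → (Fin n → ℂ) → ℂ} (hα : ∀ j, MemLp (α j) 2) {T : Set (Fin n → ℂ)}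
    (hT : IsCompact T) (hαT : ∀ j, ∀ z ∉ T, α j z = 0) (hαG : ∀ j, ∀ z ∉ G, α j z = 0)
    (hαcl : ∀ θ : (Fin n → ℂ) → ℂ, ContDiff ℝ 2 θ → HasCompactSupport θ → tsupport θ ⊆ G →
      ∀ j k, ∫ z, (α j z * wderBar n k θ z - α k z * wderBar n j θ z) = 0) :
    ‖∫ z, ∑ j, ψ j z * α j z‖ ^ 2 ≤
      (2 * ∫ z, ‖∑ j, wderBar n j (ψ j) z‖ ^ 2 * Real.exp (φ z)) *
        ∫ z, (∑ j, ‖α j z‖ ^ 2) * Real.exp (-φ z) := by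
  obtain ⟨η₀, h0, h0c, h0G, h01, h0I⟩ := exists_cutoff hK hG hKG
  obtain ⟨η₁, h1, h1c, h1G, h11, h1I⟩ := exists_cutoff h0c hG h0G
  have bd : ∀ η : (Fin n → ℂ) → ℝ, ContDiff ℝ 2 η → HasCompactSupport η →
      ∃ C, ∀ z, ∑ k, ‖wderBar n k (fun w => (η w : ℂ)) z‖ ^ 2 ≤ C := by
    intro η hη hc
    have c : Continuous fun z => ∑ k, ‖wderBar n k (fun w => (η w : ℂ)) z‖ ^ 2 :=
      continuous_finsetSum _ fun k _ => ((contDiff_wderBar (m := 1) k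
        (contDiff_ofReal_comp hη) (by norm_num)).continuous.norm.pow 2)
    obtain ⟨C, hC⟩ := (HasCompactSupport.intro (K := tsupport η) hc fun z hz => by
      simp [wderBar_eq_zero_of_notMem _ (by rwa [tsupport_ofReal] :
        z ∉ tsupport fun w => (η w : ℂ))] : HasCompactSupport
        fun z => ∑ k, ‖wderBar n k (fun w => (η w : ℂ)) z‖ ^ 2).exists_bound_of_continuous c
    exact ⟨C, fun z => (le_abs_self _).trans (hC z)⟩
  obtain ⟨C₀, hC₀⟩ := bd η₀ h0 h0c
  obtain ⟨C₁, hC₁⟩ := bd η₁ h1 h1c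
  have step := fun k : ℕ => key_inequality_step hφ hρ hφL hG he hρL h0 h0c h0G h0I
    (fun z hz hz1 => h01 z (hρK z hz hz1)) h1 h1c h1G h1I (fun z hz => (h11 z hz).eq_of_nhds)
    hC₀ hC₁ hψ hψc hψρ hα hT hαT hαG hαcl rfl rfl rfl (N := (k : ℝ) + 1) (by positivity)
  have lim : ∀ c D A : ℝ, Tendsto (fun k : ℕ => (D + c / ((k : ℝ) + 1)) * A) atTop
      (𝓝 (D * A)) := by
    intro c D A
    have h2 := (tendsto_one_div_add_atTop_nhds_zero_nat (𝕜 := ℝ)).const_mul c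
    have h3 := (h2.const_add D).mul_const A
    simpa [div_eq_mul_inv] using h3
  exact ge_of_tendsto' (lim _ _ _) step

end KeyInequalityLocal

section Existence

variable {n : ℕ}

theorem exists_representer {V H : Type*} [AddCommGroup V] [Module ℂ V] [NormedAddCommGroup H]
    [InnerProductSpace ℂ H] [CompleteSpace H] (T : V →ₗ[ℂ] H) (l : V →ₗ[ℂ] ℂ) {C : ℝ} (hC : 0 ≤ C)
    (h : ∀ x, ‖l x‖ ≤ C * ‖T x‖) : ∃ v : H, ‖v‖ ≤ C ∧ ∀ x, l x = inner ℂ v (T x) := by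
  have hk : LinearMap.ker T ≤ LinearMap.ker l := fun x hx => by
    rw [LinearMap.mem_ker] at hx ⊢
    have := h x
    rw [hx, norm_zero, mul_zero] at this
    exact norm_le_zero_iff.1 this
  let f : LinearMap.range T →ₗ[ℂ] ℂ :=
    ((LinearMap.ker T).liftQ l hk).comp T.quotKerEquivRange.symm.toLinearMap
  have hf : ∀ x, f ⟨T x, LinearMap.mem_range_self T x⟩ = l x := fun x => by
    have : T.quotKerEquivRange.symm ⟨T x, LinearMap.mem_range_self T x⟩ =
        (LinearMap.ker T).mkQ x := T.quotKerEquivRange_symm_apply_image x _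
    simp only [f, LinearMap.comp_apply, LinearEquiv.coe_coe, this]
    simp
  let F : LinearMap.range T →L[ℂ] ℂ := f.mkContinuous C (by
    rintro ⟨_, x, rfl⟩
    rw [hf]
    exact h x)
  obtain ⟨g, hg, hgn⟩ := exists_extension_norm_eq _ F
  refine ⟨(InnerProductSpace.toDual ℂ H).symm g, ?_, fun x => ?_⟩
  · rw [LinearIsometryEquiv.norm_map, hgn]
    exact f.mkContinuous_norm_le hC _
  · rw [InnerProductSpace.toDual_symm_apply, ← hf]
    exact (hg ⟨T x, LinearMap.mem_range_self T x⟩).symm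

/-- `Ω` carries, near each of its compact sets, smooth strictly plurisubharmonic functions with
relatively compact sublevel sets. -/
def SmoothExhaustible (n : ℕ) (Ω : Set (Fin n → ℂ)) : Prop :=
  ∀ K : Set (Fin n → ℂ), IsCompact K → K ⊆ Ω → ∃ (G K₁ : Set (Fin n → ℂ)) (ρ : (Fin n → ℂ) → ℝ)
    (e : ℝ), IsOpen G ∧ K ⊆ G ∧ G ⊆ Ω ∧ ContDiff ℝ 2 ρ ∧ 0 < e ∧
      (∀ z ∈ G, ∀ X : Fin n → ℂ, e * ∑ j, ‖X j‖ ^ 2 ≤ levi ρ z X) ∧ (∀ z ∈ K, ρ z ≤ 0) ∧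
      IsCompact K₁ ∧ K₁ ⊆ G ∧ ∀ z ∈ G, ρ z ≤ 1 → z ∈ K₁

theorem key_inequality {Ω : Set (Fin n → ℂ)} (hΩ : SmoothExhaustible n Ω)
    (hΩb : Bornology.IsBounded Ω) {φ : (Fin n → ℂ) → ℝ} (hφ : ContDiff ℝ 2 φ)
    (hφL : ∀ z X : Fin n → ℂ, ∑ j, ‖X j‖ ^ 2 ≤ levi φ z X)
    {ψ : Fin n → (Fin n → ℂ) → ℂ} (hψ : ∀ j, ContDiff ℝ 2 (ψ j))
    (hψc : ∀ j, HasCompactSupport (ψ j)) (hψΩ : ∀ j, tsupport (ψ j) ⊆ Ω)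
    {α : Fin n → (Fin n → ℂ) → ℂ} (hα : ∀ j, MemLp (α j) 2) (hαΩ : ∀ j, ∀ z ∉ Ω, α j z = 0)
    (hαcl : ∀ θ : (Fin n → ℂ) → ℂ, ContDiff ℝ 2 θ → HasCompactSupport θ → tsupport θ ⊆ Ω →
      ∀ j k, ∫ z, (α j z * wderBar n k θ z - α k z * wderBar n j θ z) = 0) :
    ‖∫ z, ∑ j, ψ j z * α j z‖ ^ 2 ≤
      (2 * ∫ z, ‖∑ j, wderBar n j (ψ j) z‖ ^ 2 * Real.exp (φ z)) *
        ∫ z, (∑ j, ‖α j z‖ ^ 2) * Real.exp (-φ z) := by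
  obtain ⟨G, K₁, ρ, e, hG, hKG, hGΩ, hρ, he, hρL, hρK, hK₁, hK₁G, hGK₁⟩ :=
    hΩ (⋃ j, tsupport (ψ j)) (isCompact_iUnion fun j => hψc j) (iUnion_subset hψΩ)
  have hT : IsCompact (closure Ω) := hΩb.isCompact_closure
  have key := key_inequality_local hφ hρ hφL hG he hρL hK₁ hK₁G hGK₁ hψ hψc
    (fun j z hz => hρK z (mem_iUnion.2 ⟨j, hz⟩)) (α := fun j => G.indicator (α j))
    (fun j => (hα j).indicator hG.measurableSet) hT
    (fun j z hz => indicator_of_notMem (fun h => hz (subset_closure (hGΩ h))) _)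
    (fun j z hz => indicator_of_notMem hz _)
    (fun θ h1 h2 h3 j k => by
      rw [← hαcl θ h1 h2 (h3.trans hGΩ) j k]
      refine integral_congr_ae (ae_of_all _ fun z => ?_)
      by_cases hz : z ∈ G
      · simp only [indicator_of_mem hz]
      · have : z ∉ tsupport θ := fun h => hz (h3 h)
        simp only [wderBar_eq_zero_of_notMem _ this, mul_zero])
  have e1 : ∫ z, ∑ j, ψ j z * G.indicator (α j) z = ∫ z, ∑ j, ψ j z * α j z := by
    refine integral_congr_ae (ae_of_all _ fun z => Finset.sum_congr rfl fun j _ => ?_)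
    by_cases hz : z ∈ G
    · rw [indicator_of_mem hz]
    · rw [image_eq_zero_of_notMem_tsupport fun h => hz (hKG (mem_iUnion.2 ⟨j, h⟩)), zero_mul,
        zero_mul]
  rw [e1] at key
  refine key.trans (mul_le_mul_of_nonneg_left ?_ (by positivity))
  have hc : Continuous fun z => Real.exp (-φ z) := by have := hφ.continuous; fun_prop
  have iA : Integrable fun z => (∑ j, ‖α j z‖ ^ 2) * Real.exp (-φ z) := by
    obtain ⟨C, hC⟩ := hT.exists_bound_of_continuousOn hc.continuousOn
    refine ((integrable_finsetSum Finset.univ fun j _ =>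
      (hα j).integrable_norm_pow (by norm_num : (2 : ℕ) ≠ 0)).const_mul C).mono'
      ((AEStronglyMeasurable.mul (Finset.aestronglyMeasurable_fun_sum _
        fun j _ => (hα j).1.norm.pow 2)) hc.aestronglyMeasurable) (ae_of_all _ fun z => ?_)
    by_cases hz : z ∈ closure Ω
    · rw [norm_mul, mul_comm, Real.norm_of_nonneg (by positivity : 0 ≤ ∑ j, ‖α j z‖ ^ 2)]
      exact mul_le_mul_of_nonneg_right (hC z hz) (by positivity)
    · simp [hαΩ _ z fun h => hz (subset_closure h)]
  refine integral_mono_of_nonneg (ae_of_all _ fun z => by positivity) iA (ae_of_all _ fun z => ?_)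
  by_cases hz : z ∈ G
  · simp only [indicator_of_mem hz]; exact le_rfl
  · simp only [indicator_of_notMem hz]
    simp
    positivity

/-- Test forms on `Ω`, as a complex vector space. -/
def testForms (n : ℕ) (Ω : Set (Fin n → ℂ)) : Submodule ℂ (Fin n → (Fin n → ℂ) → ℂ) where
  carrier := {ψ | ∀ j, ContDiff ℝ 2 (ψ j) ∧ HasCompactSupport (ψ j) ∧ tsupport (ψ j) ⊆ Ω}
  add_mem' := fun ha hb j => ⟨(ha j).1.add (hb j).1, (ha j).2.1.add (hb j).2.1,
    (tsupport_add _ _).trans (union_subset (ha j).2.2 (hb j).2.2)⟩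
  zero_mem' := fun j => ⟨contDiff_const, HasCompactSupport.zero, by
    simp [tsupport, Function.support]⟩
  smul_mem' := fun c ψ h j => ⟨(h j).1.const_smul c, (h j).2.1.smul_left (f := fun _ => c),
    (tsupport_smul_subset_right (fun _ => c) (ψ j)).trans (h j).2.2⟩

theorem exists_dbar_solution {Ω : Set (Fin n → ℂ)} (hΩo : IsOpen Ω) (hΩ : SmoothExhaustible n Ω)
    (hΩb : Bornology.IsBounded Ω) {φ : (Fin n → ℂ) → ℝ} (hφ : ContDiff ℝ 2 φ)
    (hφL : ∀ z X : Fin n → ℂ, ∑ j, ‖X j‖ ^ 2 ≤ levi φ z X)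
    {α : Fin n → (Fin n → ℂ) → ℂ} (hα : ∀ j, MemLp (α j) 2) (hαΩ : ∀ j, ∀ z ∉ Ω, α j z = 0)
    (hαcl : ∀ θ : (Fin n → ℂ) → ℂ, ContDiff ℝ 2 θ → HasCompactSupport θ → tsupport θ ⊆ Ω →
      ∀ j k, ∫ z, (α j z * wderBar n k θ z - α k z * wderBar n j θ z) = 0) :
    ∃ u : (Fin n → ℂ) → ℂ, MemLp u 2 ∧
      (∀ θ : (Fin n → ℂ) → ℂ, ContDiff ℝ 2 θ → HasCompactSupport θ → tsupport θ ⊆ Ω →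
        ∀ j, ∫ z, u z * wderBar n j θ z = -∫ z, α j z * θ z) ∧
      Integrable (fun z => ‖u z‖ ^ 2 * Real.exp (-φ z)) ∧
      ∫ z, ‖u z‖ ^ 2 * Real.exp (-φ z) ≤ 2 * ∫ z, (∑ j, ‖α j z‖ ^ 2) * Real.exp (-φ z) := by
  set A := ∫ z, (∑ j, ‖α j z‖ ^ 2) * Real.exp (-φ z) with hA
  have A0 : 0 ≤ A := integral_nonneg fun z => by positivity
  have hcw : Continuous fun z => ((Real.exp (1 / 2 * φ z) : ℝ) : ℂ) := by
    have := hφ.continuous; fun_prop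
  have memT : ∀ ψ : testForms n Ω, MemLp (fun z => ((Real.exp (1 / 2 * φ z) : ℝ) : ℂ) *
      ∑ j, wderBar n j (ψ.1 j) z) 2 := fun ψ => by
    refine memLp_two_of_continuous (hcw.mul (continuous_finsetSum _ fun j _ =>
      (contDiff_wderBar (m := 1) j (ψ.2 j).1 (by norm_num)).continuous)) ?_
    refine HasCompactSupport.intro (K := ⋃ j, tsupport (ψ.1 j))
      (isCompact_iUnion fun j => (ψ.2 j).2.1) fun z hz => ?_
    simp only [mem_iUnion, not_exists] at hz
    rw [Finset.sum_eq_zero fun j _ => wderBar_eq_zero_of_notMem j (hz j), mul_zero]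
  have dψ : ∀ (ψ : testForms n Ω) j z, DifferentiableAt ℝ (ψ.1 j) z := fun ψ j z =>
    ((ψ.2 j).1.differentiable (by norm_num)).differentiableAt
  have iψ : ∀ (ψ : testForms n Ω), Integrable fun z => ∑ j, ψ.1 j z * α j z := fun ψ =>
    integrable_finsetSum _ fun j _ => by
      simpa [mul_comm] using integrable_mul_continuous_compact
        ((hα j).locallyIntegrable (by norm_num)) (ψ.2 j).1.continuous (ψ.2 j).2.1
  let T : testForms n Ω →ₗ[ℂ] Lp ℂ 2 (volume : Measure (Fin n → ℂ)) :=
    { toFun := fun ψ => (memT ψ).toLp _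
      map_add' := fun ψ χ => by
        rw [← MemLp.toLp_add]
        refine MemLp.toLp_congr _ _ (ae_of_all _ fun z => ?_)
        simp only [Pi.add_apply, ← mul_add, ← Finset.sum_add_distrib]
        congr 1
        exact Finset.sum_congr rfl fun j _ => wderBar_add j (dψ ψ j z) (dψ χ j z)
      map_smul' := fun c ψ => by
        rw [RingHom.id_apply, ← MemLp.toLp_const_smul]
        refine MemLp.toLp_congr _ _ (ae_of_all _ fun z => ?_)
        simp only [Pi.smul_apply, smul_eq_mul]
        rw [mul_left_comm c]
        congr 1
        rw [Finset.mul_sum]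
        exact Finset.sum_congr rfl fun j _ => wderBar_const_mul j c (dψ ψ j z) }
  let l : testForms n Ω →ₗ[ℂ] ℂ :=
    { toFun := fun ψ => ∫ z, ∑ j, ψ.1 j z * α j z
      map_add' := fun ψ χ => by
        rw [← integral_add (iψ ψ) (iψ χ)]
        refine integral_congr_ae (ae_of_all _ fun z => ?_)
        simp only [← Finset.sum_add_distrib]
        exact Finset.sum_congr rfl fun j _ => add_mul _ _ _
      map_smul' := fun c ψ => by
        rw [RingHom.id_apply, smul_eq_mul, ← integral_const_mul]
        refine integral_congr_ae (ae_of_all _ fun z => ?_)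
        simp only [Finset.mul_sum]
        exact Finset.sum_congr rfl fun j _ => mul_assoc _ _ _ }
  have normT : ∀ ψ : testForms n Ω, ‖T ψ‖ ^ 2 =
      ∫ z, ‖∑ j, wderBar n j (ψ.1 j) z‖ ^ 2 * Real.exp (φ z) := fun ψ => by
    rw [show ‖T ψ‖ = _ from Lp.norm_toLp _ (memT ψ), ← integral_norm_sq_eq_toReal (memT ψ)]
    refine integral_congr_ae (ae_of_all _ fun z => ?_)
    simp only [norm_mul, mul_pow, Complex.norm_real, Real.norm_eq_abs, sq_abs]
    rw [← Real.exp_nat_mul, mul_comm]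
    congr 2
    push_cast; ring
  obtain ⟨v, hv, hvl⟩ := exists_representer T l (Real.sqrt_nonneg (2 * A)) fun ψ => by
    have h := key_inequality hΩ hΩb hφ hφL (fun j => (ψ.2 j).1) (fun j => (ψ.2 j).2.1)
      (fun j => (ψ.2 j).2.2) hα hαΩ hαcl
    rw [← normT] at h
    refine abs_le_of_sq_le_sq' ?_ (by positivity) |>.2
    rw [mul_pow, Real.sq_sqrt (by positivity)]
    calc _ ≤ _ := h
      _ = _ := by ring
  set u : (Fin n → ℂ) → ℂ := Ω.indicator fun z =>
    -(starRingEnd ℂ (v z) * ((Real.exp (1 / 2 * φ z) : ℝ) : ℂ)) with hu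
  have mv : MemLp v 2 := Lp.memLp v
  have um : AEStronglyMeasurable u volume :=
    ((mv.star.1.mul hcw.aestronglyMeasurable).neg).indicator hΩo.measurableSet
  have hle : ∀ z, ‖u z‖ ^ 2 * Real.exp (-φ z) ≤ ‖v z‖ ^ 2 := by
    intro z
    by_cases hz : z ∈ Ω
    · rw [hu, indicator_of_mem hz, norm_neg, norm_mul, mul_pow, RCLike.norm_conj, Complex.norm_real,
        Real.norm_eq_abs, sq_abs, ← Real.exp_nat_mul, mul_assoc, ← Real.exp_add]
      have : ((2 : ℕ) : ℝ) * (1 / 2 * φ z) + -φ z = 0 := by push_cast; ring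
      rw [this, Real.exp_zero, mul_one]
    · rw [hu, indicator_of_notMem hz]; simp
  have hce : Continuous fun z => Real.exp (-φ z) := by have := hφ.continuous; fun_prop
  have iu : Integrable (fun z => ‖u z‖ ^ 2 * Real.exp (-φ z)) :=
    (mv.integrable_norm_pow (by norm_num)).mono'
      ((um.norm.pow 2).mul hce.aestronglyMeasurable)
      (ae_of_all _ fun z => by
        rw [Real.norm_of_nonneg (by positivity)]
        exact hle z)
  refine ⟨u, ?_, fun θ h1 h2 h3 j => ?_, iu, ?_⟩
  · obtain ⟨C, hC⟩ := hΩb.isCompact_closure.exists_bound_of_continuousOn hcw.continuousOn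
    refine MemLp.of_le_mul (c := |C|) mv um (ae_of_all _ fun z => ?_)
    by_cases hz : z ∈ Ω
    · rw [hu, indicator_of_mem hz, norm_neg, norm_mul, RCLike.norm_conj, mul_comm]
      gcongr
      exact (hC z (subset_closure hz)).trans (le_abs_self C)
    · rw [hu, indicator_of_notMem hz, norm_zero]
      positivity
  · let ψ : testForms n Ω := ⟨Pi.single j θ, fun k => by
      by_cases hk : k = j
      · subst hk; rw [Pi.single_eq_same]; exact ⟨h1, h2, h3⟩
      · rw [Pi.single_eq_of_ne hk]
        exact (testForms n Ω).zero_mem k⟩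
    have h := hvl ψ
    have e1 : l ψ = ∫ z, α j z * θ z := by
      refine integral_congr_ae (ae_of_all _ fun z => ?_)
      show ∑ k, Pi.single (M := fun _ => (Fin n → ℂ) → ℂ) j θ k z * α k z = _
      rw [Finset.sum_eq_single j, Pi.single_eq_same, mul_comm]
      · intro k _ hk; rw [Pi.single_eq_of_ne hk]; simp
      · simp
    rw [← e1, h, L2.inner_def, ← integral_neg]
    refine integral_congr_ae ?_
    filter_upwards [(memT ψ).coeFn_toLp] with z hz
    have e2 : (T ψ) z = ((Real.exp (1 / 2 * φ z) : ℝ) : ℂ) * wderBar n j θ z := by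
      refine hz.trans ?_
      congr 1
      show ∑ k, wderBar n k (Pi.single (M := fun _ => (Fin n → ℂ) → ℂ) j θ k) z = _
      rw [Finset.sum_eq_single j, Pi.single_eq_same]
      · intro k _ hk; rw [Pi.single_eq_of_ne hk]; simp [wderBar, Pi.zero_def]
      · simp
    rw [e2, RCLike.inner_apply]
    by_cases hz : z ∈ Ω
    · rw [hu, indicator_of_mem hz]; ring
    · rw [wderBar_eq_zero_of_notMem j fun h => hz (h3 h)]; simp
  · calc _ ≤ ∫ z, ‖v z‖ ^ 2 := integral_mono iu (mv.integrable_norm_pow (by norm_num)) hle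
      _ = ‖v‖ ^ 2 := by rw [integral_norm_sq_eq_toReal mv, Lp.norm_def]
      _ ≤ √(2 * A) ^ 2 := pow_le_pow_left₀ (norm_nonneg _) hv 2
      _ = _ := Real.sq_sqrt (by positivity)

end Existence

section MeanValue

variable {n : ℕ}

theorem le_taylor_two {V : (Fin n → ℂ) → ℝ} (hV : ContDiff ℝ 2 V) (z h : Fin n → ℂ) {M : ℝ}
    (hM : ∀ t ∈ Icc (0 : ℝ) 1, fderiv ℝ (fderiv ℝ V) (z + t • h) h h ≤ M) :
    V (z + h) ≤ V z + fderiv ℝ V z h + M / 2 := by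
  have hl : ∀ t : ℝ, HasDerivAt (fun t : ℝ => z + t • h) h t := fun t => by
    simpa using ((hasDerivAt_id t).smul_const h).const_add z
  have d1 : ∀ t : ℝ, HasDerivAt (fun t : ℝ => V (z + t • h)) (fderiv ℝ V (z + t • h) h) t :=
    fun t => ((hV.differentiable (by norm_num)).differentiableAt.hasFDerivAt).comp_hasDerivAt t
      (hl t)
  have dV : Differentiable ℝ (fderiv ℝ V) :=
    (hV.fderiv_right (m := 1) (by norm_num)).differentiable (by norm_num)
  have d2 : ∀ t : ℝ, HasDerivAt (fun t : ℝ => fderiv ℝ V (z + t • h) h)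
      (fderiv ℝ (fderiv ℝ V) (z + t • h) h h) t := fun t => by
    have h3 : HasDerivAt (fun t : ℝ => fderiv ℝ V (z + t • h))
      (fderiv ℝ (fderiv ℝ V) (z + t • h) h) t :=
      dV.differentiableAt.hasFDerivAt.comp_hasDerivAt t (hl t)
    simpa using h3.clm_apply (hasDerivAt_const t h)
  have b1 : ∀ t ∈ Icc (0 : ℝ) 1, fderiv ℝ V (z + t • h) h - fderiv ℝ V z h ≤ M * t := by
    intro t ht
    have := (convex_Icc (0 : ℝ) 1).image_sub_le_mul_sub_of_deriv_le
      (f := fun t : ℝ => fderiv ℝ V (z + t • h) h)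
      (fun t _ => (d2 t).continuousAt.continuousWithinAt)
      (fun t _ => (d2 t).differentiableAt.differentiableWithinAt) (C := M)
      (fun t ht => by
        rw [(d2 t).deriv]
        exact hM t (interior_subset ht)) 0 (by simp) t ht ht.1
    simpa using this
  have d3 : ∀ t : ℝ, HasDerivAt (fun t : ℝ => V (z + t • h) - (fderiv ℝ V z h * t + M / 2 * t ^ 2))
      (fderiv ℝ V (z + t • h) h - (fderiv ℝ V z h + M * t)) t := fun t => by
    have := (d1 t).sub (((hasDerivAt_id t).const_mul (fderiv ℝ V z h)).add
      (((hasDerivAt_id t).pow 2).const_mul (M / 2)))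
    refine this.congr_deriv ?_
    simp
    ring
  have anti := antitoneOn_of_deriv_nonpos (convex_Icc (0 : ℝ) 1)
    (f := fun t : ℝ => V (z + t • h) - (fderiv ℝ V z h * t + M / 2 * t ^ 2))
    (fun t _ => (d3 t).continuousAt.continuousWithinAt)
    (fun t _ => (d3 t).differentiableAt.differentiableWithinAt)
    (fun t ht => by
      rw [(d3 t).deriv]
      linarith [b1 t (interior_subset ht)])
  have := anti (by simp : (0 : ℝ) ∈ Icc (0 : ℝ) 1) (by simp : (1 : ℝ) ∈ Icc (0 : ℝ) 1) zero_le_one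
  simp at this
  linarith

theorem levi_nonneg_of_mean_value {V : (Fin n → ℂ) → ℝ} (hV : ContDiff ℝ 2 V) (z w : Fin n → ℂ)
    {r₀ : ℝ} (hr₀ : 0 < r₀)
    (h : ∀ r, 0 < r → r ≤ r₀ → V z ≤ (1 / (2 * Real.pi)) *
      ∫ θ in (0 : ℝ)..2 * Real.pi, V (z + ((r : ℂ) * Complex.exp (θ * Complex.I)) • w)) :
    0 ≤ levi V z w := by
  by_contra! hneg
  set c := -levi V z w with hc
  have c0 : 0 < c := by linarith
  set B := fderiv ℝ (fderiv ℝ V) with hB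
  have cB : Continuous B := (hV.fderiv_right (m := 1) (by norm_num)).continuous_fderiv (by norm_num)
  set ε := c / (‖w‖ ^ 2 + 1) with hε
  have ε0 : 0 < ε := by positivity
  obtain ⟨s, s0, hs⟩ := (Metric.continuous_iff (f := B)).1 cB z ε ε0
  set r := min r₀ (s / (2 * (‖w‖ + 1))) with hr
  have r0 : 0 < r := by positivity
  have rs : r * ‖w‖ < s := by
    have h1 : r ≤ s / (2 * (‖w‖ + 1)) := min_le_right _ _
    rw [le_div_iff₀ (by positivity)] at h1
    nlinarith [norm_nonneg w]
  have key := h r r0 (min_le_left _ _)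
  have hh : ∀ θ : ℝ, ((r : ℂ) * Complex.exp (θ * Complex.I)) • w =
      (r * Real.cos θ) • w + (r * Real.sin θ) • (Complex.I • w) := fun θ => by
    ext j
    simp only [Pi.smul_apply, Pi.add_apply, smul_eq_mul, Complex.real_smul]
    rw [Complex.exp_mul_I]
    push_cast
    ring
  have pt : ∀ θ : ℝ, V (z + ((r : ℂ) * Complex.exp (θ * Complex.I)) • w) ≤
      (V z + ε * (r * ‖w‖) ^ 2 / 2) + r * fderiv ℝ V z w * Real.cos θ +
        r * fderiv ℝ V z (Complex.I • w) * Real.sin θ + r ^ 2 / 2 * B z w w * Real.cos θ ^ 2 +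
        r ^ 2 / 2 * (B z w (Complex.I • w) + B z (Complex.I • w) w) * (Real.sin θ * Real.cos θ) +
        r ^ 2 / 2 * B z (Complex.I • w) (Complex.I • w) * Real.sin θ ^ 2 := by
    intro θ
    have nh : ‖((r : ℂ) * Complex.exp (θ * Complex.I)) • w‖ = r * ‖w‖ := by
      rw [norm_smul, norm_mul, Complex.norm_exp_ofReal_mul_I, Complex.norm_real,
        Real.norm_of_nonneg r0.le, mul_one]
    have := le_taylor_two hV z (((r : ℂ) * Complex.exp (θ * Complex.I)) • w)
      (M := B z (((r : ℂ) * Complex.exp (θ * Complex.I)) • w)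
        (((r : ℂ) * Complex.exp (θ * Complex.I)) • w) + ε * (r * ‖w‖) ^ 2) (fun t ht => by
      set x := z + t • ((r : ℂ) * Complex.exp (θ * Complex.I)) • w with hx
      have h1 : dist x z < s := by
        rw [hx, dist_self_add_left, norm_smul, nh, Real.norm_of_nonneg ht.1]
        have := mul_le_mul_of_nonneg_right ht.2 (by positivity : 0 ≤ r * ‖w‖)
        linarith
      have h2 : ‖B x - B z‖ ≤ ε := (dist_eq_norm (B x) (B z)).symm.trans_le (hs _ h1).le
      rw [← nh]
      set q := ((r : ℂ) * Complex.exp (θ * Complex.I)) • w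
      have h3 : ‖(B x - B z) q q‖ ≤ ε * ‖q‖ ^ 2 := by
        refine ((B x - B z).le_opNorm₂ q q).trans ?_
        rw [mul_assoc, ← sq]
        gcongr
      have h4 : (B x - B z) q q = B x q q - B z q q := rfl
      have h5 := (le_abs_self _).trans h3
      rw [h4] at h5
      linarith)
    refine this.trans (le_of_eq ?_)
    rw [hh]
    simp only [map_add, map_smul, add_apply, smul_apply, smul_eq_mul]
    ring
  have hint : ∫ θ in (0 : ℝ)..2 * Real.pi, V (z + ((r : ℂ) * Complex.exp (θ * Complex.I)) • w) ≤
      2 * Real.pi * (V z + ε * (r * ‖w‖) ^ 2 / 2 + r ^ 2 * levi V z w) := by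
    refine (intervalIntegral.integral_mono_on (by positivity) ?_ ?_ fun θ _ => pt θ).trans
      (le_of_eq ?_)
    · have := hV.continuous
      exact Continuous.intervalIntegrable (by fun_prop) _ _
    · exact Continuous.intervalIntegrable (by fun_prop) _ _
    · have ic : ∀ f : ℝ → ℝ, Continuous f → IntervalIntegrable f volume 0 (2 * Real.pi) :=
        fun f hf => hf.intervalIntegrable _ _
      rw [intervalIntegral.integral_add (ic _ (by fun_prop)) (ic _ (by fun_prop)),
        intervalIntegral.integral_add (ic _ (by fun_prop)) (ic _ (by fun_prop)),
        intervalIntegral.integral_add (ic _ (by fun_prop)) (ic _ (by fun_prop)),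
        intervalIntegral.integral_add (ic _ (by fun_prop)) (ic _ (by fun_prop)),
        intervalIntegral.integral_add (ic _ (by fun_prop)) (ic _ (by fun_prop))]
      simp only [intervalIntegral.integral_const_mul, intervalIntegral.integral_const,
        integral_cos, integral_sin, integral_cos_sq, integral_sin_sq, integral_sin_mul_cos₁,
        levi, smul_eq_mul, Real.sin_two_pi, Real.cos_two_pi, Real.sin_zero, Real.cos_zero]
      ring
  have π0 := Real.pi_pos
  have k2 : V z ≤ V z + ε * (r * ‖w‖) ^ 2 / 2 + r ^ 2 * levi V z w := by
    refine key.trans ((mul_le_mul_of_nonneg_left hint (by positivity)).trans (le_of_eq ?_))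
    field_simp
  have k3 : ε * ‖w‖ ^ 2 ≤ c := by
    rw [hε, div_mul_eq_mul_div, div_le_iff₀ (by positivity)]
    nlinarith
  have k4 : 0 < r ^ 2 := by positivity
  have k5 : levi V z w = -c := by rw [hc]; ring
  rw [k5] at k2
  nlinarith

end MeanValue

section Exhaustion

variable {n : ℕ}

/-- Mollification preserves the sub-mean value property. -/
theorem mol_le_circle_mean {δ : ℝ} (hδ : 0 < δ) {v : (Fin n → ℂ) → ℝ} (hvm : Measurable v)
    {C : ℝ} (hvC : ∀ z, ‖v z‖ ≤ C) {z w : Fin n → ℂ} {r : ℝ}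
    (h : ∀ t, ‖t‖ < δ → v (z - t) ≤ (1 / (2 * Real.pi)) *
      ∫ θ in (0 : ℝ)..2 * Real.pi, v (z - t + ((r : ℂ) * Complex.exp (θ * Complex.I)) • w)) :
    mol n δ v z ≤ (1 / (2 * Real.pi)) *
      ∫ θ in (0 : ℝ)..2 * Real.pi, mol n δ v (z + ((r : ℂ) * Complex.exp (θ * Complex.I)) • w) := by
  have hloc : LocallyIntegrable v := by
    refine (locallyIntegrable_const C).mono hvm.aestronglyMeasurable (ae_of_all _ fun z => ?_)
    exact (hvC z).trans (le_abs_self C)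
  have hπ : (0 : ℝ) ≤ 2 * Real.pi := by positivity
  set γ : ℝ → Fin n → ℂ := fun θ => ((r : ℂ) * Complex.exp (θ * Complex.I)) • w with hγ
  have cγ : Continuous γ := by fun_prop
  have : IsFiniteMeasure ((volume : Measure ℝ).restrict (Set.uIoc 0 (2 * Real.pi))) := by
    rw [Set.uIoc]; infer_instance
  have hprod : Integrable (fun p : ℝ × (Fin n → ℂ) => mollifier n δ p.2 * v (z + γ p.1 - p.2))
      ((volume.restrict (Set.uIoc 0 (2 * Real.pi))).prod volume) := by
    have i1 : Integrable (fun p : ℝ × (Fin n → ℂ) => C * mollifier n δ p.2)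
        ((volume.restrict (Set.uIoc 0 (2 * Real.pi))).prod volume) :=
      ((integrable_mollifier hδ).comp_snd _).const_mul C
    refine i1.mono' ?_ (ae_of_all _ fun p => ?_)
    · refine Measurable.aestronglyMeasurable (Measurable.mul ?_ (hvm.comp ?_))
      · exact ((continuous_mollifier δ).comp continuous_snd).measurable
      · exact ((continuous_const.add (cγ.comp continuous_fst)).sub continuous_snd).measurable
    · rw [norm_mul, mul_comm, Real.norm_of_nonneg (mollifier_nonneg hδ _)]
      exact mul_le_mul_of_nonneg_right (hvC _) (mollifier_nonneg hδ _)
  have swap : ∫ θ in (0 : ℝ)..2 * Real.pi, mol n δ v (z + γ θ) =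
      ∫ t, mollifier n δ t * ∫ θ in (0 : ℝ)..2 * Real.pi, v (z - t + γ θ) := by
    simp only [mol_apply_swap, smul_eq_mul]
    rw [intervalIntegral_integral_swap hprod]
    refine integral_congr_ae (ae_of_all _ fun t => ?_)
    show ∫ θ in (0 : ℝ)..2 * Real.pi, mollifier n δ t * v (z + γ θ - t) = _
    rw [intervalIntegral.integral_const_mul]
    congr 2
    funext θ
    congr 1
    abel
  rw [swap, mol_apply_swap, ← integral_const_mul]
  refine integral_mono (integrable_mollifier_smul_swap hδ hloc z) ?_ fun t => ?_
  · refine Integrable.const_mul ?_ _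
    have := hprod.integral_prod_right
    refine this.congr (ae_of_all _ fun t => ?_)
    show ∫ θ in Set.uIoc 0 (2 * Real.pi), mollifier n δ t * v (z + γ θ - t) = _
    rw [integral_const_mul, Set.uIoc_of_le hπ]
    show _ = mollifier n δ t * ∫ θ in (0 : ℝ)..2 * Real.pi, v (z - t + γ θ)
    rw [intervalIntegral.integral_of_le hπ]
    congr 2
    funext θ
    congr 1
    abel
  · show mollifier n δ t • v (z - t) ≤ _
    rw [smul_eq_mul, mul_left_comm]
    by_cases ht : ‖t‖ < δ
    · exact mul_le_mul_of_nonneg_left (h t ht) (mollifier_nonneg hδ t)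
    · rw [mollifier_eq_zero hδ (not_lt.1 ht), zero_mul, zero_mul]

theorem PseudoconvexExh.smoothExhaustible {Ω : Set (Fin n → ℂ)} (hΩo : IsOpen Ω)
    (hΩb : Bornology.IsBounded Ω) (hΩ : PseudoconvexExh n Ω) : SmoothExhaustible n Ω := by
  obtain ⟨v, hv, ⟨-, hpsh⟩, hex⟩ := hΩ
  intro K hK hKΩ
  obtain ⟨c, hc⟩ := hK.exists_bound_of_continuousOn (hv.mono hKΩ)
  replace hc : ∀ z ∈ K, v z ≤ c := fun z hz => (le_abs_self _).trans (hc z hz)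
  obtain ⟨K', hK', hK'Ω, hsub⟩ := hex (c + 5)
  obtain ⟨δ₀, hδ₀, hthick⟩ := hK'.exists_cthickening_subset_open hΩo hK'Ω
  set L := Metric.cthickening δ₀ K' with hL
  have hLc : IsCompact L := hK'.cthickening
  have hmem : ∀ z ∈ K', ∀ t : Fin n → ℂ, ‖t‖ ≤ δ₀ → z + t ∈ L := fun z hz t ht =>
    Metric.mem_cthickening_of_dist_le _ z _ _ hz (by simpa [dist_eq_norm] using ht)
  have hvL : ContinuousOn v L := hv.mono hthick
  obtain ⟨C, hC⟩ := hLc.exists_bound_of_continuousOn hvL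
  have hvu := hLc.uniformContinuousOn_of_continuous hvL
  obtain ⟨δ₁, hδ₁, hunif⟩ := Metric.uniformContinuousOn_iff.1 hvu (1 / 4) (by norm_num)
  set v₁ := L.indicator v with hv₁
  have v₁m : Measurable v₁ := by
    classical
    have := ContinuousOn.measurable_piecewise (s := L) (f := v) (g := 0) hvL
      continuousOn_const hLc.measurableSet
    rwa [Set.piecewise_eq_indicator] at this
  have v₁C : ∀ z, ‖v₁ z‖ ≤ |C| := fun z => by
    by_cases hz : z ∈ L
    · rw [hv₁, indicator_of_mem hz]; exact (hC z hz).trans (le_abs_self C)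
    · rw [hv₁, indicator_of_notMem hz, norm_zero]; exact abs_nonneg C
  have hloc : LocallyIntegrable v₁ :=
    (locallyIntegrable_const |C|).mono v₁m.aestronglyMeasurable (ae_of_all _ fun z => by
      rw [Real.norm_of_nonneg (abs_nonneg C)]; exact v₁C z)
  set δ := min (δ₀ / 2) δ₁ with hδ
  have δ0 : 0 < δ := by positivity
  have δle : δ ≤ δ₀ / 2 := min_le_left _ _
  set V := mol n δ v₁ with hV
  have cV : ContDiff ℝ 2 V := contDiff_mol (k := 2) δ0 hloc
  have approx : ∀ z ∈ K', |V z - v z| ≤ 1 / 4 := by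
    intro z hz
    have zL : z ∈ L := Metric.self_subset_cthickening _ hz
    have e1 : V z - v z = ∫ t, mollifier n δ t * (v₁ (z - t) - v z) := by
      have e2 : v z = ∫ t, mollifier n δ t * v z := by
        rw [integral_mul_const, integral_mollifier δ0, one_mul]
      simp only [mul_sub]
      have i1 : Integrable fun t => mollifier n δ t * v₁ (z - t) :=
        integrable_mollifier_smul_swap δ0 hloc z
      rw [integral_sub i1
        ((integrable_mollifier δ0).mul_const _), ← e2, hV, mol_apply_swap]
      rfl
    rw [e1, ← Real.norm_eq_abs]
    refine (norm_integral_le_of_norm_le ((integrable_mollifier δ0).mul_const (1 / 4))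
      (ae_of_all _ fun t => ?_)).trans ?_
    · by_cases ht : ‖t‖ < δ
      · rw [norm_mul, Real.norm_of_nonneg (mollifier_nonneg δ0 t)]
        have ztL : z - t ∈ L := by
          rw [sub_eq_add_neg]; exact hmem z hz _ (by rw [norm_neg]; linarith)
        refine mul_le_mul_of_nonneg_left ?_ (mollifier_nonneg δ0 t)
        rw [hv₁, indicator_of_mem ztL]
        refine (hunif _ ztL _ zL ?_).le
        simp only [dist_eq_norm, sub_sub_cancel_left, norm_neg]
        exact ht.trans_le (min_le_right _ _)
      · rw [mollifier_eq_zero δ0 (not_lt.1 ht)]; simp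
    · rw [integral_mul_const, integral_mollifier δ0, one_mul]
  have levV : ∀ z ∈ K', ∀ X : Fin n → ℂ, 0 ≤ levi V z X := by
    intro z hz X
    refine levi_nonneg_of_mean_value cV z X (r₀ := δ₀ / 2 / (‖X‖ + 1)) (by positivity)
      fun r r0 hr => mol_le_circle_mean δ0 v₁m v₁C fun t ht => ?_
    rw [le_div_iff₀ (by positivity)] at hr
    have small : ∀ s : ℂ, ‖s‖ ≤ r → z - t + s • X ∈ L := by
      intro s hs
      rw [sub_eq_add_neg, add_assoc]
      refine hmem z hz _ ((norm_add_le _ _).trans ?_)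
      rw [norm_neg, norm_smul]
      have := mul_le_mul_of_nonneg_right hs (norm_nonneg X)
      nlinarith
    have h0 : z - t ∈ L := by simpa using small 0 (by simpa using r0.le)
    have hm := hpsh (z - t) (hthick h0) X r r0 fun s hs => hthick (small s hs)
    rw [hv₁, indicator_of_mem h0]
    refine hm.trans (le_of_eq ?_)
    congr 2
    funext θ
    rw [indicator_of_mem (small _ _)]
    rw [norm_mul, Complex.norm_exp_ofReal_mul_I, Complex.norm_real, Real.norm_of_nonneg r0.le,
      mul_one]
  obtain ⟨M, hM⟩ := hΩb.isCompact_closure.exists_bound_of_continuousOn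
    (contDiff_sqDist (n := n) 0 (k := 2)).continuous.continuousOn
  set τ := 1 / (4 * (|M| + 1)) with hτ
  have τ0 : 0 < τ := by positivity
  have hτM : ∀ z ∈ Ω, τ * sqDist 0 z ≤ 1 / 4 := fun z hz => by
    have h1 := ((le_abs_self _).trans (hM z (subset_closure hz))).trans (le_abs_self M)
    rw [hτ, div_mul_eq_mul_div, div_le_div_iff₀ (by positivity) (by norm_num)]
    linarith
  have hsq : ∀ z : Fin n → ℂ, 0 ≤ sqDist 0 z := fun z => by unfold sqDist; positivity
  have hK'mem : ∀ z ∈ Ω, v z ≤ c + 5 → z ∈ K' := fun z hz h => hsub ⟨hz, h⟩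
  have csq : ContDiff ℝ 2 (fun z : Fin n → ℂ => τ * sqDist 0 z) :=
    contDiff_const.mul (contDiff_sqDist 0)
  refine ⟨Ω ∩ v ⁻¹' Iio (c + 4), K' ∩ v ⁻¹' Iic (c + 2),
    fun z => V z + τ * sqDist 0 z + (-(c + 1 / 2)), τ,
    hv.isOpen_inter_preimage hΩo isOpen_Iio, fun z hz => ⟨hKΩ hz, ?_⟩, inter_subset_left,
    (cV.add csq).add contDiff_const, τ0, fun z hz X => ?_, fun z hz => ?_, ?_, fun z hz => ?_,
    fun z hz h => ?_⟩
  · have := hc z hz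
    show v z < c + 4
    linarith
  · have hz' : v z < c + 4 := hz.2
    rw [levi_add (cV.add csq) contDiff_const, levi_add cV csq,
      levi_const_mul τ (contDiff_sqDist 0), levi_sqDist, levi_const]
    linarith [levV z (hK'mem z hz.1 (by linarith)) X]
  · have h1 := abs_le.1 (approx z (hK'mem z (hKΩ hz) (by linarith [hc z hz])))
    linarith [hτM z (hKΩ hz), hc z hz]
  · exact hK'.of_isClosed_subset ((hv.mono hK'Ω).preimage_isClosed_of_isClosed hK'.isClosed
      isClosed_Iic) inter_subset_left
  · refine ⟨hK'Ω hz.1, ?_⟩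
    have : v z ≤ c + 2 := hz.2
    show v z < c + 4
    linarith
  · have hz' : v z < c + 4 := hz.2
    have hK'z := hK'mem z hz.1 (by linarith)
    refine ⟨hK'z, ?_⟩
    have h1 := abs_le.1 (approx z hK'z)
    show v z ≤ c + 2
    linarith [hsq z, mul_nonneg τ0.le (hsq z)]

end Exhaustion

section Holomorphic

variable {n : ℕ}

theorem measurePreserving_circle_smul (c : Circle) :
    MeasurePreserving (fun t : Fin n → ℂ => (c : ℂ) • t) volume volume :=
  volume_preserving_pi fun _ => (rotation c).measurePreserving

/-- The mean value property for averages against a circle-invariant density. -/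
theorem integral_mul_holomorphic {h : (Fin n → ℂ) → ℝ} (hi : Integrable h)
    (hrot : ∀ c : ℂ, ‖c‖ = 1 → ∀ t, h (c • t) = h t) {δ : ℝ} (h0 : ∀ t, δ ≤ ‖t‖ → h t = 0)
    {O : Set (Fin n → ℂ)} {f : (Fin n → ℂ) → ℂ} (hf : DifferentiableOn ℂ f O)
    {z : Fin n → ℂ} (hb : Metric.closedBall z δ ⊆ O) :
    ∫ t, (h t : ℂ) * f (z + t) = ((∫ t, h t : ℝ) : ℂ) * f z := by
  have hc : ContinuousOn f (Metric.closedBall z δ) := hf.continuousOn.mono hb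
  have hK : IsCompact (Metric.closedBall z δ) := isCompact_closedBall z δ
  obtain ⟨C, hC⟩ := hK.exists_bound_of_continuousOn hc
  set g := (Metric.closedBall z δ).indicator f with hg
  have gm : Measurable g := by
    classical
    have := ContinuousOn.measurable_piecewise (s := Metric.closedBall z δ) (f := f) (g := 0) hc
      continuousOn_const hK.measurableSet
    rwa [Set.piecewise_eq_indicator] at this
  have gC : ∀ w, ‖g w‖ ≤ |C| := fun w => by
    by_cases hw : w ∈ Metric.closedBall z δ
    · rw [hg, indicator_of_mem hw]; exact (hC w hw).trans (le_abs_self C)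
    · rw [hg, indicator_of_notMem hw, norm_zero]; exact abs_nonneg C
  have gf : ∀ t, ‖t‖ < δ → g (z + t) = f (z + t) := fun t ht =>
    indicator_of_mem (by simpa [dist_eq_norm] using ht.le) f
  have e0 : ∫ t, (h t : ℂ) * f (z + t) = ∫ t, (h t : ℂ) * g (z + t) := by
    refine integral_congr_ae (ae_of_all _ fun t => ?_)
    by_cases ht : ‖t‖ < δ
    · simp only [gf t ht]
    · simp [h0 t (not_lt.1 ht)]
  have erot : ∀ θ : ℝ, ∫ t, (h t : ℂ) * g (z + Complex.exp (θ * Complex.I) • t) =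
      ∫ t, (h t : ℂ) * g (z + t) := by
    intro θ
    have mp := measurePreserving_circle_smul (n := n) (Circle.exp θ)
    have hm : AEStronglyMeasurable (fun t => (h t : ℂ) * g (z + t)) volume :=
      (Complex.continuous_ofReal.comp_aestronglyMeasurable hi.1).mul
        (gm.comp (measurable_const_add z)).aestronglyMeasurable
    have h1 : ∫ t, (h t : ℂ) * g (z + t) = ∫ t, (h (((Circle.exp θ : Circle) : ℂ) • t) : ℂ) *
        g (z + ((Circle.exp θ : Circle) : ℂ) • t) := by
      conv_lhs => rw [← mp.map_eq]
      exact integral_map mp.aemeasurable (by rwa [mp.map_eq])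
    rw [h1]
    simp only [Circle.coe_exp]
    simp only [hrot _ (Complex.norm_exp_ofReal_mul_I θ)]
  have hprod : Integrable (fun p : ℝ × (Fin n → ℂ) =>
      (h p.2 : ℂ) * g (z + Complex.exp (p.1 * Complex.I) • p.2))
      ((volume.restrict (Set.uIoc 0 (2 * Real.pi))).prod volume) := by
    have : IsFiniteMeasure ((volume : Measure ℝ).restrict (Set.uIoc 0 (2 * Real.pi))) := by
      rw [Set.uIoc]; infer_instance
    refine ((hi.comp_snd _).ofReal).mul_bdd (c := |C|) ?_ (ae_of_all _ fun p => gC _)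
    refine (gm.comp (Continuous.measurable ?_)).aestronglyMeasurable
    fun_prop
  have circ : ∀ t, ‖t‖ < δ → ∫ θ in (0 : ℝ)..2 * Real.pi,
      g (z + Complex.exp (θ * Complex.I) • t) = (2 * Real.pi : ℝ) * f z := by
    intro t ht
    have hmaps : ∀ s : ℂ, ‖s‖ ≤ 1 → z + s • t ∈ Metric.closedBall z δ := fun s hs => by
      rw [mem_closedBall_iff_norm, add_sub_cancel_left, norm_smul]
      exact (mul_le_of_le_one_left (norm_nonneg _) hs).trans ht.le
    have hd : DifferentiableOn ℂ (fun s : ℂ => f (z + s • t)) (Metric.closedBall 0 1) := by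
      refine hf.comp (Differentiable.differentiableOn (by fun_prop)) fun s hs => ?_
      exact hb (hmaps s (by simpa using hs))
    have h1 := (hd.diffContOnCl_ball (U := Metric.closedBall (0 : ℂ) 1) (c := 0) (R := |1|)
      (by rw [abs_one])).circleAverage (R := 1)
    rw [Real.circleAverage_def] at h1
    have e : ∫ θ in (0 : ℝ)..2 * Real.pi, g (z + Complex.exp (θ * Complex.I) • t) =
        ∫ θ in (0 : ℝ)..2 * Real.pi, f (z + circleMap 0 1 θ • t) := by
      refine intervalIntegral.integral_congr fun θ _ => ?_
      simp only [circleMap, Complex.ofReal_one, one_mul, zero_add]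
      exact indicator_of_mem (hmaps _ (Complex.norm_exp_ofReal_mul_I θ).le) f
    rw [e]
    have π0 : (2 * Real.pi : ℝ) ≠ 0 := by positivity
    rw [inv_smul_eq_iff₀ π0, zero_smul, add_zero, Complex.real_smul] at h1
    exact h1
  have fub : ∫ θ in (0 : ℝ)..2 * Real.pi, ∫ t, (h t : ℂ) *
      g (z + Complex.exp (θ * Complex.I) • t) =
      ∫ t, ∫ θ in (0 : ℝ)..2 * Real.pi, (h t : ℂ) * g (z + Complex.exp (θ * Complex.I) • t) :=
    intervalIntegral_integral_swap hprod
  simp only [erot, intervalIntegral.integral_const, intervalIntegral.integral_const_mul,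
    sub_zero, Complex.real_smul] at fub
  have e2 : ∫ t, (h t : ℂ) * ∫ θ in (0 : ℝ)..2 * Real.pi,
      g (z + Complex.exp (θ * Complex.I) • t) =
      ((2 * Real.pi : ℝ) : ℂ) * (((∫ t, h t : ℝ) : ℂ) * f z) := by
    rw [← integral_complex_ofReal, ← integral_mul_const, ← integral_const_mul]
    refine integral_congr_ae (ae_of_all _ fun t => ?_)
    by_cases ht : ‖t‖ < δ
    · simp only [circ t ht]; ring
    · simp [h0 t (not_lt.1 ht)]
  rw [e2] at fub
  have π0 : ((2 * Real.pi : ℝ) : ℂ) ≠ 0 := by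
    exact_mod_cast (by positivity : (2 * Real.pi : ℝ) ≠ 0)
  rw [e0]
  exact mul_left_cancel₀ π0 fub

theorem mol_holomorphic {δ : ℝ} (hδ : 0 < δ) {O : Set (Fin n → ℂ)} {f : (Fin n → ℂ) → ℂ}
    (hf : DifferentiableOn ℂ f O) {z : Fin n → ℂ}
    (hb : Metric.closedBall z δ ⊆ O) : mol n δ f z = f z := by
  have h := integral_mul_holomorphic (integrable_mollifier hδ)
    (fun c hc t => mollifier_congr δ fun j => by simp [hc])
    (fun t ht => mollifier_eq_zero hδ ht) hf hb
  rw [integral_mollifier hδ, Complex.ofReal_one, one_mul] at h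
  rw [← h, mol_apply_swap, ← integral_neg_eq_self]
  simp only [mollifier_neg, sub_neg_eq_add, Complex.real_smul]

/-- Near a compact set, a holomorphic function agrees with a globally smooth one. -/
theorem exists_contDiff_eq_holomorphic {O K : Set (Fin n → ℂ)} (hO : IsOpen O) (hK : IsCompact K)
    (hKO : K ⊆ O) {f : (Fin n → ℂ) → ℂ} (hf : DifferentiableOn ℂ f O) :
    ∃ g : (Fin n → ℂ) → ℂ, ContDiff ℝ 2 g ∧ ∀ z ∈ K, g =ᶠ[𝓝 z] f := by
  obtain ⟨δ₀, hδ₀, hthick⟩ := hK.exists_cthickening_subset_open hO hKO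
  set L := Metric.cthickening δ₀ K with hL
  have hLc : IsCompact L := hK.cthickening
  have hint : IntegrableOn f L := (hf.continuousOn.mono hthick).integrableOn_compact hLc
  have hloc : LocallyIntegrable (L.indicator f) :=
    (hint.integrable_indicator hLc.measurableSet).locallyIntegrable
  have δ0 : 0 < δ₀ / 2 := by positivity
  refine ⟨mol n (δ₀ / 2) (L.indicator f), contDiff_mol (k := 2) δ0 hloc, fun z hz => ?_⟩
  filter_upwards [Metric.ball_mem_nhds z δ0] with w hw
  have hwL : Metric.closedBall w (δ₀ / 2) ⊆ L := fun y hy =>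
    Metric.mem_cthickening_of_dist_le y z _ _ hz (by
      have := dist_triangle y w z
      rw [Metric.mem_closedBall] at hy
      rw [Metric.mem_ball] at hw
      linarith)
  rw [← mol_holomorphic δ0 hf (hwL.trans hthick)]
  exact mol_congr δ0 fun t ht => indicator_of_mem (hwL (Metric.ball_subset_closedBall ht)) f

theorem wderBar_eq_zero_of_differentiableAt {f : (Fin n → ℂ) → ℂ} {z : Fin n → ℂ}
    (hf : DifferentiableAt ℂ f z) (j : Fin n) : wderBar n j f z = 0 := by
  have e : (Pi.single j Complex.I : Fin n → ℂ) = Complex.I • Pi.single j (1 : ℂ) := by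
    rw [← Pi.single_smul]; simp
  rw [wderBar, hf.fderiv_restrictScalars ℝ, e]
  simp only [ContinuousLinearMap.coe_restrictScalars', map_smul, smul_eq_mul]
  rw [← mul_assoc, Complex.I_mul_I]
  ring

theorem differentiableAt_of_wderBar_eq_zero {f : (Fin n → ℂ) → ℂ} {z : Fin n → ℂ}
    (hf : DifferentiableAt ℝ f z) (h : ∀ j, wderBar n j f z = 0) : DifferentiableAt ℂ f z := by
  rw [differentiableAt_iff_restrictScalars ℝ hf]
  refine ⟨∑ j, (fderiv ℝ f z (Pi.single j 1)) •
    ContinuousLinearMap.proj (R := ℂ) (φ := fun _ : Fin n => ℂ) j, ?_⟩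
  have hI : ∀ j, fderiv ℝ f z (Pi.single j Complex.I) =
      Complex.I * fderiv ℝ f z (Pi.single j 1) := fun j => by
    have := h j
    rw [wderBar] at this
    have h2 : fderiv ℝ f z (Pi.single j 1) + Complex.I * fderiv ℝ f z (Pi.single j Complex.I) = 0 := by
      simpa using this
    linear_combination (-Complex.I) * h2 + fderiv ℝ f z (Pi.single j Complex.I) * Complex.I_mul_I
  ext X
  have eX : X = ∑ j, ((X j).re • (Pi.single j 1 : Fin n → ℂ) +
      (X j).im • (Pi.single j Complex.I : Fin n → ℂ)) := by
    ext k
    rw [Finset.sum_apply, Finset.sum_eq_single k]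
    · simp [Complex.re_add_im]
    · intro j _ hj; simp [Pi.single_eq_of_ne' hj]
    · simp
  conv_rhs => rw [eX]
  simp only [ContinuousLinearMap.coe_restrictScalars', map_sum, map_add, map_smul, hI,
    sum_apply, smul_apply, ContinuousLinearMap.proj_apply, smul_eq_mul, Complex.real_smul]
  refine Finset.sum_congr rfl fun j _ => ?_
  conv_lhs => rw [← Complex.re_add_im (X j)]
  ring

theorem integral_holomorphic_mul_wderBar {O : Set (Fin n → ℂ)} (hO : IsOpen O)
    {f : (Fin n → ℂ) → ℂ} (hf : DifferentiableOn ℂ f O) {θ : (Fin n → ℂ) → ℂ}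
    (hθ : ContDiff ℝ 1 θ) (hc : HasCompactSupport θ) (hs : tsupport θ ⊆ O) (j : Fin n) :
    ∫ z, f z * wderBar n j θ z = 0 := by
  obtain ⟨g, hg, hgf⟩ := exists_contDiff_eq_holomorphic hO hc hs hf
  have e : ∫ z, f z * wderBar n j θ z = ∫ z, g z * wderBar n j θ z := by
    refine integral_congr_ae (ae_of_all _ fun z => ?_)
    by_cases hz : z ∈ tsupport θ
    · simp only [(hgf z hz).eq_of_nhds]
    · simp only [wderBar_eq_zero_of_notMem j hz, mul_zero]
  have h := integral_wderBar_mul (hg.of_le (by norm_num)) hθ (Or.inr hc) j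
  have h0 : ∫ z, wderBar n j g z * θ z = 0 := by
    rw [← integral_zero (Fin n → ℂ) ℂ]
    refine integral_congr_ae (ae_of_all _ fun z => ?_)
    by_cases hz : z ∈ tsupport θ
    · simp only [wderBar_congr j (hgf z hz), wderBar_eq_zero_of_differentiableAt
        (hf.differentiableAt (hO.mem_nhds (hs hz))) j, zero_mul]
    · simp only [image_eq_zero_of_notMem_tsupport hz, mul_zero]
  rw [e]
  rw [h0] at h
  exact neg_eq_zero.1 h.symm

end Holomorphic

section Weyl

variable {n : ℕ}

theorem exists_enorm_mol_sq_le {δ : ℝ} (hδ : 0 < δ) : ∃ C : ℝ≥0∞, C ≠ ∞ ∧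
    ∀ (f : (Fin n → ℂ) → ℂ), AEStronglyMeasurable f → ∀ z,
      ‖mol n δ f z‖ₑ ^ 2 ≤ C * eLpNorm f 2 volume ^ 2 := by
  obtain ⟨C, hC⟩ := (hasCompactSupport_mollifier (n := n) hδ).exists_bound_of_continuous
    (continuous_mollifier δ)
  refine ⟨ENNReal.ofReal C, ENNReal.ofReal_ne_top, fun f hf z => ?_⟩
  have hm : AEMeasurable (fun t => ‖f (z - t)‖ₑ) :=
    (hf.comp_quasiMeasurePreserving
      (quasiMeasurePreserving_sub_left_of_right_invariant volume z)).enorm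
  have h1 : ‖mol n δ f z‖ₑ ≤ ∫⁻ t, ENNReal.ofReal (mollifier n δ t) * ‖f (z - t)‖ₑ := by
    rw [mol_apply_swap]
    refine (enorm_integral_le_lintegral_enorm _).trans (le_of_eq ?_)
    congr 1; ext t
    rw [enorm_smul, Real.enorm_eq_ofReal (mollifier_nonneg hδ t)]
  calc ‖mol n δ f z‖ₑ ^ 2
      ≤ (∫⁻ t, ENNReal.ofReal (mollifier n δ t) * ‖f (z - t)‖ₑ) ^ 2 := by gcongr
    _ ≤ ∫⁻ t, ENNReal.ofReal (mollifier n δ t) * ‖f (z - t)‖ₑ ^ 2 :=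
        lintegral_mul_sq_le (continuous_mollifier δ).measurable.ennreal_ofReal hm
          (lintegral_mollifier hδ)
    _ ≤ ∫⁻ t, ENNReal.ofReal C * ‖f (z - t)‖ₑ ^ 2 := by
        refine lintegral_mono fun t => ?_
        gcongr
        exact (le_abs_self _).trans (hC t)
    _ = ENNReal.ofReal C * ∫⁻ t, ‖f (z - t)‖ₑ ^ 2 := lintegral_const_mul' _ _ ENNReal.ofReal_ne_top
    _ = ENNReal.ofReal C * eLpNorm f 2 volume ^ 2 := by
        rw [eLpNorm_two_sq, lintegral_sub_left_eq_self (fun t => ‖f t‖ₑ ^ 2) z]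

theorem tendsto_mol_mol {δ : ℝ} (hδ : 0 < δ) {f : (Fin n → ℂ) → ℂ} (hf : MemLp f 2)
    (z : Fin n → ℂ) :
    Tendsto (fun δ' : ℝ => mol n δ (mol n δ' f) z) (𝓝[>] 0) (𝓝 (mol n δ f z)) := by
  have hloc : LocallyIntegrable f := hf.locallyIntegrable (by norm_num)
  obtain ⟨C, hC, hle⟩ := exists_enorm_mol_sq_le (n := n) hδ
  have h0 : Tendsto (fun δ' : ℝ => C * eLpNorm (fun x => mol n δ' f x - f x) 2 volume ^ 2)
      (𝓝[>] 0) (𝓝 0) := by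
    have h2 := ((ENNReal.continuous_pow 2).tendsto 0).comp (tendsto_eLpNorm_mol_sub hf)
    have := ENNReal.Tendsto.const_mul h2 (Or.inr hC)
    simpa [Function.comp_def] using this
  have h1 : ∀ᶠ δ' : ℝ in 𝓝[>] 0, ‖mol n δ (mol n δ' f) z - mol n δ f z‖ₑ ^ 2 ≤
      C * eLpNorm (fun x => mol n δ' f x - f x) 2 volume ^ 2 := by
    filter_upwards [self_mem_nhdsWithin] with δ' hδ'
    have hδ'0 : 0 < δ' := hδ'
    have hl : LocallyIntegrable (mol n δ' f) :=
      (contDiff_mol (k := 0) hδ'0 hloc).continuous.locallyIntegrable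
    have e : mol n δ (mol n δ' f) z - mol n δ f z = mol n δ (fun x => mol n δ' f x - f x) z := by
      rw [mol_apply δ (fun x => mol n δ' f x - f x), mol_apply δ (mol n δ' f), mol_apply δ f]
      simp only [smul_sub]
      exact (integral_sub (integrable_mollifier_smul hδ hl z)
        (integrable_mollifier_smul hδ hloc z)).symm
    rw [e]
    exact hle _ (hl.aestronglyMeasurable.sub hloc.aestronglyMeasurable) z
  have h3 : Tendsto (fun δ' : ℝ => ‖mol n δ (mol n δ' f) z - mol n δ f z‖ₑ ^ 2) (𝓝[>] 0) (𝓝 0) :=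
    tendsto_of_tendsto_of_tendsto_of_le_of_le' tendsto_const_nhds h0
      (Eventually.of_forall fun _ => zero_le) h1
  have h4 : Tendsto (fun δ' : ℝ => ‖mol n δ (mol n δ' f) z - mol n δ f z‖ₑ) (𝓝[>] 0) (𝓝 0) := by
    have := (ENNReal.continuous_rpow_const (y := (1 / 2 : ℝ))).tendsto 0 |>.comp h3
    refine (this.congr fun δ' => ?_).trans (by simp)
    simp only [Function.comp_apply]
    rw [← ENNReal.rpow_natCast, ← ENNReal.rpow_mul]
    norm_num
  rw [tendsto_iff_edist_tendsto_0]
  simpa only [edist_eq_enorm_sub] using h4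

variable {Ω : Set (Fin n → ℂ)} {f : (Fin n → ℂ) → ℂ}

theorem differentiableAt_mol_of_weak (hf : LocallyIntegrable f)
    (hw : ∀ θ : (Fin n → ℂ) → ℂ, ContDiff ℝ 2 θ → HasCompactSupport θ → tsupport θ ⊆ Ω →
      ∀ j, ∫ z, f z * wderBar n j θ z = 0) {δ : ℝ} (hδ : 0 < δ) {z : Fin n → ℂ}
    (hz : Metric.closedBall z δ ⊆ Ω) : DifferentiableAt ℂ (mol n δ f) z := by
  refine differentiableAt_of_wderBar_eq_zero
    ((contDiff_mol (k := 1) hδ hf).differentiable (by norm_num) z) fun j => ?_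
  rw [wderBar_mol hδ hf, hw _ (contDiff_molTest (k := 2) δ z) (hasCompactSupport_molTest hδ z)
    ((tsupport_molTest_subset hδ z).trans hz) j, neg_zero]

theorem tendsto_mol_of_weak (hf : MemLp f 2)
    (hw : ∀ θ : (Fin n → ℂ) → ℂ, ContDiff ℝ 2 θ → HasCompactSupport θ → tsupport θ ⊆ Ω →
      ∀ j, ∫ z, f z * wderBar n j θ z = 0) {δ s : ℝ} (hδ : 0 < δ) (hs : 0 < s) {z : Fin n → ℂ}
    (hz : Metric.closedBall z (δ + 2 * s) ⊆ Ω) :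
    Tendsto (fun δ' : ℝ => mol n δ' f z) (𝓝[>] 0) (𝓝 (mol n δ f z)) := by
  have hloc : LocallyIntegrable f := hf.locallyIntegrable (by norm_num)
  refine (tendsto_mol_mol hδ hf z).congr' ?_
  filter_upwards [Ioo_mem_nhdsGT hs] with δ' hδ'
  refine mol_holomorphic hδ (O := Metric.ball z (δ + s)) (fun w hw' => ?_)
    (Metric.closedBall_subset_ball (by linarith))
  refine (differentiableAt_mol_of_weak hloc hw hδ'.1
    ((Metric.closedBall_subset_closedBall' ?_).trans hz)).differentiableWithinAt
  have := Metric.mem_ball.1 hw'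
  linarith [hδ'.2]

/-- Weyl's lemma for the Cauchy-Riemann operator on square-integrable functions. -/
theorem exists_holomorphic_of_weak (hΩ : IsOpen Ω) (hf : MemLp f 2)
    (hw : ∀ θ : (Fin n → ℂ) → ℂ, ContDiff ℝ 2 θ → HasCompactSupport θ → tsupport θ ⊆ Ω →
      ∀ j, ∫ z, f z * wderBar n j θ z = 0) :
    ∃ g : (Fin n → ℂ) → ℂ, DifferentiableOn ℂ g Ω ∧ ∀ᵐ z, z ∈ Ω → g z = f z := by
  have hloc : LocallyIntegrable f := hf.locallyIntegrable (by norm_num)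
  set g : (Fin n → ℂ) → ℂ := fun z => limUnder (𝓝[>] (0 : ℝ)) fun δ => mol n δ f z with hg
  have key : ∀ z ∈ Ω, ∃ s > 0, Metric.closedBall z s ⊆ Ω ∧ ∀ w ∈ Metric.ball z s,
      Tendsto (fun δ' : ℝ => mol n δ' f w) (𝓝[>] 0) (𝓝 (mol n s f w)) := by
    intro z hz
    obtain ⟨r, hr, hrΩ⟩ := Metric.isOpen_iff.1 hΩ z hz
    have hr4 : 0 < r / 4 := by linarith
    refine ⟨r / 4, hr4, (Metric.closedBall_subset_ball (by linarith)).trans hrΩ, fun w hw' => ?_⟩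
    refine tendsto_mol_of_weak (s := r / 8) hf hw hr4 (by linarith)
      (fun x hx => hrΩ ?_)
    have h1 := Metric.mem_closedBall.1 hx
    have h2 := Metric.mem_ball.1 hw'
    exact Metric.mem_ball.2 (by linarith [dist_triangle x w z])
  have hlim : ∀ z ∈ Ω, Tendsto (fun δ' : ℝ => mol n δ' f z) (𝓝[>] 0) (𝓝 (g z)) := fun z hz => by
    obtain ⟨s, hs, -, h⟩ := key z hz
    exact tendsto_nhds_limUnder ⟨_, h z (Metric.mem_ball_self hs)⟩
  refine ⟨g, fun z hz => ?_, ?_⟩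
  · obtain ⟨s, hs, hsΩ, h⟩ := key z hz
    have e : g =ᶠ[𝓝 z] mol n s f := by
      filter_upwards [Metric.ball_mem_nhds z hs] with w hw'
      exact (h w hw').limUnder_eq
    exact ((differentiableAt_mol_of_weak hloc hw hs hsΩ).congr_of_eventuallyEq
      e).differentiableWithinAt
  · have hm : ∀ k : ℕ, AEStronglyMeasurable (mol n (1 / ((k : ℝ) + 1)) f) volume := fun k =>
      (contDiff_mol (k := 0) Nat.one_div_pos_of_nat hloc).continuous.aestronglyMeasurable
    have hseq : Tendsto (fun k : ℕ => 1 / ((k : ℝ) + 1)) atTop (𝓝[>] 0) :=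
      tendsto_nhdsWithin_iff.2 ⟨tendsto_one_div_add_atTop_nhds_zero_nat,
        Eventually.of_forall fun k => mem_Ioi.2 Nat.one_div_pos_of_nat⟩
    have h1 : TendstoInMeasure volume (fun k : ℕ => mol n (1 / ((k : ℝ) + 1)) f) atTop f :=
      tendstoInMeasure_of_tendsto_eLpNorm two_ne_zero hm hf.1
        ((tendsto_eLpNorm_mol_sub hf).comp hseq)
    obtain ⟨ns, hns, hae⟩ := h1.exists_seq_tendsto_ae
    filter_upwards [hae] with z hz hzΩ
    exact tendsto_nhds_unique ((hlim z hzΩ).comp (hseq.comp hns.tendsto_atTop)) hz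

end Weyl

section PoleWeight

variable {n : ℕ}

theorem norm_sq_mul_integral_le {h : (Fin n → ℂ) → ℝ} (hi : Integrable h) (hn : ∀ t, 0 ≤ h t)
    (hrot : ∀ c : ℂ, ‖c‖ = 1 → ∀ t, h (c • t) = h t) {δ : ℝ} (h0 : ∀ t, δ ≤ ‖t‖ → h t = 0)
    {O : Set (Fin n → ℂ)} {f : (Fin n → ℂ) → ℂ} (hf : DifferentiableOn ℂ f O)
    {z : Fin n → ℂ} (hb : Metric.closedBall z δ ⊆ O) :
    ‖f z‖ ^ 2 * ∫ t, h t ≤ ∫ t, ‖f (z + t)‖ ^ 2 * h t := by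
  have h1 := integral_mul_holomorphic hi hrot h0 (hf.pow 2) hb
  have h2 : ‖((∫ t, h t : ℝ) : ℂ) * f z ^ 2‖ = ‖f z‖ ^ 2 * ∫ t, h t := by
    rw [norm_mul, norm_pow, Complex.norm_real, Real.norm_of_nonneg (integral_nonneg hn), mul_comm]
  rw [← h2, show f z ^ 2 = (f ^ 2) z from rfl, ← h1]
  refine (norm_integral_le_integral_norm _).trans (le_of_eq ?_)
  congr 1; ext t
  simp only [Pi.pow_apply, norm_mul, norm_pow, Complex.norm_real, Real.norm_of_nonneg (hn t)]
  ring

theorem sqDist_nonneg (p z : Fin n → ℂ) : 0 ≤ sqDist p z :=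
  Finset.sum_nonneg fun _ _ => sq_nonneg _

theorem norm_sub_sq_le_sqDist (p z : Fin n → ℂ) : ‖z - p‖ ^ 2 ≤ sqDist p z := by
  have h : ‖z - p‖ ≤ √(sqDist p z) := (pi_norm_le_iff_of_nonneg (Real.sqrt_nonneg _)).2 fun j =>
    Real.le_sqrt_of_sq_le (Finset.single_le_sum (f := fun j => ‖z j - p j‖ ^ 2)
      (fun _ _ => sq_nonneg _) (Finset.mem_univ j))
  calc ‖z - p‖ ^ 2 ≤ √(sqDist p z) ^ 2 := by gcongr
    _ = sqDist p z := Real.sq_sqrt (sqDist_nonneg p z)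

theorem sqDist_le (p z : Fin n → ℂ) : sqDist p z ≤ n * ‖z - p‖ ^ 2 := by
  calc sqDist p z ≤ ∑ _j : Fin n, ‖z - p‖ ^ 2 := Finset.sum_le_sum fun j _ => by
        gcongr; exact norm_le_pi_norm (z - p) j
    _ = n * ‖z - p‖ ^ 2 := by simp

/-- A strictly plurisubharmonic weight with a regularized logarithmic pole at `p`. -/
noncomputable def poleWeight (p : Fin n → ℂ) (ε : ℝ) (z : Fin n → ℂ) : ℝ :=
  (n + 1) * Real.log (sqDist p z + ε ^ 2) + sqDist p z

theorem sqDist_add_sq_pos {ε : ℝ} (hε : 0 < ε) (p z : Fin n → ℂ) : 0 < sqDist p z + ε ^ 2 := by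
  have := sqDist_nonneg p z
  positivity

theorem contDiff_poleWeight {ε : ℝ} (hε : 0 < ε) (p : Fin n → ℂ) :
    ContDiff ℝ 2 (poleWeight p ε) :=
  (contDiff_const.mul (((contDiff_sqDist p).add contDiff_const).log
    fun z => (sqDist_add_sq_pos hε p z).ne')).add (contDiff_sqDist p)

theorem exp_neg_poleWeight {ε : ℝ} (hε : 0 < ε) (p z : Fin n → ℂ) :
    Real.exp (-poleWeight p ε z) =
      ((sqDist p z + ε ^ 2) ^ (n + 1))⁻¹ * Real.exp (-sqDist p z) := by
  have h := sqDist_add_sq_pos hε p z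
  have e : (n + 1 : ℝ) * Real.log (sqDist p z + ε ^ 2) =
      Real.log ((sqDist p z + ε ^ 2) ^ (n + 1)) := by rw [Real.log_pow]; push_cast; ring
  rw [poleWeight, e, neg_add, Real.exp_add, Real.exp_neg, Real.exp_log (by positivity)]

theorem le_levi_poleWeight {ε : ℝ} (hε : 0 < ε) (p z X : Fin n → ℂ) :
    ∑ j, ‖X j‖ ^ 2 ≤ levi (poleWeight p ε) z X := by
  have h := sqDist_add_sq_pos hε p z
  have hc : ContDiff ℝ 2 fun w => Real.log (sqDist p w + ε ^ 2) :=
    ((contDiff_sqDist p).add contDiff_const).log fun z => (sqDist_add_sq_pos hε p z).ne'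
  have e : levi (poleWeight p ε) z X =
      (n + 1) * levi (fun w => Real.log (sqDist p w + ε ^ 2)) z X + levi (sqDist p) z X := by
    rw [← levi_const_mul _ hc, ← levi_add (contDiff_const.mul hc) (contDiff_sqDist p)]
    rfl
  have hl : 0 ≤ levi (fun w => Real.log (sqDist p w + ε ^ 2)) z X := by
    rw [levi_comp (g := fun x => Real.log (x + ε ^ 2)) (g' := fun x => (x + ε ^ 2)⁻¹)
      (g'' := fun x => -1 / (x + ε ^ 2) ^ 2)
      (fun w => by
        simpa using ((hasDerivAt_id (sqDist p w)).add_const (ε ^ 2)).log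
          (sqDist_add_sq_pos hε p w).ne') (contDiff_sqDist p) z X
      (by simpa using ((hasDerivAt_id (sqDist p z)).add_const (ε ^ 2)).fun_inv h.ne'),
      levi_sqDist]
    have h1 := fderiv_sqDist_sq_add p z X
    have hX : 0 ≤ ∑ j, ‖X j‖ ^ 2 := Finset.sum_nonneg fun _ _ => sq_nonneg _
    have h2 : (sqDist p z + ε ^ 2)⁻¹ * ∑ j, ‖X j‖ ^ 2 =
        (1 / 4) * (1 / (sqDist p z + ε ^ 2) ^ 2) *
          (4 * ((sqDist p z + ε ^ 2) * ∑ j, ‖X j‖ ^ 2)) := by field_simp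
    have h3 : (fderiv ℝ (sqDist p) z X) ^ 2 + (fderiv ℝ (sqDist p) z (Complex.I • X)) ^ 2 ≤
        4 * ((sqDist p z + ε ^ 2) * ∑ j, ‖X j‖ ^ 2) := by nlinarith [sq_nonneg ε]
    have h4 := mul_le_mul_of_nonneg_left h3
      (by positivity : 0 ≤ 1 / 4 * (1 / (sqDist p z + ε ^ 2) ^ 2))
    rw [h2, neg_div]
    linarith
  rw [e, levi_sqDist]
  have : 0 ≤ (n + 1 : ℝ) * levi (fun w => Real.log (sqDist p w + ε ^ 2)) z X := by positivity
  linarith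

/-- The masses of the weights `exp (-poleWeight 0 ε)` on a fixed ball blow up as `ε → 0`. -/
theorem exists_integral_exp_neg_poleWeight_ge {r : ℝ} (hr : 0 < r) (M : ℝ) :
    ∃ ε, 0 < ε ∧ ε ≤ 1 ∧
      M ≤ ∫ t in Metric.ball (0 : Fin n → ℂ) r, Real.exp (-poleWeight 0 ε t) := by
  set V : ℝ := volume.real (Metric.ball (0 : Fin n → ℂ) 1) with hV
  have V0 : 0 < V := by
    refine ENNReal.toReal_pos (Metric.measure_ball_pos _ _ one_pos).ne' measure_ball_lt_top.ne
  set c : ℝ := ((n + 1 : ℝ) ^ (n + 1))⁻¹ * Real.exp (-n) * V with hc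
  have c0 : 0 < c := by positivity
  have hlim : Tendsto (fun ε : ℝ => c * (ε ^ 2)⁻¹) (𝓝[>] 0) atTop := by
    refine Tendsto.const_mul_atTop c0 (Tendsto.inv_tendsto_nhdsGT_zero ?_)
    refine tendsto_nhdsWithin_iff.2 ⟨?_, ?_⟩
    · have : Tendsto (fun ε : ℝ => ε ^ 2) (𝓝 0) (𝓝 (0 ^ 2)) := (continuous_pow 2).tendsto 0
      rw [zero_pow two_ne_zero] at this
      exact this.mono_left nhdsWithin_le_nhds
    · filter_upwards [self_mem_nhdsWithin] with ε hε
      have : (0 : ℝ) < ε := hε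
      exact mem_Ioi.2 (by positivity)
  obtain ⟨ε, hM, hε⟩ := ((hlim.eventually_ge_atTop M).and
    (Ioo_mem_nhdsGT (lt_min hr one_pos))).exists
  have ε0 : 0 < ε := hε.1
  have εr : ε < r := hε.2.trans_le (min_le_left _ _)
  have ε1 : ε < 1 := hε.2.trans_le (min_le_right _ _)
  refine ⟨ε, ε0, ε1.le, hM.trans ?_⟩
  have hcont : Continuous fun t : Fin n → ℂ => Real.exp (-poleWeight 0 ε t) :=
    Real.continuous_exp.comp (contDiff_poleWeight ε0 0).continuous.neg
  have hint : ∀ s : ℝ, IntegrableOn (fun t : Fin n → ℂ => Real.exp (-poleWeight 0 ε t))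
      (Metric.ball 0 s) := fun s =>
    (hcont.continuousOn.integrableOn_compact (isCompact_closedBall 0 s)).mono_set
      Metric.ball_subset_closedBall
  have hvol : volume.real (Metric.ball (0 : Fin n → ℂ) ε) = ε ^ (2 * n) * V := by
    rw [measureReal_def, Measure.addHaar_ball_of_pos _ _ ε0, ENNReal.toReal_mul,
      ENNReal.toReal_ofReal (by positivity)]
    have : Module.finrank ℝ (Fin n → ℂ) = 2 * n := by
      rw [Module.finrank_pi_fintype]; simp [mul_comm]
    rw [this]
    rfl
  calc c * (ε ^ 2)⁻¹
      = ((((n + 1) * ε ^ 2) ^ (n + 1))⁻¹ * Real.exp (-n)) *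
          volume.real (Metric.ball (0 : Fin n → ℂ) ε) := by
        rw [hvol, hc, mul_pow]
        field_simp
        ring
    _ = ∫ t in Metric.ball (0 : Fin n → ℂ) ε, (((n + 1) * ε ^ 2) ^ (n + 1))⁻¹ * Real.exp (-n) := by
        rw [setIntegral_const, smul_eq_mul, mul_comm]
    _ ≤ ∫ t in Metric.ball (0 : Fin n → ℂ) ε, Real.exp (-poleWeight 0 ε t) := by
        refine setIntegral_mono_on (integrableOn_const measure_ball_lt_top.ne) (hint ε)
          measurableSet_ball fun t ht => ?_
        rw [exp_neg_poleWeight ε0]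
        have ht' : ‖t‖ < ε := by simpa using ht
        have h1 := sqDist_le 0 t
        rw [sub_zero] at h1
        have h2 : ‖t‖ ^ 2 ≤ ε ^ 2 := by gcongr
        have h3 : sqDist 0 t ≤ n * ε ^ 2 := h1.trans (by gcongr)
        have h4 : sqDist 0 t ≤ n := h3.trans (mul_le_of_le_one_right (by positivity) (by nlinarith))
        have h5 := sqDist_add_sq_pos ε0 0 t
        gcongr
        linarith
    _ ≤ _ := setIntegral_mono_set (hint r) (ae_of_all _ fun t => (Real.exp_pos _).le)
        (Metric.ball_subset_ball εr.le).eventuallyLE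

end PoleWeight

section CutoffForm

variable {n : ℕ} {Ω U : Set (Fin n → ℂ)} {f χ : (Fin n → ℂ) → ℂ}

theorem integrable_holomorphic_mul_wderBar {O : Set (Fin n → ℂ)} (hO : IsOpen O)
    (hf : DifferentiableOn ℂ f O) {θ : (Fin n → ℂ) → ℂ}
    (hθ : ContDiff ℝ 1 θ) (hc : HasCompactSupport θ) (hs : tsupport θ ⊆ O) (j : Fin n) :
    Integrable (fun z => f z * wderBar n j θ z) := by
  obtain ⟨g, hg, hgf⟩ := exists_contDiff_eq_holomorphic hO hc hs hf
  have e : (fun z => f z * wderBar n j θ z) = fun z => g z * wderBar n j θ z := by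
    ext z
    by_cases hz : z ∈ tsupport θ
    · simp only [(hgf z hz).eq_of_nhds]
    · simp only [wderBar_eq_zero_of_notMem j hz, mul_zero]
  rw [e]
  exact (hg.continuous.mul (contDiff_wderBar (m := 0) j hθ
    (by norm_num)).continuous).integrable_of_hasCompactSupport (hc.wderBar j).mul_left

/-- The form `f ∂̄χ` on `U ∩ Ω`, extended by zero. -/
noncomputable def cutoffForm (O : Set (Fin n → ℂ)) (f χ : (Fin n → ℂ) → ℂ) (j : Fin n) :
    (Fin n → ℂ) → ℂ :=
  O.indicator fun z => f z * wderBar n j χ z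

theorem tsupport_mul_subset_inter {χ θ : (Fin n → ℂ) → ℂ} (hχ : tsupport χ ⊆ U)
    (hθ : tsupport θ ⊆ Ω) : tsupport (fun z => χ z * θ z) ⊆ U ∩ Ω := fun _ hz =>
  ⟨hχ (tsupport_mul_subset_left hz), hθ (tsupport_mul_subset_right hz)⟩

theorem integral_cutoffForm_closed (hΩ : IsOpen Ω) (hU : IsOpen U)
    (hf : DifferentiableOn ℂ f (U ∩ Ω)) (hχ : ContDiff ℝ 2 χ) (hχU : tsupport χ ⊆ U)
    {θ : (Fin n → ℂ) → ℂ} (hθ : ContDiff ℝ 2 θ) (hc : HasCompactSupport θ) (hs : tsupport θ ⊆ Ω)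
    (j k : Fin n) :
    ∫ z, (cutoffForm (U ∩ Ω) f χ j z * wderBar n k θ z -
      cutoffForm (U ∩ Ω) f χ k z * wderBar n j θ z) = 0 := by
  have hO := hU.inter hΩ
  have cθ : ∀ k, ContDiff ℝ 1 (wderBar n k θ) := fun k => contDiff_wderBar k hθ (by norm_num)
  have cψ : ∀ k, ContDiff ℝ 1 fun z => χ z * wderBar n k θ z := fun k =>
    (hχ.of_le (by norm_num)).mul (cθ k)
  have sψ : ∀ k, tsupport (fun z => χ z * wderBar n k θ z) ⊆ U ∩ Ω := fun k =>
    tsupport_mul_subset_inter hχU ((tsupport_wderBar_subset k θ).trans hs)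
  have kψ : ∀ k, HasCompactSupport fun z => χ z * wderBar n k θ z := fun k =>
    (hc.wderBar k).mul_left
  have e : ∀ z, cutoffForm (U ∩ Ω) f χ j z * wderBar n k θ z -
      cutoffForm (U ∩ Ω) f χ k z * wderBar n j θ z =
      f z * wderBar n j (fun z => χ z * wderBar n k θ z) z -
        f z * wderBar n k (fun z => χ z * wderBar n j θ z) z := by
    intro z
    have dχ := hχ.differentiable (by norm_num) z
    rw [wderBar_mul j dχ ((cθ k).differentiable (by norm_num) z),
      wderBar_mul k dχ ((cθ j).differentiable (by norm_num) z), wderBar_wderBar_comm hθ j k]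
    by_cases hz : z ∈ U ∩ Ω
    · simp only [cutoffForm, indicator_of_mem hz]; ring
    · simp only [cutoffForm, indicator_of_notMem hz, zero_mul, sub_zero]
      by_cases hzU : z ∈ U
      · have hzθ : z ∉ tsupport θ := fun h => hz ⟨hzU, hs h⟩
        simp [wderBar_eq_zero_of_notMem _ hzθ]
      · have hzχ : z ∉ tsupport χ := fun h => hzU (hχU h)
        simp [wderBar_eq_zero_of_notMem _ hzχ]
  simp only [e]
  rw [integral_sub (integrable_holomorphic_mul_wderBar hO hf (cψ k) (kψ k) (sψ k) j)
    (integrable_holomorphic_mul_wderBar hO hf (cψ j) (kψ j) (sψ j) k),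
    integral_holomorphic_mul_wderBar hO hf (cψ k) (kψ k) (sψ k) j,
    integral_holomorphic_mul_wderBar hO hf (cψ j) (kψ j) (sψ j) k, sub_zero]

theorem memLp_indicator_mul {O : Set (Fin n → ℂ)} (hO : IsOpen O) (hf : DifferentiableOn ℂ f O)
    (hf2 : IntegrableOn (fun z => ‖f z‖ ^ 2) O) {κ : (Fin n → ℂ) → ℂ} (hκ : Continuous κ)
    (hc : HasCompactSupport κ) : MemLp (O.indicator fun z => f z * κ z) 2 := by
  obtain ⟨C, hC⟩ := hc.exists_bound_of_continuous hκ
  rw [memLp_indicator_iff_restrict hO.measurableSet]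
  have h1 : MemLp f 2 (volume.restrict O) :=
    (memLp_two_iff_integrable_sq_norm (hf.continuousOn.aestronglyMeasurable hO.measurableSet)).2 hf2
  refine h1.of_le_mul (c := C) (h1.1.mul hκ.aestronglyMeasurable) (ae_of_all _ fun z => ?_)
  rw [norm_mul, mul_comm]
  gcongr
  exact hC z

theorem integral_cutoff_eq (hΩ : IsOpen Ω) (hU : IsOpen U)
    (hf : DifferentiableOn ℂ f (U ∩ Ω)) (hf2 : IntegrableOn (fun z => ‖f z‖ ^ 2) (U ∩ Ω))
    (hχ : ContDiff ℝ 2 χ) (hχc : HasCompactSupport χ) (hχU : tsupport χ ⊆ U)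
    {θ : (Fin n → ℂ) → ℂ} (hθ : ContDiff ℝ 2 θ) (hc : HasCompactSupport θ) (hs : tsupport θ ⊆ Ω)
    (j : Fin n) :
    ∫ z, (U ∩ Ω).indicator (fun z => f z * χ z) z * wderBar n j θ z =
      -∫ z, cutoffForm (U ∩ Ω) f χ j z * θ z := by
  have hO := hU.inter hΩ
  have i1 := integrable_mul_continuous_compact
    ((memLp_indicator_mul hO hf hf2 hχ.continuous hχc).locallyIntegrable (by norm_num))
    (contDiff_wderBar (m := 0) j hθ (by norm_num)).continuous (hc.wderBar j)
  have i2 := integrable_mul_continuous_compact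
    ((memLp_indicator_mul hO hf hf2 (contDiff_wderBar (m := 0) j hχ (by norm_num)).continuous
      (hχc.wderBar j)).locallyIntegrable (by norm_num)) hθ.continuous hc
  rw [eq_neg_iff_add_eq_zero]
  unfold cutoffForm
  rw [← integral_add i1 i2, ← integral_holomorphic_mul_wderBar hO hf
    ((hχ.mul hθ).of_le (by norm_num)) hc.mul_left (tsupport_mul_subset_inter hχU hs) j]
  congr 1; ext z
  rw [wderBar_mul j (hχ.differentiable (by norm_num) z) (hθ.differentiable (by norm_num) z)]
  by_cases hz : z ∈ U ∩ Ω
  · simp only [indicator_of_mem hz]; ring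
  · simp only [indicator_of_notMem hz, zero_mul, add_zero]
    by_cases hzU : z ∈ U
    · have hzθ : z ∉ tsupport θ := fun h => hz ⟨hzU, hs h⟩
      simp [wderBar_eq_zero_of_notMem _ hzθ, image_eq_zero_of_notMem_tsupport hzθ]
    · have hzχ : z ∉ tsupport χ := fun h => hzU (hχU h)
      simp [wderBar_eq_zero_of_notMem _ hzχ, image_eq_zero_of_notMem_tsupport hzχ]

end CutoffForm

section Extension

variable {n : ℕ}

theorem poleWeight_add (p t : Fin n → ℂ) (ε : ℝ) :
    poleWeight p ε (p + t) = poleWeight 0 ε t := by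
  simp [poleWeight, sqDist]

theorem norm_sq_mul_integral_ball_le {ε r : ℝ} (hε : 0 < ε) {p : Fin n → ℂ}
    {O : Set (Fin n → ℂ)} {g u : (Fin n → ℂ) → ℂ} (hg : DifferentiableOn ℂ g O)
    (hr : Metric.closedBall p r ⊆ O) (hgu : ∀ᵐ z, z ∈ Metric.ball p r → g z = u z)
    (hu : Integrable fun z => ‖u z‖ ^ 2 * Real.exp (-poleWeight p ε z)) :
    ‖g p‖ ^ 2 * ∫ t in Metric.ball (0 : Fin n → ℂ) r, Real.exp (-poleWeight 0 ε t) ≤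
      ∫ z, ‖u z‖ ^ 2 * Real.exp (-poleWeight p ε z) := by
  have hcont : Continuous fun t : Fin n → ℂ => Real.exp (-poleWeight 0 ε t) :=
    Real.continuous_exp.comp (contDiff_poleWeight hε 0).continuous.neg
  set h := (Metric.ball (0 : Fin n → ℂ) r).indicator fun t => Real.exp (-poleWeight 0 ε t) with hh
  have hi : Integrable h := (integrable_indicator_iff measurableSet_ball).2
    ((hcont.continuousOn.integrableOn_compact (isCompact_closedBall 0 r)).mono_set
      Metric.ball_subset_closedBall)
  have hn : ∀ t, 0 ≤ h t := fun t => indicator_nonneg (fun _ _ => (Real.exp_pos _).le) t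
  have hrot : ∀ c : ℂ, ‖c‖ = 1 → ∀ t, h (c • t) = h t := by
    intro c hc t
    have e : poleWeight 0 ε (c • t) = poleWeight 0 ε t := by simp [poleWeight, sqDist, hc]
    have e' : c • t ∈ Metric.ball (0 : Fin n → ℂ) r ↔ t ∈ Metric.ball 0 r := by
      simp [norm_smul, hc]
    by_cases ht : t ∈ Metric.ball (0 : Fin n → ℂ) r
    · rw [hh, indicator_of_mem ht, indicator_of_mem (e'.2 ht), e]
    · rw [hh, indicator_of_notMem ht, indicator_of_notMem (mt e'.1 ht)]
  have h0 : ∀ t, r ≤ ‖t‖ → h t = 0 := fun t ht =>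
    indicator_of_notMem (by simpa using ht) _
  rw [← integral_indicator measurableSet_ball]
  refine (norm_sq_mul_integral_le hi hn hrot h0 hg hr).trans ?_
  have e : ∫ t, ‖g (p + t)‖ ^ 2 * h t = ∫ z, ‖g z‖ ^ 2 * h (z - p) := by
    have := integral_add_left_eq_self (μ := volume) (fun z => ‖g z‖ ^ 2 * h (z - p)) p
    simpa only [add_sub_cancel_left] using this
  rw [e]
  refine integral_mono_of_nonneg (ae_of_all _ fun z => mul_nonneg (sq_nonneg _) (hn _)) hu ?_
  filter_upwards [hgu] with z hz
  by_cases hzr : z ∈ Metric.ball p r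
  · have h1 : z - p ∈ Metric.ball 0 r := by simpa [dist_eq_norm] using hzr
    have h2 := poleWeight_add p (z - p) ε
    rw [add_sub_cancel] at h2
    rw [hz hzr, hh, indicator_of_mem h1, h2]
  · have h1 : z - p ∉ Metric.ball 0 r := by simpa [dist_eq_norm] using hzr
    rw [hh, indicator_of_notMem h1, mul_zero]
    positivity

theorem one_le_mul_exp_neg_poleWeight {ε D : ℝ} (hε : 0 < ε) (hε1 : ε ≤ 1) {p z : Fin n → ℂ}
    (hD : sqDist p z ≤ D) :
    1 ≤ ((D + 1) ^ (n + 1) * Real.exp D) * Real.exp (-poleWeight p ε z) := by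
  have h0 := sqDist_nonneg p z
  have h1 := sqDist_add_sq_pos hε p z
  have h2 : sqDist p z + ε ^ 2 ≤ D + 1 := by nlinarith
  rw [exp_neg_poleWeight hε]
  calc (1 : ℝ) = ((sqDist p z + ε ^ 2) ^ (n + 1) * Real.exp (sqDist p z)) *
        (((sqDist p z + ε ^ 2) ^ (n + 1))⁻¹ * Real.exp (-sqDist p z)) := by
        rw [Real.exp_neg]; field_simp
    _ ≤ _ := by
        have : 0 ≤ D + 1 := by linarith
        gcongr

theorem exp_neg_poleWeight_le {ε δ : ℝ} (hε : 0 < ε) (hδ : 0 < δ) {p z : Fin n → ℂ}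
    (hz : δ ≤ ‖z - p‖) : Real.exp (-poleWeight p ε z) ≤ ((δ ^ 2) ^ (n + 1))⁻¹ := by
  have h1 := norm_sub_sq_le_sqDist p z
  have h2 : δ ^ 2 ≤ ‖z - p‖ ^ 2 := by gcongr
  have h3 := sqDist_nonneg p z
  rw [exp_neg_poleWeight hε]
  calc ((sqDist p z + ε ^ 2) ^ (n + 1))⁻¹ * Real.exp (-sqDist p z)
      ≤ ((sqDist p z + ε ^ 2) ^ (n + 1))⁻¹ * 1 := by
        gcongr
        exact Real.exp_le_one_iff.2 (by linarith)
    _ ≤ ((δ ^ 2) ^ (n + 1))⁻¹ := by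
        rw [mul_one]
        gcongr
        nlinarith [sq_nonneg ε]

variable {W U Ω : Set (Fin n → ℂ)}

/-- Holomorphic functions on `U ∩ Ω` are corrected to holomorphic functions on `Ω` with a uniform
`L²` bound, keeping the value at a given point of `W ∩ Ω` up to a factor. -/
theorem exists_bergman_extension (hΩ : IsOpen Ω) (hb : Bornology.IsBounded Ω)
    (hS : SmoothExhaustible n Ω) (hWo : IsOpen W) (hUo : IsOpen U) (hWU : closure W ⊆ U)
    (hWc : IsCompact (closure W)) :
    ∃ C > (0 : ℝ), ∀ p ∈ W ∩ Ω, ∀ f, InBergman n (U ∩ Ω) f → f p = 1 →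
      ∃ g, InBergman n Ω g ∧ g p = 1 ∧ l2sq n Ω g ≤ C * l2sq n (U ∩ Ω) f := by
  obtain ⟨η, hη, hηc, hηU, hη1, hη01⟩ := exists_cutoff hWc hUo hWU
  set χ : (Fin n → ℂ) → ℂ := fun z => (η z : ℂ) with hχdef
  have hχ : ContDiff ℝ 2 χ := contDiff_ofReal_comp hη
  have hχs : tsupport χ ⊆ tsupport η := closure_mono fun z hz h => hz (by simp [hχdef, h])
  have hχc : HasCompactSupport χ := hηc.of_isClosed_subset (isClosed_tsupport _) hχs
  have hχU : tsupport χ ⊆ U := hχs.trans hηU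
  have χ1 : ∀ z, ‖χ z‖ ≤ 1 := fun z => by
    rw [hχdef, Complex.norm_real, Real.norm_of_nonneg (hη01 z).1]; exact (hη01 z).2
  have cχ : ∀ j, Continuous (wderBar n j χ) := fun j =>
    (contDiff_wderBar (m := 0) j hχ (by norm_num)).continuous
  choose b hb' using fun j => (hχc.wderBar j).exists_bound_of_continuous (cχ j)
  obtain ⟨δ, δ0, hδ⟩ := hWc.exists_cthickening_subset_open
    (isOpen_interior (s := {z | η z = 1})) fun z hz => mem_interior_iff_mem_nhds.2 (hη1 z hz)
  obtain ⟨R, hR⟩ := Metric.isBounded_iff.1 hb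
  set B : ℝ := ∑ j, b j ^ 2 with hBdef
  have B0 : 0 ≤ B := Finset.sum_nonneg fun _ _ => sq_nonneg _
  have hB : ∀ z, ∑ j, ‖wderBar n j χ z‖ ^ 2 ≤ B := fun z =>
    Finset.sum_le_sum fun j _ => by gcongr; exact hb' j z
  set D : ℝ := n * R ^ 2 with hD
  have D0 : 0 ≤ D := by positivity
  set E : ℝ := (D + 1) ^ (n + 1) * Real.exp D with hE
  have E0 : 0 ≤ E := by positivity
  set Q : ℝ := ((δ ^ 2) ^ (n + 1))⁻¹ with hQ
  have Q0 : 0 ≤ Q := by positivity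
  refine ⟨8 + 16 * (E * (B * Q)), by positivity, fun p hp f hf hfp => ?_⟩
  have hO : IsOpen (U ∩ Ω) := hUo.inter hΩ
  set A := l2sq n (U ∩ Ω) f with hA
  have A0 : 0 ≤ A := integral_nonneg fun z => sq_nonneg _
  obtain ⟨r, r0, hr⟩ := Metric.nhds_basis_closedBall.mem_iff.1 ((hWo.inter hΩ).mem_nhds hp)
  obtain ⟨ε, ε0, ε1, hε⟩ := exists_integral_exp_neg_poleWeight_ge (n := n) r0 (8 * (B * Q * A) + 1)
  have hφ := contDiff_poleWeight ε0 p
  have mα : ∀ j, MemLp (cutoffForm (U ∩ Ω) f χ j) 2 := fun j =>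
    memLp_indicator_mul hO hf.1 hf.2 (cχ j) (hχc.wderBar j)
  obtain ⟨u, hu, hdb, hui, hule⟩ := exists_dbar_solution hΩ hS hb hφ (le_levi_poleWeight ε0 p) mα
    (fun j z hz => indicator_of_notMem (fun h => hz h.2) _)
    (fun θ hθ hc hs j k => integral_cutoffForm_closed hΩ hUo hf.1 hχ hχU hθ hc hs j k)
  set v := (U ∩ Ω).indicator fun z => f z * χ z with hv
  have mv : MemLp v 2 := memLp_indicator_mul hO hf.1 hf.2 hχ.continuous hχc
  -- the weighted estimate of the correction term
  have hα : ∫ z, (∑ j, ‖cutoffForm (U ∩ Ω) f χ j z‖ ^ 2) * Real.exp (-poleWeight p ε z) ≤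
      B * Q * A := by
    rw [hA, l2sq, ← integral_indicator hO.measurableSet, ← integral_const_mul]
    refine integral_mono_of_nonneg (ae_of_all _ fun z => by positivity)
      (((integrable_indicator_iff hO.measurableSet).2 hf.2).const_mul _) (ae_of_all _ fun z => ?_)
    by_cases hz : z ∈ U ∩ Ω
    · simp only [cutoffForm, indicator_of_mem hz, norm_mul, mul_pow, ← Finset.mul_sum]
      by_cases hzδ : δ ≤ ‖z - p‖
      · calc ‖f z‖ ^ 2 * (∑ j, ‖wderBar n j χ z‖ ^ 2) * Real.exp (-poleWeight p ε z)
            ≤ ‖f z‖ ^ 2 * B * Q := by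
              gcongr
              · exact hB z
              · exact exp_neg_poleWeight_le ε0 δ0 hzδ
          _ = B * Q * ‖f z‖ ^ 2 := by ring
      · have hz1 : z ∈ interior {z | η z = 1} := hδ (Metric.mem_cthickening_of_dist_le z p δ _
          (subset_closure hp.1) (by rw [dist_eq_norm]; exact (not_le.1 hzδ).le))
        have e1 : χ =ᶠ[𝓝 z] fun _ => 1 := by
          filter_upwards [mem_interior_iff_mem_nhds.1 hz1] with w hw
          have : η w = 1 := hw
          simp [hχdef, this]
        have e2 : ∀ j, wderBar n j χ z = 0 := fun j => by
          rw [wderBar_congr j e1]; simp [wderBar]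
        simp only [e2]
        simp
        positivity
    · simp [cutoffForm, indicator_of_notMem hz]
  have hu2 : ∫ z, ‖u z‖ ^ 2 * Real.exp (-poleWeight p ε z) ≤ 2 * (B * Q * A) :=
    hule.trans (by gcongr)
  obtain ⟨g, hg, hgF⟩ := exists_holomorphic_of_weak hΩ (mv.sub hu) fun θ hθ hc hs j => by
    have i1 := integrable_mul_continuous_compact (mv.locallyIntegrable (by norm_num))
      (contDiff_wderBar (m := 0) j hθ (by norm_num)).continuous (hc.wderBar j)
    have i2 := integrable_mul_continuous_compact (hu.locallyIntegrable (by norm_num))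
      (contDiff_wderBar (m := 0) j hθ (by norm_num)).continuous (hc.wderBar j)
    simp only [Pi.sub_apply, sub_mul]
    rw [integral_sub i1 i2, hdb θ hθ hc hs j,
      integral_cutoff_eq hΩ hUo hf.1 hf.2 hχ hχc hχU hθ hc hs j, sub_self]
  -- the correction is small at `p`
  have hgp : (1 : ℝ) / 2 ≤ ‖g p‖ := by
    have hWsub : W ∩ Ω ⊆ U ∩ Ω := inter_subset_inter_left _ (subset_closure.trans hWU)
    have h1 := norm_sq_mul_integral_ball_le ε0 (g := fun z => f z - g z) (u := u)
      ((hf.1.mono hWsub).sub (hg.mono inter_subset_right)) hr (by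
        filter_upwards [hgF] with z hz hzr
        have hzW := hr (Metric.ball_subset_closedBall hzr)
        have e1 : χ z = 1 := by
          have := (hη1 z (subset_closure hzW.1)).eq_of_nhds
          simp [hχdef, this]
        rw [hz hzW.2, Pi.sub_apply, hv, indicator_of_mem (hWsub hzW), e1]
        ring) hui
    rw [hfp] at h1
    have h2 : ‖1 - g p‖ ^ 2 * (8 * (B * Q * A) + 1) ≤ 2 * (B * Q * A) :=
      (mul_le_mul_of_nonneg_left hε (sq_nonneg _)).trans (h1.trans hu2)
    have h3 : ‖1 - g p‖ ≤ 1 / 2 := by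
      have : 0 ≤ B * Q * A := by positivity
      by_contra! h
      have h4 : (1 / 2 : ℝ) ^ 2 < ‖1 - g p‖ ^ 2 := by gcongr
      nlinarith
    have h5 := norm_sub_norm_le (1 : ℂ) (1 - g p)
    rw [sub_sub_cancel, norm_one] at h5
    linarith
  have gp0 : g p ≠ 0 := norm_pos_iff.1 (by linarith)
  -- the `L²` bound
  have iv : Integrable fun z => ‖v z‖ ^ 2 := (memLp_two_iff_integrable_sq_norm mv.1).1 mv
  have iu : Integrable fun z => ‖u z‖ ^ 2 := (memLp_two_iff_integrable_sq_norm hu.1).1 hu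
  have iF : Integrable fun z => ‖v z - u z‖ ^ 2 :=
    (memLp_two_iff_integrable_sq_norm (mv.sub hu).1).1 (mv.sub hu)
  have eg : (fun z => ‖g z‖ ^ 2) =ᵐ[volume.restrict Ω] fun z => ‖v z - u z‖ ^ 2 := by
    filter_upwards [(ae_restrict_iff' hΩ.measurableSet).2 hgF] with z hz
    rw [hz, Pi.sub_apply]
  have ig : IntegrableOn (fun z => ‖g z‖ ^ 2) Ω := iF.integrableOn.congr eg.symm
  have bv : ∫ z, ‖v z‖ ^ 2 ≤ A := by
    rw [hA, l2sq, ← integral_indicator hO.measurableSet]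
    refine integral_mono iv ((integrable_indicator_iff hO.measurableSet).2 hf.2) fun z => ?_
    by_cases hz : z ∈ U ∩ Ω
    · simp only [hv, indicator_of_mem hz, norm_mul, mul_pow]
      exact mul_le_of_le_one_right (sq_nonneg _) (pow_le_one₀ (norm_nonneg _) (χ1 z))
    · simp [hv, indicator_of_notMem hz]
  have bu : ∫ z in Ω, ‖u z‖ ^ 2 ≤ E * (2 * (B * Q * A)) := by
    calc ∫ z in Ω, ‖u z‖ ^ 2
        ≤ ∫ z in Ω, E * (‖u z‖ ^ 2 * Real.exp (-poleWeight p ε z)) := by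
          refine setIntegral_mono_on iu.integrableOn (hui.const_mul E).integrableOn
            hΩ.measurableSet fun z hz => ?_
          have h1 : sqDist p z ≤ D := (sqDist_le p z).trans (by
            rw [hD, ← dist_eq_norm]
            gcongr
            exact hR hz hp.2)
          have h2 := one_le_mul_exp_neg_poleWeight ε0 ε1 h1
          nlinarith [sq_nonneg ‖u z‖]
      _ ≤ ∫ z, E * (‖u z‖ ^ 2 * Real.exp (-poleWeight p ε z)) :=
          setIntegral_le_integral (hui.const_mul E) (ae_of_all _ fun z => by positivity)
      _ ≤ E * (2 * (B * Q * A)) := by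
          rw [integral_const_mul]; gcongr
  have bg : ∫ z in Ω, ‖g z‖ ^ 2 ≤ (2 + 4 * (E * (B * Q))) * A := by
    calc ∫ z in Ω, ‖g z‖ ^ 2 = ∫ z in Ω, ‖v z - u z‖ ^ 2 := integral_congr_ae eg
      _ ≤ ∫ z in Ω, (2 * ‖v z‖ ^ 2 + 2 * ‖u z‖ ^ 2) := by
          refine integral_mono iF.integrableOn
            ((iv.const_mul 2).add (iu.const_mul 2)).integrableOn fun z => ?_
          have h1 := norm_sub_le (v z) (u z)
          have h2 : ‖v z - u z‖ ^ 2 ≤ (‖v z‖ + ‖u z‖) ^ 2 := by gcongr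
          nlinarith [sq_nonneg (‖v z‖ - ‖u z‖)]
      _ = 2 * (∫ z in Ω, ‖v z‖ ^ 2) + 2 * ∫ z in Ω, ‖u z‖ ^ 2 := by
          rw [integral_add (iv.const_mul 2).integrableOn (iu.const_mul 2).integrableOn,
            integral_const_mul, integral_const_mul]
      _ ≤ 2 * A + 2 * (E * (2 * (B * Q * A))) := by
          gcongr
          exact (setIntegral_le_integral iv (ae_of_all _ fun z => sq_nonneg _)).trans bv
      _ = (2 + 4 * (E * (B * Q))) * A := by ring
  have en : ∀ z, ‖g z / g p‖ ^ 2 = (‖g p‖ ^ 2)⁻¹ * ‖g z‖ ^ 2 := fun z => by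
    rw [norm_div, div_pow, div_eq_inv_mul]
  refine ⟨fun z => g z / g p, ⟨by simpa only [div_eq_mul_inv] using hg.mul_const (g p)⁻¹, ?_⟩, div_self gp0, ?_⟩
  · simp only [en]
    exact ig.const_mul _
  · simp only [l2sq, en]
    rw [integral_const_mul]
    have h1 : (‖g p‖ ^ 2)⁻¹ ≤ 4 := by
      rw [inv_le_comm₀ (by positivity) (by norm_num)]
      nlinarith
    calc (‖g p‖ ^ 2)⁻¹ * ∫ z in Ω, ‖g z‖ ^ 2 ≤ 4 * ((2 + 4 * (E * (B * Q))) * A) :=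
          mul_le_mul h1 bg (integral_nonneg fun _ => sq_nonneg _) (by norm_num)
      _ = (8 + 16 * (E * (B * Q))) * A := by ring

end Extension

section MinimumIntegral

variable {n : ℕ}

theorem bddBelow_minimumIntegral (Ω : Set (Fin n → ℂ)) (p : Fin n → ℂ) :
    BddBelow {r | ∃ f, InBergman n Ω f ∧ f p = 1 ∧ r = l2sq n Ω f} := by
  refine ⟨0, ?_⟩
  rintro r ⟨f, -, -, rfl⟩
  exact integral_nonneg fun z => sq_nonneg _

theorem nonempty_minimumIntegral {Ω : Set (Fin n → ℂ)} (hb : Bornology.IsBounded Ω)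
    (p : Fin n → ℂ) : {r | ∃ f, InBergman n Ω f ∧ f p = 1 ∧ r = l2sq n Ω f}.Nonempty :=
  ⟨_, fun _ => 1, ⟨differentiableOn_const _, integrableOn_const hb.measure_lt_top.ne⟩, rfl, rfl⟩

theorem I0_mono {Ω Ω' : Set (Fin n → ℂ)} (h : Ω' ⊆ Ω) (hb : Bornology.IsBounded Ω)
    (p : Fin n → ℂ) : I0 n Ω' p ≤ I0 n Ω p := by
  refine le_csInf (nonempty_minimumIntegral hb p) ?_
  rintro r ⟨f, hf, hfp, rfl⟩
  exact (csInf_le (bddBelow_minimumIntegral Ω' p) ⟨f, ⟨hf.1.mono h, hf.2.mono_set h⟩, hfp, rfl⟩).trans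
    (setIntegral_mono_set hf.2 (ae_of_all _ fun z => sq_nonneg _) h.eventuallyLE)

end MinimumIntegral

end

/-- Localization of the minimum integral `I⁰`: for a bounded pseudoconvex domain
`Ω ⊂ ℂⁿ`, `z₀ ∈ ∂Ω`, and open neighborhoods `W ⊂⊂ U` of `z₀`, there is `C₀ > 0` with
`I⁰_{U∩Ω}(p) ≤ I⁰_Ω(p) ≤ C₀ · I⁰_{U∩Ω}(p)` for all `p ∈ W ∩ Ω`. -/
theorem I0_localization
    {n : ℕ} (Ω : Set (Fin n → ℂ)) (hΩ : IsOpen Ω) (hb : Bornology.IsBounded Ω)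
    (hconn : IsPreconnected Ω) (hpsc : PseudoconvexExh n Ω)
    (z₀ : Fin n → ℂ) (hz₀ : z₀ ∈ frontier Ω)
    (W U : Set (Fin n → ℂ)) (hWo : IsOpen W) (hUo : IsOpen U)
    (hz₀W : z₀ ∈ W) (hWU : closure W ⊆ U) (hWc : IsCompact (closure W)) :
    ∃ C₀ > (0:ℝ), ∀ p ∈ W ∩ Ω,
      I0 n (U ∩ Ω) p ≤ I0 n Ω p ∧ I0 n Ω p ≤ C₀ * I0 n (U ∩ Ω) p := by
  obtain ⟨C, C0, hC⟩ := exists_bergman_extension hΩ hb (hpsc.smoothExhaustible hΩ hb) hWo hUo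
    hWU hWc
  refine ⟨C, C0, fun p hp => ⟨I0_mono inter_subset_right hb p, ?_⟩⟩
  have hle : C⁻¹ * I0 n Ω p ≤ I0 n (U ∩ Ω) p := by
    refine le_csInf (nonempty_minimumIntegral (hb.subset inter_subset_right) p) ?_
    rintro r ⟨f, hf, hfp, rfl⟩
    obtain ⟨g, hg, hgp, hle⟩ := hC p hp f hf hfp
    rw [inv_mul_le_iff₀ C0]
    exact (csInf_le (bddBelow_minimumIntegral Ω p) ⟨g, hg, hgp, rfl⟩).trans hle
  rwa [inv_mul_le_iff₀ C0] at hle
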